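/- arXiv:2506.01528 — 3 statements merged into one kernel-verified Lean document; each statement's English description precedes it below -/
import Mathlib

section
/- Let (K,|·|) be a non-Archimedean nontrivially valued field, n ≥ 2, and let ‖·‖ be a non-Archimedean norm on K^n equivalent to the maximum norm ‖·‖_∞. Then for every x₀ ∈ K^n and every r > 0 such that the sphere S[x₀,r] = {x ∈ K^n : ‖x−x₀‖ = r} is nonempty, S[x₀,r] is paradoxical using four pieces with respect to the group IA(K^n,‖·‖) of affine isometries of (K^n,‖·‖). -/
/-- `v` is a non-Archimedean valuation on the field `K`: it is nonnegative, vanishes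
exactly at `0`, is multiplicative, and satisfies the strong triangle inequality. -/
def IsNAVal {K : Type*} [Field K] (v : K → ℝ) : Prop :=
  (∀ x, 0 ≤ v x) ∧ (∀ x, v x = 0 ↔ x = 0) ∧
    (∀ x y, v (x * y) = v x * v y) ∧ (∀ x y, v (x + y) ≤ max (v x) (v y))

/-- `N` is a non-Archimedean norm on the `K`-vector space `X` with respect to the
valuation `v` on `K`. -/
def IsNANorm {K : Type*} [Field K] (v : K → ℝ) {X : Type*} [AddCommGroup X] [Module K X]
    (N : X → ℝ) : Prop :=
  (∀ x, 0 ≤ N x) ∧ (∀ x, N x = 0 ↔ x = 0) ∧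
    (∀ (c : K) (x : X), N (c • x) = v c * N x) ∧ (∀ x y, N (x + y) ≤ max (N x) (N y))

/-- The maximum norm `‖x‖_∞ = max_i v (x i)` on `K^n`. -/
noncomputable def maxNorm {K : Type*} [Field K] (v : K → ℝ) {n : ℕ} (x : Fin n → K) : ℝ :=
  sSup (Set.range fun i => v (x i))

/-- `f ∈ IA(K^n, N)`: `f` is a surjective affine isometry of `(K^n, N)`. -/
def MemIA {K : Type*} [Field K] {n : ℕ} (N : (Fin n → K) → ℝ)
    (f : (Fin n → K) → Fin n → K) : Prop :=
  (∃ (A : Matrix (Fin n) (Fin n) K) (τ : Fin n → K), ∀ x, f x = A.mulVec x + τ) ∧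
    Function.Surjective f ∧ ∀ x y, N (f x - f y) = N (x - y)

/-- A nonempty set `E ⊆ X` is paradoxical using `r` pieces with respect to the
set `S` of transformations of `X`: there are `m, k ≥ 1` with `m + k = r`,
pairwise disjoint pieces `A₁, …, A_m, B₁, …, B_k ⊆ E` covering `E`, and
transformations `g i, h j ∈ S` such that the images `g i '' A i` partition `E`
and the images `h j '' B j` partition `E`. -/
def ParadoxicalUsing {X : Type*} (S : Set (X → X)) (E : Set X) (r : ℕ) : Prop :=
  ∃ (m k : ℕ), 1 ≤ m ∧ 1 ≤ k ∧ m + k = r ∧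
    ∃ (A : Fin m → Set X) (B : Fin k → Set X) (g : Fin m → X → X) (h : Fin k → X → X),
      (∀ i, g i ∈ S) ∧ (∀ j, h j ∈ S) ∧
      (∀ i, A i ⊆ E) ∧ (∀ j, B j ⊆ E) ∧
      (∀ i i', i ≠ i' → Disjoint (A i) (A i')) ∧
      (∀ j j', j ≠ j' → Disjoint (B j) (B j')) ∧
      (∀ i j, Disjoint (A i) (B j)) ∧
      ((⋃ i, A i) ∪ ⋃ j, B j) = E ∧
      (∀ i i', i ≠ i' → Disjoint (g i '' A i) (g i' '' A i')) ∧
      (⋃ i, g i '' A i) = E ∧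
      (∀ j j', j ≠ j' → Disjoint (h j '' B j) (h j' '' B j')) ∧
      (⋃ j, h j '' B j) = E

/-! Part 1: abstract ping-pong -/
theorem pp_word {α Y : Type*} (φ : FreeGroup α → Y → Y)
    (hmul : ∀ g h y, φ (g * h) y = φ g (φ h y)) (Y0 : Set Y)
    (hY0 : ∀ g, ∀ y ∈ Y0, φ g y ∈ Y0) (C : α × Bool → Set Y) (σ : Y → ℝ)
    (hC : ∀ s s', s ≠ s' → ∀ y, y ∈ C s → y ∉ C s')
    (hs : ∀ s, ∀ y ∈ Y0, y ∉ C (s.1, !s.2) →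
      φ (FreeGroup.mk [s]) y ∈ C s ∧ σ y < σ (φ (FreeGroup.mk [s]) y)) :
    ∀ (L : List (α × Bool)) (s : α × Bool), FreeGroup.IsReduced (s :: L) →
      ∀ l ∈ (s :: L).getLast?, ∀ y ∈ Y0, y ∉ C (l.1, !l.2) →
      φ (FreeGroup.mk (s :: L)) y ∈ C s ∧ σ y < σ (φ (FreeGroup.mk (s :: L)) y) := by
  intro L
  induction L with
  | nil =>
    intro s _ l hl y hy hyC
    simp at hl
    subst hl
    exact hs s y hy hyC
  | cons s' L ih =>
    intro s hred l hl y hy hyC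
    rw [FreeGroup.isReduced_cons_cons] at hred
    have hl' : l ∈ (s' :: L).getLast? := by simpa [List.getLast?_cons_cons] using hl
    obtain ⟨h1, h2⟩ := ih s' hred.2 l hl' y hy hyC
    have he : FreeGroup.mk (s :: s' :: L) = FreeGroup.mk [s] * FreeGroup.mk (s' :: L) := by
      simp
    rw [he, hmul]
    have h3 : s' ≠ (s.1, !s.2) := by
      intro h
      have := hred.1
      rw [h] at this
      simp at this
    obtain ⟨h4, h5⟩ := hs s _ (hY0 (FreeGroup.mk (s' :: L)) y hy) (hC _ _ h3 _ h1)
    exact ⟨h4, h2.trans h5⟩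

theorem pp_free {α Y : Type*} (φ : FreeGroup α → Y → Y)
    (hone : ∀ y, φ 1 y = y)
    (hmul : ∀ g h y, φ (g * h) y = φ g (φ h y)) (Y0 : Set Y)
    (hY0 : ∀ g, ∀ y ∈ Y0, φ g y ∈ Y0) (C : α × Bool → Set Y) (σ : Y → ℝ)
    (hC : ∀ s s', s ≠ s' → ∀ y, y ∈ C s → y ∉ C s')
    (hs : ∀ s, ∀ y ∈ Y0, y ∉ C (s.1, !s.2) →
      φ (FreeGroup.mk [s]) y ∈ C s ∧ σ y < σ (φ (FreeGroup.mk [s]) y))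
    (g : FreeGroup α) (hg : g ≠ 1) (y : Y) (hy : y ∈ Y0) : φ g y ≠ y := by
  classical
  -- cyclically reduced words
  have key : ∀ (L : List (α × Bool)) (s : α × Bool), FreeGroup.IsCyclicallyReduced (s :: L) →
      ∀ y ∈ Y0, φ (FreeGroup.mk (s :: L)) y ≠ y := by
    intro L s hcyc y hy hfix
    obtain ⟨hred, hc⟩ := hcyc
    obtain ⟨l, hl⟩ : ∃ l, l ∈ (s :: L).getLast? := ⟨_, List.getLast?_eq_getLast_of_ne_nil (by simp)⟩
    by_cases hyC : y ∈ C (l.1, !l.2)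
    · have hne : (l.1, !l.2) ≠ s := by
        intro h
        have := hc l hl s (by simp) (by rw [← h])
        rw [← h] at this
        simp at this
      have hys := hC _ _ hne y hyC
      have hfix' : φ (FreeGroup.mk (FreeGroup.invRev (s :: L))) y = y := by
        rw [← FreeGroup.inv_mk]
        conv_lhs => rw [← hfix]
        rw [← hmul, inv_mul_cancel, hone]
      have hred' : FreeGroup.IsReduced (FreeGroup.invRev (s :: L)) := by
        rw [FreeGroup.isReduced_iff_reduce_eq, FreeGroup.reduce_invRev, hred.reduce_eq]
      have hlast : (s.1, !s.2) ∈ (FreeGroup.invRev (s :: L)).getLast? := by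
        simp [FreeGroup.invRev]
      generalize hM : FreeGroup.invRev (s :: L) = M at *
      cases M with
      | nil => simp at hlast
      | cons s2 L2 =>
        have := (pp_word φ hmul Y0 hY0 C σ hC hs L2 s2 hred' _ hlast y hy (by simpa using hys)).2
        rw [hfix'] at this
        exact lt_irrefl _ this
    · have := (pp_word φ hmul Y0 hY0 C σ hC hs L s hred l hl y hy hyC).2
      rw [hfix] at this
      exact lt_irrefl _ this
  intro hfix
  have hdec := FreeGroup.reduceCyclically.conj_conjugator_reduceCyclically g.toWord
  set c := FreeGroup.reduceCyclically.conjugator g.toWord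
  have hcyc : FreeGroup.IsCyclicallyReduced (FreeGroup.reduceCyclically g.toWord) :=
    FreeGroup.reduceCyclically.isCyclicallyReduced FreeGroup.isReduced_toWord
  generalize FreeGroup.reduceCyclically g.toWord = k at *
  have hg' : g = FreeGroup.mk c * FreeGroup.mk k * (FreeGroup.mk c)⁻¹ := by
    rw [FreeGroup.inv_mk, FreeGroup.mul_mk, FreeGroup.mul_mk, hdec, FreeGroup.mk_toWord]
  cases k with
  | nil =>
    apply hg
    rw [hg', ← FreeGroup.one_eq_mk, mul_one, mul_inv_cancel]
  | cons s L =>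
    apply key L s hcyc (φ (FreeGroup.mk c)⁻¹ y) (hY0 _ _ hy)
    have h1 : φ (FreeGroup.mk c)⁻¹ (φ g y) = φ (FreeGroup.mk c)⁻¹ y := by rw [hfix]
    rw [hg', ← hmul] at h1
    rw [← hmul]
    convert h1 using 2
    group

/-! Part 2: paradox of a set with a free action -/
theorem mem_sw_iff {α : Type*} [DecidableEq α] (w : α × Bool) (g : FreeGroup α) :
    FreeGroup.mk [w] * g ∈ FreeGroup.startsWith w ↔ g ∉ FreeGroup.startsWith (w.1, !w.2) := by
  refine ⟨fun h hg => ?_, FreeGroup.startsWith_mk_mul g⟩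
  have h2 : (FreeGroup.mk [w] * g).toWord = g.toWord.tail := by
    unfold FreeGroup.startsWith at hg
    have hr : FreeGroup.IsReduced g.toWord := FreeGroup.isReduced_toWord
    have e : g = FreeGroup.mk g.toWord := FreeGroup.mk_toWord.symm
    simp only [Set.mem_ofPred_eq] at hg
    generalize g.toWord = L at *
    cases L with
    | nil => simp at hg
    | cons x L =>
      simp at hg
      subst hg
      have : FreeGroup.mk [w] * g = FreeGroup.mk L := by
        have e2 : FreeGroup.mk ((w.1, !w.2) :: L) = FreeGroup.mk [(w.1, !w.2)] * FreeGroup.mk L := by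
          simp
        have e3 : FreeGroup.mk [(w.1, !w.2)] = (FreeGroup.mk [w])⁻¹ := by
          simp [FreeGroup.inv_mk, FreeGroup.invRev]
        rw [e, e2, e3, mul_inv_cancel_left]
      rw [this, FreeGroup.toWord_mk, List.tail_cons]
      exact (hr.infix ⟨[(w.1, !w.2)], [], by simp⟩).reduce_eq
  unfold FreeGroup.startsWith at h hg
  have hr : FreeGroup.IsReduced g.toWord := FreeGroup.isReduced_toWord
  simp only [Set.mem_ofPred_eq] at h hg
  rw [h2] at h
  generalize g.toWord = L at *
  cases L with
  | nil => simp at hg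
  | cons x L =>
    cases L with
    | nil => simp at h
    | cons y L =>
      simp at h hg
      subst h hg
      rw [FreeGroup.isReduced_cons_cons] at hr
      simp at hr

/-- four-piece decomposition of the free group -/
theorem free_four : ∃ A1 A2 B1 B2 : Set (FreeGroup Bool),
    (∀ g, (g ∈ A1 ∧ g ∉ A2 ∧ g ∉ B1 ∧ g ∉ B2) ∨ (g ∉ A1 ∧ g ∈ A2 ∧ g ∉ B1 ∧ g ∉ B2) ∨
      (g ∉ A1 ∧ g ∉ A2 ∧ g ∈ B1 ∧ g ∉ B2) ∨ (g ∉ A1 ∧ g ∉ A2 ∧ g ∉ B1 ∧ g ∈ B2)) ∧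
    (∀ g, (FreeGroup.of true)⁻¹ * g ∈ A2 ↔ g ∉ A1) ∧
    (∀ g, (FreeGroup.of false)⁻¹ * g ∈ B2 ↔ g ∉ B1) := by
  let Pw : Set (FreeGroup Bool) := {g | ∃ k : ℕ, g = ((FreeGroup.of false)⁻¹) ^ k}
  have e : ∀ i : Bool, (FreeGroup.of i)⁻¹ = FreeGroup.mk [(i, false)] := by
    intro i; simp [FreeGroup.of, FreeGroup.inv_mk, FreeGroup.invRev]
  have hPw : ∀ g ∈ Pw, g = 1 ∨ g ∈ FreeGroup.startsWith (false, false) := by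
    rintro g ⟨k, rfl⟩
    cases k with
    | zero => left; simp
    | succ k =>
      right
      unfold FreeGroup.startsWith
      have : ((FreeGroup.of false)⁻¹ ^ (k+1) : FreeGroup Bool).toWord
          = List.replicate (k+1) (false, false) := by
        rw [inv_pow, FreeGroup.toWord_inv, FreeGroup.toWord_of_pow]
        simp [FreeGroup.invRev]
      simp only [Set.mem_ofPred_eq, this]
      simp
  have hPw2 : ∀ g, (FreeGroup.of false)⁻¹ * g ∈ Pw ↔ (g ∈ Pw ∨ g = FreeGroup.of false) := by
    intro g
    constructor
    · rintro ⟨k, hk⟩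
      cases k with
      | zero => right; rw [pow_zero, inv_mul_eq_one] at hk; exact hk.symm
      | succ k => left; rw [pow_succ'] at hk; exact ⟨k, mul_left_cancel hk⟩
    · rintro (⟨k, rfl⟩ | rfl)
      · exact ⟨k+1, by rw [pow_succ']⟩
      · exact ⟨0, by simp⟩
  have hof : FreeGroup.of false ∈ FreeGroup.startsWith (false, true) := by
    simp [FreeGroup.startsWith]
  have h1P : (1 : FreeGroup Bool) ∈ Pw := ⟨0, by simp⟩
  refine ⟨FreeGroup.startsWith (true, true), FreeGroup.startsWith (true, false),
    FreeGroup.startsWith (false, true) ∪ Pw, FreeGroup.startsWith (false, false) \ Pw, ?_, ?_, ?_⟩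
  · intro g
    have hg1 := hPw g
    have hcase : g = 1 ∨ g.toWord[0]? ≠ none := by
      by_cases h : g.toWord = []
      · left; exact FreeGroup.toWord_eq_nil_iff.1 h
      · right; simpa using h
    simp only [Set.mem_union, Set.mem_sdiff]
    rcases hcase with rfl | hc
    · simp [FreeGroup.startsWith, h1P]
    · obtain ⟨⟨i, j⟩, hx⟩ := Option.ne_none_iff_exists'.1 hc
      have hne : g ≠ 1 := by rintro rfl; simp at hx
      have hsw : ∀ s, g ∈ FreeGroup.startsWith s ↔ (i, j) = s := by
        intro s; simp [FreeGroup.startsWith, hx]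
      simp only [hsw] at hg1 ⊢
      by_cases hp : g ∈ Pw
      · have := (hg1 hp).resolve_left hne
        simp at this
        obtain ⟨rfl, rfl⟩ := this
        simp [hp]
      · cases i <;> cases j <;> simp [hp]
  · intro g
    rw [e, mem_sw_iff]
    rfl
  · intro g
    simp only [Set.mem_union, Set.mem_sdiff, hPw2]
    rw [e, mem_sw_iff]
    simp only [Bool.not_false]
    by_cases h : g = FreeGroup.of false
    · subst h; simp [hof]
    · simp [h]

theorem paradox_of_free {X : Type*} (S : Set (X → X)) (E : Set X)
    (Φ : FreeGroup Bool →* Equiv.Perm X)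
    (hE : ∀ g, ∀ x ∈ E, Φ g x ∈ E) (hfree : ∀ g, g ≠ 1 → ∀ x ∈ E, Φ g x ≠ x)
    (hid : (fun x => x) ∈ S) (ha : ∀ i, (Φ (FreeGroup.of i) : X → X) ∈ S) :
    ParadoxicalUsing S E 4 := by
  classical
  -- equivariant map to the group
  obtain ⟨γ, hγ⟩ : ∃ γ : X → FreeGroup Bool, ∀ g, ∀ x ∈ E, γ (Φ g x) = g * γ x := by
    let rel : Setoid X := ⟨fun x y => ∃ g, Φ g x = y,
      ⟨fun x => ⟨1, by simp⟩, fun {x y} ⟨g, h⟩ => ⟨g⁻¹, by rw [← h, ← Equiv.Perm.mul_apply, ← map_mul]; simp⟩,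
        fun {x y z} ⟨g, h⟩ ⟨g', h'⟩ => ⟨g' * g, by rw [map_mul, Equiv.Perm.mul_apply, h, h']⟩⟩⟩
    have hrep : ∀ x : X, ∃ g, Φ g (Quotient.out (Quotient.mk rel x)) = x := fun x =>
      Quotient.mk_out (s := rel) x
    choose γ hγ using hrep
    refine ⟨γ, fun g x hx => ?_⟩
    have hq : Quotient.mk rel (Φ g x) = Quotient.mk rel x :=
      Quotient.sound (s := rel) (Setoid.symm' rel ⟨g, rfl⟩)
    have h1 := hγ (Φ g x)
    rw [hq] at h1
    have h2 := hγ x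
    set o := Quotient.out (Quotient.mk rel x)
    have ho : o ∈ E := by
      have : Φ (γ x)⁻¹ x = o := by
        have h3 : Φ (γ x)⁻¹ (Φ (γ x) o) = o := by
          rw [← Equiv.Perm.mul_apply, ← map_mul]; simp
        rwa [h2] at h3
      rw [← this]; exact hE _ _ hx
    by_contra hne
    apply hfree ((g * γ x)⁻¹ * γ (Φ g x)) (by rw [Ne, inv_mul_eq_one]; exact fun h => hne h.symm) o ho
    rw [map_mul, Equiv.Perm.mul_apply, h1, ← h2, ← Equiv.Perm.mul_apply, ← Equiv.Perm.mul_apply, ← map_mul, ← map_mul, h2]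
    simp
  obtain ⟨A1, A2, B1, B2, hpart, hA, hB⟩ := free_four
  have himg : ∀ (i : Bool) (D D' : Set (FreeGroup Bool)),
      (∀ g, (FreeGroup.of i)⁻¹ * g ∈ D ↔ g ∉ D') →
      (Φ (FreeGroup.of i) : X → X) '' {x | x ∈ E ∧ γ x ∈ D} = {x | x ∈ E ∧ γ x ∉ D'} := by
    intro i D D' h
    ext y
    constructor
    · rintro ⟨x, ⟨hx, hxD⟩, rfl⟩
      refine ⟨hE _ _ hx, ?_⟩
      rw [← h, hγ _ _ hx]
      simpa using hxD
    · rintro ⟨hy, hyD⟩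
      refine ⟨Φ (FreeGroup.of i)⁻¹ y, ⟨hE _ _ hy, ?_⟩, ?_⟩
      · rw [hγ _ _ hy, h]; exact hyD
      · rw [← Equiv.Perm.mul_apply, ← map_mul]; simp
  have hiA := himg true A2 A1 hA
  have hiB := himg false B2 B1 hB
  refine ⟨2, 2, by norm_num, by norm_num, by norm_num,
    ![{x | x ∈ E ∧ γ x ∈ A1}, {x | x ∈ E ∧ γ x ∈ A2}],
    ![{x | x ∈ E ∧ γ x ∈ B1}, {x | x ∈ E ∧ γ x ∈ B2}],
    ![fun x => x, Φ (FreeGroup.of true)], ![fun x => x, Φ (FreeGroup.of false)], ?_⟩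
  simp only [Fin.forall_fin_two, Matrix.cons_val_zero, Matrix.cons_val_one, ne_eq, not_true_eq_false,
    false_imp_iff, true_and, and_true, zero_ne_one, one_ne_zero, not_false_eq_true, true_imp_iff,
    hiA, hiB, Set.image_id', ha, hid]
  have hU : ∀ f : Fin 2 → Set X, (⋃ i, f i) = f 0 ∪ f 1 := by
    intro f; ext x; simp [Fin.exists_fin_two]
  simp only [hU, Matrix.cons_val_zero, Matrix.cons_val_one, hiA, hiB, Set.image_id']
  have q : ∀ x : X, _ := fun x => hpart (γ x)
  simp only [Set.disjoint_left, Set.mem_ofPred_eq, Set.ext_iff, Set.mem_union, Set.subset_def]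
  refine ⟨?_, ?_, ?_, ?_, ?_, ?_, ?_, ?_, ?_, ?_⟩
  all_goals grind

/-! Part 3: the two matrices -/
theorem av_lin {R : Type*} [CommRing R] [IsDomain R] (w : AbsoluteValue R ℝ) (α β p q : R) :
    w (α * p + β * q) ≤ w α * w p + w β * w q ∧ w α * w p - w β * w q ≤ w (α * p + β * q) ∧
    w β * w q - w α * w p ≤ w (α * p + β * q) := by
  refine ⟨?_, ?_, ?_⟩
  · have := w.add_le (α * p) (β * q); simpa using this
  · have := w.le_add (α * p) (β * q); simpa using this
  · have := w.le_add (β * q) (α * p); rw [add_comm (β * q)] at this; simpa using this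

theorem av_near {R : Type*} [CommRing R] [IsDomain R] (w : AbsoluteValue R ℝ) (x e : R) :
    w x - w e ≤ w (x + e) ∧ w (x + e) ≤ w x + w e := ⟨w.le_add x e, w.add_le x e⟩

theorem pp_real_a (T P Q α P' Q' : ℝ) (hT : 100 ≤ T) (hP : 0 ≤ P)
    (hPQ : 0 < P + Q)
    (hα : T ^ 4 - 1 ≤ α)
    (h1 : α * P - T ^ 2 * Q ≤ P') (h2 : Q' ≤ T ^ 2 * P + 1 * Q)
    (hc : Q ≤ 10 * T * P) : 10 * T * Q' < P' ∧ P + Q < P' := by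
  have hP0 : 0 < P := by
    rcases hP.lt_or_eq with h | h
    · exact h
    · rw [← h] at hc hPQ; linarith
  have e1 : T ^ 2 * Q ≤ T ^ 2 * (10 * T * P) := by gcongr
  have e2 : (T ^ 4 - 1) * P ≤ α * P := by gcongr
  have e3 : 10 * T * Q' ≤ 10 * T * (T ^ 2 * P + 1 * (10 * T * P)) := by
    have : Q' ≤ T ^ 2 * P + 1 * (10 * T * P) := by linarith
    gcongr
  have f1 : 100 * P ≤ T * P := by gcongr
  have f2 : 100 * (T * P) ≤ T * (T * P) := by gcongr
  have f3 : 100 * (T * (T * P)) ≤ T * (T * (T * P)) := by gcongr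
  have f4 : 100 * (T * (T * (T * P))) ≤ T * (T * (T * (T * P))) := by gcongr
  ring_nf at *
  constructor <;> linarith

/-- `b`-type estimate: first row of size `M * T'`, second row of size `M`, and `T'` the ratio. -/
theorem pp_real_b (A B C D U V P Q P' Q' : ℝ) (hU : 100 ≤ U) (hV : 100 ≤ V)
    (hP : 0 ≤ P) (hQ : 0 ≤ Q)
    (hA : 0.9 * U ≤ A ∧ A ≤ 1.1 * U) (hB : 0.9 * U ≤ B ∧ B ≤ 1.1 * U)
    (hC : 0.9 * V ≤ C ∧ C ≤ 1.1 * V) (hD : 0.9 * V ≤ D ∧ D ≤ 1.1 * V)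
    (h1 : P' ≤ A * P + B * Q) (h2 : A * P - B * Q ≤ P') (h3 : B * Q - A * P ≤ P')
    (h4 : Q' ≤ C * P + D * Q) (h5 : C * P - D * Q ≤ Q') (h6 : D * Q - C * P ≤ Q')
    (hPQ : 0 < P + Q) (hc : Q * 5 ≤ P ∨ P * 5 ≤ Q) :
    U * Q' < V * (5 * P') ∧ V * P' < U * (5 * Q') ∧ P + Q < P' := by
  obtain ⟨a1, a2⟩ := hA
  obtain ⟨b1, b2⟩ := hB
  obtain ⟨c1, c2⟩ := hC
  obtain ⟨d1, d2⟩ := hD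
  have A1 : 0.9 * U * P ≤ A * P := by gcongr
  have A2 : A * P ≤ 1.1 * U * P := by gcongr
  have B1 : 0.9 * U * Q ≤ B * Q := by gcongr
  have B2 : B * Q ≤ 1.1 * U * Q := by gcongr
  have C1 : 0.9 * V * P ≤ C * P := by gcongr
  have C2 : C * P ≤ 1.1 * V * P := by gcongr
  have D1 : 0.9 * V * Q ≤ D * Q := by gcongr
  have D2 : D * Q ≤ 1.1 * V * Q := by gcongr
  have U0 : 0 < U := by linarith
  have V0 : 0 < V := by linarith
  have m : ∀ x y : ℝ, x ≤ y → U * x ≤ U * y := fun x y h => by gcongr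
  have k : ∀ x y : ℝ, x ≤ y → V * x ≤ V * y := fun x y h => by gcongr
  rcases hc with hc | hc
  · have hP0 : 0 < P := by linarith
    have q1 : 0.68 * (U * P) ≤ P' := by have := m _ _ hc; linarith
    have q2 : P' ≤ 1.32 * (U * P) := by have := m _ _ hc; linarith
    have q3 : 0.68 * (V * P) ≤ Q' := by have := k _ _ hc; linarith
    have q4 : Q' ≤ 1.32 * (V * P) := by have := k _ _ hc; linarith
    have W0 : 0 < U * V * P := by positivity
    have := k _ _ q1
    have := k _ _ q2
    have := m _ _ q3
    have := m _ _ q4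
    have : 100 * P ≤ U * P := by gcongr
    refine ⟨?_, ?_, ?_⟩ <;> linarith
  · have hP0 : 0 < Q := by linarith
    have q1 : 0.68 * (U * Q) ≤ P' := by have := m _ _ hc; linarith
    have q2 : P' ≤ 1.32 * (U * Q) := by have := m _ _ hc; linarith
    have q3 : 0.68 * (V * Q) ≤ Q' := by have := k _ _ hc; linarith
    have q4 : Q' ≤ 1.32 * (V * Q) := by have := k _ _ hc; linarith
    have W0 : 0 < U * V * Q := by positivity
    have := k _ _ q1
    have := k _ _ q2
    have := m _ _ q3
    have := m _ _ q4
    have : 100 * Q ≤ U * Q := by gcongr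
    refine ⟨?_, ?_, ?_⟩ <;> linarith

def genA {R : Type*} [CommRing R] (t : R) : Matrix.SpecialLinearGroup (Fin 2) R :=
  ⟨!![1 + t ^ 4, t ^ 2; t ^ 2, 1], by rw [Matrix.det_fin_two_of]; ring⟩

def genB {R : Type*} [CommRing R] (t : R) : Matrix.SpecialLinearGroup (Fin 2) R :=
  ⟨!![1 - t ^ 2 + t ^ 3, t - t ^ 2 + t ^ 3; t ^ 2, 1 + t ^ 2], by
    rw [Matrix.det_fin_two_of]; ring⟩

def gens {R : Type*} [CommRing R] (t : R) (i : Bool) : Matrix.SpecialLinearGroup (Fin 2) R :=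
  if i then genA t else genB t

def cone {R : Type*} [CommRing R] (w : AbsoluteValue R ℝ) (t : R) :
    Bool × Bool → Set (Fin 2 → R)
  | (true, true) => {u | 10 * w t * w (u 1) < w (u 0)}
  | (true, false) => {u | 10 * w t * w (u 0) < w (u 1)}
  | (false, true) => {u | w t * w (u 1) < 5 * w (u 0) ∧ w (u 0) < 5 * (w t * w (u 1))}
  | (false, false) => {u | w (u 1) < 5 * w (u 0) ∧ w (u 0) < 5 * w (u 1)}

theorem cone_disj {R : Type*} [CommRing R] (w : AbsoluteValue R ℝ) (t : R) (ht : 100 ≤ w t)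
    (s s' : Bool × Bool) (hs : s ≠ s') (u : Fin 2 → R) (h : u ∈ cone w t s) :
    u ∉ cone w t s' := by
  have hP := w.nonneg (u 0)
  have hQ := w.nonneg (u 1)
  have e1 : 100 * w (u 0) ≤ w t * w (u 0) := by gcongr
  have e2 : 100 * w (u 1) ≤ w t * w (u 1) := by gcongr
  have e3 : 100 * (w t * w (u 0)) ≤ w t * (w t * w (u 0)) := by gcongr
  have e4 : 100 * (w t * w (u 1)) ≤ w t * (w t * w (u 1)) := by gcongr
  intro h'
  obtain ⟨i, j⟩ := s
  obtain ⟨i', j'⟩ := s'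
  cases i <;> cases j <;> cases i' <;> cases j' <;> simp [cone] at h h' hs <;>
    linarith

theorem cone_step {R : Type*} [CommRing R] [IsDomain R] (w : AbsoluteValue R ℝ) (t : R)
    (ht : 100 ≤ w t) (s : Bool × Bool) (u : Fin 2 → R) (hu : u ≠ 0)
    (h : u ∉ cone w t (s.1, !s.2)) (M : Matrix (Fin 2) (Fin 2) R)
    (hM : M = if s.2 then (gens t s.1).1 else (gens t s.1).1.adjugate) :
    M.mulVec u ∈ cone w t s ∧ w (u 0) + w (u 1) < w (M.mulVec u 0) + w (M.mulVec u 1) := by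
  have hP := w.nonneg (u 0)
  have hQ := w.nonneg (u 1)
  have hPQ : 0 < w (u 0) + w (u 1) := by
    have : u 0 ≠ 0 ∨ u 1 ≠ 0 := by
      by_contra hcon
      push Not at hcon
      apply hu
      ext i; fin_cases i
      · exact hcon.1
      · exact hcon.2
    rcases this with h | h
    · have := w.pos h; linarith
    · have := w.pos h; linarith
  have hT0 : 0 < w t := by linarith
  have hT2 : 100 * w t ≤ w t ^ 2 := by nlinarith
  have hT3 : 100 * w t ^ 2 ≤ w t ^ 3 := by nlinarith
  have hT4 : 100 * w t ^ 3 ≤ w t ^ 4 := by nlinarith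
  have w1 : w 1 = 1 := w.map_one
  have a4 := av_near w (t ^ 4) 1
  have a2 := av_near w (t ^ 2) 1
  have b3 := av_near w (t ^ 3) (1 - t ^ 2)
  have b3' := av_near w (t ^ 3) (t - t ^ 2)
  have b1 : w (1 - t ^ 2) ≤ 1 + w t ^ 2 := by
    have := w.sub_le_add 1 (t ^ 2); simpa using this
  have b1' : w (t - t ^ 2) ≤ w t + w t ^ 2 := by
    have := w.sub_le_add t (t ^ 2); simpa using this
  rw [add_comm (t ^ 4), map_pow, w1] at a4
  rw [add_comm (t ^ 2), map_pow, w1] at a2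
  rw [add_comm (t ^ 3), map_pow] at b3
  rw [add_comm (t ^ 3), map_pow] at b3'
  have hv0 : ∀ M : Matrix (Fin 2) (Fin 2) R, M.mulVec u 0 = M 0 0 * u 0 + M 0 1 * u 1 := by
    intro M; simp [Matrix.mulVec, dotProduct, Fin.sum_univ_two]
  have hv1 : ∀ M : Matrix (Fin 2) (Fin 2) R, M.mulVec u 1 = M 1 0 * u 0 + M 1 1 * u 1 := by
    intro M; simp [Matrix.mulVec, dotProduct, Fin.sum_univ_two]
  obtain ⟨i1, i2, i3⟩ := av_lin w (M 0 0) (M 0 1) (u 0) (u 1)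
  obtain ⟨j1, j2, j3⟩ := av_lin w (M 1 0) (M 1 1) (u 0) (u 1)
  rw [← hv0] at i1 i2 i3
  rw [← hv1] at j1 j2 j3
  have n0 := w.nonneg (M.mulVec u 0)
  have n1 := w.nonneg (M.mulVec u 1)
  obtain ⟨i, j⟩ := s
  simp only at hM h
  cases i <;> cases j
  · -- inverse of b
    have m00 : w (M 0 0) = w (1 + t ^ 2) := by
      rw [hM]; simp [gens, genB, Matrix.adjugate_fin_two]
    have m01 : w (M 0 1) = w (t - t ^ 2 + t ^ 3) := by
      rw [hM, ← w.map_neg (t - t ^ 2 + t ^ 3)]; simp [gens, genB, Matrix.adjugate_fin_two]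
    have m10 : w (M 1 0) = w t ^ 2 := by
      rw [hM, ← map_pow, ← w.map_neg (t ^ 2)]; simp [gens, genB, Matrix.adjugate_fin_two]
    have m11 : w (M 1 1) = w (1 - t ^ 2 + t ^ 3) := by
      rw [hM]; simp [gens, genB, Matrix.adjugate_fin_two]
    rw [m00, m01] at i1 i2 i3
    rw [m10, m11] at j1 j2 j3
    have hd : ∀ x, 0.9 * w t ^ 3 ≤ x → x ≤ 1.1 * w t ^ 3 →
        0.9 * w t ^ 2 ≤ x / w t ∧ x / w t ≤ 1.1 * w t ^ 2 := by
      intro x h1 h2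
      rw [le_div_iff₀ hT0, div_le_iff₀ hT0]
      constructor <;> linarith
    have hx : ∀ x, x * w (u 1) = x / w t * (w t * w (u 1)) := by
      intro x; field_simp
    rw [hx (w (t - t ^ 2 + t ^ 3))] at i1 i2 i3
    rw [hx (w (1 - t ^ 2 + t ^ 3))] at j1 j2 j3
    have e2 : 100 * w (u 1) ≤ w t * w (u 1) := by gcongr
    obtain ⟨r1, r2, r3⟩ := pp_real_b _ _ _ _ (w t ^ 2) (w t ^ 2) (w (u 0)) (w t * w (u 1)) _ _
      (by linarith) (by linarith) hP (by positivity) ⟨by linarith, by linarith⟩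
      (hd _ (by linarith) (by linarith)) ⟨by linarith, by linarith⟩
      (hd _ (by linarith) (by linarith)) i1 i2 i3 j1 j2 j3 (by linarith)
      (by
        simp only [cone, Bool.not_false, Set.mem_ofPred_eq] at h
        by_contra hcon
        push Not at hcon
        exact h ⟨by linarith, by linarith⟩)
    have hTT : 0 < w t ^ 2 := by positivity
    refine ⟨⟨lt_of_mul_lt_mul_left r1 hTT.le, lt_of_mul_lt_mul_left r2 hTT.le⟩, by linarith⟩
  · have m00 : w (M 0 0) = w (1 - t ^ 2 + t ^ 3) := by
      rw [hM]; simp [gens, genB]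
    have m01 : w (M 0 1) = w (t - t ^ 2 + t ^ 3) := by
      rw [hM]; simp [gens, genB]
    have m10 : w (M 1 0) = w t ^ 2 := by
      rw [hM]; simp [gens, genB]
    have m11 : w (M 1 1) = w (1 + t ^ 2) := by
      rw [hM]; simp [gens, genB]
    rw [m00, m01] at i1 i2 i3
    rw [m10, m11] at j1 j2 j3
    obtain ⟨r1, r2, r3⟩ := pp_real_b _ _ _ _ (w t ^ 3) (w t ^ 2) (w (u 0)) (w (u 1)) _ _
      (by linarith) (by linarith) hP hQ ⟨by linarith, by linarith⟩
      ⟨by linarith, by linarith⟩ ⟨by linarith, by linarith⟩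
      ⟨by linarith, by linarith⟩ i1 i2 i3 j1 j2 j3 hPQ
      (by
        simp only [cone, Bool.not_true, Set.mem_ofPred_eq] at h
        by_contra hcon
        push Not at hcon
        exact h ⟨by linarith, by linarith⟩)
    have hTT : 0 < w t ^ 2 := by positivity
    refine ⟨⟨lt_of_mul_lt_mul_left (a := w t ^ 2) ?_ hTT.le,
      lt_of_mul_lt_mul_left (a := w t ^ 2) ?_ hTT.le⟩, by linarith⟩
    · linarith
    · linarith
  · have m00 : w (M 0 0) = 1 := by
      rw [hM]; simp [gens, genA, Matrix.adjugate_fin_two]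
    have m01 : w (M 0 1) = w t ^ 2 := by
      rw [hM, ← map_pow, ← w.map_neg (t ^ 2)]; simp [gens, genA, Matrix.adjugate_fin_two]
    have m10 : w (M 1 0) = w t ^ 2 := by
      rw [hM, ← map_pow, ← w.map_neg (t ^ 2)]; simp [gens, genA, Matrix.adjugate_fin_two]
    have m11 : w (M 1 1) = w (1 + t ^ 4) := by
      rw [hM]; simp [gens, genA, Matrix.adjugate_fin_two]
    rw [m00, m01] at i1 i2 i3
    rw [m10, m11] at j1 j2 j3
    obtain ⟨r1, r2⟩ := pp_real_a (w t) (w (u 1)) (w (u 0)) _ _ _ ht hQ (by linarith)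
      a4.1 j3 (i1.trans (add_comm _ _).le) (by simpa [cone] using h)
    exact ⟨r1, by linarith⟩
  · have m00 : w (M 0 0) = w (1 + t ^ 4) := by
      rw [hM]; simp [gens, genA]
    have m01 : w (M 0 1) = w t ^ 2 := by
      rw [hM]; simp [gens, genA]
    have m10 : w (M 1 0) = w t ^ 2 := by
      rw [hM]; simp [gens, genA]
    have m11 : w (M 1 1) = 1 := by
      rw [hM]; simp [gens, genA]
    rw [m00, m01] at i1 i2 i3
    rw [m10, m11] at j1 j2 j3
    obtain ⟨r1, r2⟩ := pp_real_a (w t) (w (u 0)) (w (u 1)) _ _ _ ht hP hPQ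
      a4.1 i2 j1 (by simpa [cone] using h)
    exact ⟨r1, by linarith⟩

theorem det_ne {R : Type*} [CommRing R] [IsDomain R] (w : AbsoluteValue R ℝ) (t : R)
    (ht : 100 ≤ w t) (g : FreeGroup Bool) (hg : g ≠ 1) :
    ((FreeGroup.lift (gens t) g).1 - 1).det ≠ 0 := by
  intro hdet
  obtain ⟨u, hu, hu2⟩ := Matrix.exists_mulVec_eq_zero_iff.2 hdet
  rw [Matrix.sub_mulVec, Matrix.one_mulVec, sub_eq_zero] at hu2
  refine pp_free (fun g u => (FreeGroup.lift (gens t) g).1.mulVec u) ?_ ?_ {u | u ≠ 0} ?_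
    (cone w t) (fun u => w (u 0) + w (u 1)) (cone_disj w t ht) ?_ g hg u hu hu2
  · intro y; simp
  · intro g h y; simp only [map_mul, Matrix.SpecialLinearGroup.coe_mul, Matrix.mulVec_mulVec]
  · intro g y hy h0
    apply hy
    have := congrArg ((FreeGroup.lift (gens t) g⁻¹).1.mulVec) h0
    simp only [Matrix.mulVec_mulVec, Matrix.mulVec_zero] at this
    have e : (FreeGroup.lift (gens t) g⁻¹).1 * (FreeGroup.lift (gens t) g).1 = 1 := by
      have := congrArg Subtype.val (map_mul (FreeGroup.lift (gens t)) g⁻¹ g)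
      rw [inv_mul_cancel, map_one] at this
      exact this.symm
    rwa [e, Matrix.one_mulVec] at this
  · rintro ⟨i, j⟩ y hy hyC
    refine cone_step w t ht (i, j) y hy hyC _ ?_
    cases j
    · have : FreeGroup.mk [(i, false)] = (FreeGroup.of i)⁻¹ := by
        simp [FreeGroup.of, FreeGroup.inv_mk, FreeGroup.invRev]
      rw [this, map_inv, FreeGroup.lift_apply_of]
      simp [Matrix.SpecialLinearGroup.coe_inv]
    · have : FreeGroup.mk [(i, true)] = FreeGroup.of i := rfl
      rw [this, FreeGroup.lift_apply_of]
      simp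

/-! Part 4: valuations and norms -/
theorem nav_one {K : Type*} [Field K] {v : K → ℝ} (hv : IsNAVal v) : v 1 = 1 := by
  obtain ⟨h0, h1, h2, h3⟩ := hv
  have := h2 1 1
  rw [mul_one] at this
  have hne : v 1 ≠ 0 := by rw [Ne, h1]; exact one_ne_zero
  exact (mul_left_cancel₀ hne (by rw [mul_one]; exact this)).symm

theorem nav_neg {K : Type*} [Field K] {v : K → ℝ} (hv : IsNAVal v) (x : K) : v (-x) = v x := by
  have h := nav_one hv
  obtain ⟨h0, h1, h2, h3⟩ := hv
  have e : v (-1) * v (-1) = 1 := by rw [← h2]; simpa using h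
  have : v (-1) = 1 := by nlinarith [h0 (-1)]
  rw [← neg_one_mul, h2, this, one_mul]

theorem nav_pow {K : Type*} [Field K] {v : K → ℝ} (hv : IsNAVal v) (x : K) (m : ℕ) :
    v (x ^ m) = v x ^ m := by
  induction m with
  | zero => simpa using nav_one hv
  | succ m ih => rw [pow_succ, pow_succ, hv.2.2.1, ih]

theorem nav_add_le {K : Type*} [Field K] {v : K → ℝ} (hv : IsNAVal v) {x y : K} {B : ℝ}
    (hx : v x ≤ B) (hy : v y ≤ B) : v (x + y) ≤ B := (hv.2.2.2 x y).trans (max_le hx hy)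

theorem nav_sub_le {K : Type*} [Field K] {v : K → ℝ} (hv : IsNAVal v) {x y : K} {B : ℝ}
    (hx : v x ≤ B) (hy : v y ≤ B) : v (x - y) ≤ B := by
  rw [sub_eq_add_neg]; exact nav_add_le hv hx (by rwa [nav_neg hv])

theorem nav_inv {K : Type*} [Field K] {v : K → ℝ} (hv : IsNAVal v) (x : K) (hx : x ≠ 0) :
    v x⁻¹ = (v x)⁻¹ := by
  have : v x * v x⁻¹ = 1 := by rw [← hv.2.2.1, mul_inv_cancel₀ hx, nav_one hv]
  exact eq_inv_of_mul_eq_one_right this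

theorem norm_neg' {K : Type*} [Field K] {v : K → ℝ} (hv : IsNAVal v) {X : Type*}
    [AddCommGroup X] [Module K X] {N : X → ℝ} (hN : IsNANorm v N) (x : X) : N (-x) = N x := by
  have := hN.2.2.1 (-1) x
  rwa [nav_neg hv, nav_one hv, neg_one_smul, one_mul] at this

theorem norm_eq_of_sub_lt {K : Type*} [Field K] {v : K → ℝ} (hv : IsNAVal v) {X : Type*}
    [AddCommGroup X] [Module K X] {N : X → ℝ} (hN : IsNANorm v N) (x y : X)
    (h : N (y - x) < N x) : N y = N x := by
  have h1 := hN.2.2.2 (y - x) x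
  have h2 := hN.2.2.2 y (-(y - x))
  rw [norm_neg' hv hN] at h2
  simp only [sub_add_cancel, neg_sub, add_sub_cancel] at h1 h2
  rw [max_eq_right h.le] at h1
  rcases le_max_iff.1 h2 with h3 | h3
  · exact le_antisymm h1 h3
  · exact absurd h (not_lt.2 h3)

theorem le_maxNorm {K : Type*} [Field K] (v : K → ℝ) {n : ℕ} (x : Fin n → K) (i : Fin n) :
    v (x i) ≤ maxNorm v x :=
  le_csSup (Set.finite_range _).bddAbove ⟨i, rfl⟩

theorem maxNorm_le {K : Type*} [Field K] (v : K → ℝ) {n : ℕ} (hn : 2 ≤ n) (x : Fin n → K) (B : ℝ)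
    (h : ∀ i, v (x i) ≤ B) : maxNorm v x ≤ B := by
  apply csSup_le
  · exact ⟨_, ⟨⟨0, by omega⟩, rfl⟩⟩
  · rintro _ ⟨i, rfl⟩; exact h i

theorem gens_bound {K : Type*} [Field K] {v : K → ℝ} (hv : IsNAVal v) (τ : K) (hτ : v τ ≤ 1)
    (b : Bool) (k l : Fin 2) : v (((gens τ b).1 - 1) k l) ≤ v τ := by
  have h1 : v 1 ≤ 1 := (nav_one hv).le
  have hp : ∀ m, v (τ ^ m) ≤ 1 := fun m => by
    rw [nav_pow hv]; exact pow_le_one₀ (hv.1 _) hτ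
  have key : ∀ z, v z ≤ 1 → v (τ * z) ≤ v τ := fun z hz => by
    rw [hv.2.2.1]; exact mul_le_of_le_one_right (hv.1 _) hz
  have ex : ∃ z, v z ≤ 1 ∧ ((gens τ b).1 - 1) k l = τ * z := by
    cases b <;> fin_cases k <;> fin_cases l
    · exact ⟨τ ^ 2 - τ, nav_sub_le hv (hp 2) hτ, by simp [gens, genB]; ring⟩
    · exact ⟨1 - τ + τ ^ 2, nav_add_le hv (nav_sub_le hv h1 hτ) (hp 2), by simp [gens, genB]; ring⟩
    · exact ⟨τ, hτ, by simp [gens, genB]; ring⟩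
    · exact ⟨τ, hτ, by simp [gens, genB]; ring⟩
    · exact ⟨τ ^ 3, hp 3, by simp [gens, genA]; ring⟩
    · exact ⟨τ, hτ, by simp [gens, genA]; ring⟩
    · exact ⟨τ, hτ, by simp [gens, genA]; ring⟩
    · exact ⟨0, by rw [(hv.2.1 0).2 rfl]; exact zero_le_one, by simp [gens, genA]⟩
  obtain ⟨z, hz, e⟩ := ex
  rw [e]; exact key z hz

/-! Part 5: the embedding of `SL₂` -/
def embJ (K : Type*) [Field K] {n : ℕ} (hn : 2 ≤ n) : Matrix (Fin n) (Fin 2) K :=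
  Matrix.of fun i k => if i = Fin.castLE hn k then 1 else 0

theorem embJ_proj {K : Type*} [Field K] {n : ℕ} (hn : 2 ≤ n) (x : Fin n → K) (k : Fin 2) :
    (embJ K hn).transpose.mulVec x k = x (Fin.castLE hn k) := by
  simp [embJ, Matrix.mulVec, dotProduct]

theorem embJ_mul {K : Type*} [Field K] {n : ℕ} (hn : 2 ≤ n) :
    (embJ K hn).transpose * embJ K hn = 1 := by
  ext k l
  rw [Matrix.mul_apply]
  simp [embJ, Matrix.one_apply, eq_comm]

def linA {K : Type*} [Field K] {n : ℕ} (hn : 2 ≤ n) (A : Matrix (Fin 2) (Fin 2) K) :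
    Matrix (Fin n) (Fin n) K := 1 + embJ K hn * (A - 1) * (embJ K hn).transpose

theorem linA_mul {K : Type*} [Field K] {n : ℕ} (hn : 2 ≤ n) (A B : Matrix (Fin 2) (Fin 2) K) :
    linA hn (A * B) = linA hn A * linA hn B := by
  unfold linA
  have e := embJ_mul (K := K) hn
  generalize embJ K hn = J at *
  have h : J * (A - 1) * J.transpose * (J * (B - 1) * J.transpose)
      = J * ((A - 1) * (B - 1)) * J.transpose := by
    calc J * (A - 1) * J.transpose * (J * (B - 1) * J.transpose)
        = J * (A - 1) * (J.transpose * J) * (B - 1) * J.transpose := by simp only [Matrix.mul_assoc]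
      _ = _ := by rw [e, Matrix.mul_one]; simp only [Matrix.mul_assoc]
  rw [mul_add, add_mul, add_mul, h]
  have h2 : A * B - 1 = (A - 1) + (B - 1) + (A - 1) * (B - 1) := by noncomm_ring
  rw [h2]
  simp only [Matrix.mul_add, Matrix.add_mul, one_mul, mul_one]
  abel

theorem linA_one {K : Type*} [Field K] {n : ℕ} (hn : 2 ≤ n) :
    linA hn (1 : Matrix (Fin 2) (Fin 2) K) = 1 := by
  simp [linA]

def affHom {K : Type*} [Field K] {n : ℕ} (hn : 2 ≤ n) (Q : Fin n → K) :
    Matrix.SpecialLinearGroup (Fin 2) K →* Equiv.Perm (Fin n → K) where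
  toFun A :=
    { toFun := fun x => (linA hn A.1).mulVec (x - Q) + Q
      invFun := fun x => (linA hn A⁻¹.1).mulVec (x - Q) + Q
      left_inv := fun x => by
        have : A⁻¹.1 * A.1 = 1 := congrArg Subtype.val (inv_mul_cancel A)
        simp only [add_sub_cancel_right, Matrix.mulVec_mulVec]
        rw [← linA_mul, this, linA_one, Matrix.one_mulVec, sub_add_cancel]
      right_inv := fun x => by
        have : A.1 * A⁻¹.1 = 1 := congrArg Subtype.val (mul_inv_cancel A)
        simp only [add_sub_cancel_right, Matrix.mulVec_mulVec]
        rw [← linA_mul, this, linA_one, Matrix.one_mulVec, sub_add_cancel] }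
  map_one' := by
    ext1 x
    simp [linA_one]
  map_mul' A B := by
    ext1 x
    simp [linA_mul]

theorem affHom_apply {K : Type*} [Field K] {n : ℕ} (hn : 2 ≤ n) (Q : Fin n → K)
    (A : Matrix.SpecialLinearGroup (Fin 2) K) (x : Fin n → K) :
    affHom hn Q A x = (linA hn A.1).mulVec (x - Q) + Q := rfl

theorem linA_sub {K : Type*} [Field K] {n : ℕ} (hn : 2 ≤ n) (A : Matrix (Fin 2) (Fin 2) K)
    (y : Fin n → K) : (linA hn A).mulVec y - y =
      (embJ K hn).mulVec ((A - 1).mulVec ((embJ K hn).transpose.mulVec y)) := by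
  rw [linA, Matrix.add_mulVec, Matrix.one_mulVec, add_sub_cancel_left]
  simp only [Matrix.mulVec_mulVec, Matrix.mul_assoc]

theorem linA_sub_bound {K : Type*} [Field K] {v : K → ℝ} (hv : IsNAVal v) {n : ℕ} (hn : 2 ≤ n)
    (A : Matrix (Fin 2) (Fin 2) K) (ε : ℝ) (hA : ∀ k l, v ((A - 1) k l) ≤ ε)
    (y : Fin n → K) (B : ℝ) (hB : 0 ≤ B) (hy : ∀ k : Fin 2, v (y (Fin.castLE hn k)) ≤ B) :
    maxNorm v ((linA hn A).mulVec y - y) ≤ ε * B := by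
  have hε : 0 ≤ ε := (hv.1 _).trans (hA 0 0)
  rw [linA_sub]
  have h1 : ∀ k, v ((A - 1).mulVec ((embJ K hn).transpose.mulVec y) k) ≤ ε * B := by
    intro k
    simp only [Matrix.mulVec.eq_1 (A - 1), dotProduct, Fin.sum_univ_two]
    refine nav_add_le hv ?_ ?_
    · rw [hv.2.2.1, embJ_proj]; exact mul_le_mul (hA _ _) (hy _) (hv.1 _) hε
    · rw [hv.2.2.1, embJ_proj]; exact mul_le_mul (hA _ _) (hy _) (hv.1 _) hε
  generalize (A - 1).mulVec ((embJ K hn).transpose.mulVec y) = z at *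
  refine maxNorm_le v hn _ _ fun i => ?_
  have h2 : ∀ k, v (embJ K hn i k * z k) ≤ ε * B := by
    intro k
    simp only [embJ, Matrix.of_apply]
    split_ifs
    · rw [one_mul]; exact h1 k
    · rw [zero_mul, (hv.2.1 0).2 rfl]; positivity
  simp only [Matrix.mulVec, dotProduct, Fin.sum_univ_two]
  exact nav_add_le hv (h2 0) (h2 1)

theorem main_geo {K : Type*} [Field K] (v : K → ℝ) (hv : IsNAVal v)
    (n : ℕ) (hn : 2 ≤ n) (N : (Fin n → K) → ℝ) (hN : IsNANorm v N)
    (C₁ C₂ : ℝ) (hC₁ : 0 < C₁) (hC₂ : 0 < C₂)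
    (heq : ∀ x : Fin n → K, C₁ * maxNorm v x ≤ N x ∧ N x ≤ C₂ * maxNorm v x)
    (x₀ : Fin n → K) (r : ℝ) (hr : 0 < r)
    {R : Type*} [CommRing R] [IsDomain R] (j : R →+* K) (hj : Function.Injective j)
    (w : AbsoluteValue R ℝ) (t₀ : R) (hw : 1 < w t₀) (hvt : v (j t₀) < 1) :
    ParadoxicalUsing {f | MemIA N f} {x : Fin n → K | N (x - x₀) = r} 4 := by
  have ht0 : j t₀ ≠ 0 := by
    rw [Ne, map_eq_zero_iff j hj]
    rintro rfl
    simp at hw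
    linarith
  have hvt0 : 0 < v (j t₀) := lt_of_le_of_ne (hv.1 _) (Ne.symm (by rw [Ne, hv.2.1]; exact ht0))
  -- a large scalar
  obtain ⟨c, hc⟩ : ∃ c : K, r / C₁ < v c := by
    obtain ⟨m, hm⟩ := pow_unbounded_of_one_lt (r / C₁) ((one_lt_inv₀ hvt0).2 hvt)
    exact ⟨((j t₀)⁻¹) ^ m, by rw [nav_pow hv, nav_inv hv _ ht0]; exact hm⟩
  have hc0 : 0 < v c := lt_trans (by positivity) hc
  obtain ⟨t, htw, htv1, htv2, htv3⟩ : ∃ t : R, 100 ≤ w t ∧ v (j t) ≤ 1 ∧ v (j t) < C₁ / C₂ ∧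
      v (j t) < r / (C₂ * v c) := by
    obtain ⟨m1, hm1⟩ := pow_unbounded_of_one_lt (100 : ℝ) hw
    obtain ⟨m2, hm2⟩ := exists_pow_lt_of_lt_one (show 0 < C₁ / C₂ by positivity) hvt
    obtain ⟨m3, hm3⟩ := exists_pow_lt_of_lt_one (show 0 < r / (C₂ * v c) by positivity) hvt
    refine ⟨t₀ ^ (m1 + m2 + m3), ?_, ?_, ?_, ?_⟩
    · rw [map_pow]
      exact hm1.le.trans (pow_le_pow_right₀ hw.le (by omega))
    · rw [map_pow, nav_pow hv]; exact pow_le_one₀ (hv.1 _) hvt.le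
    · rw [map_pow, nav_pow hv]
      exact lt_of_le_of_lt (pow_le_pow_of_le_one (hv.1 _) hvt.le (by omega)) hm2
    · rw [map_pow, nav_pow hv]
      exact lt_of_le_of_lt (pow_le_pow_of_le_one (hv.1 _) hvt.le (by omega)) hm3
  set Q : Fin n → K := x₀ + (embJ K hn).mulVec ![c, 0] with hQ
  have hQp : ∀ k, Q (Fin.castLE hn k) = x₀ (Fin.castLE hn k) + ![c, 0] k := by
    intro k
    rw [← embJ_proj hn Q k, hQ, Matrix.mulVec_add, Matrix.mulVec_mulVec, embJ_mul,
      Matrix.one_mulVec, Pi.add_apply, embJ_proj]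
  let Φ : FreeGroup Bool →* Equiv.Perm (Fin n → K) :=
    (affHom hn Q).comp ((Matrix.SpecialLinearGroup.map j).comp (FreeGroup.lift (gens t)))
  have hmap : ∀ i, (Matrix.SpecialLinearGroup.map j) (gens t i) = gens (j t) i := by
    intro i
    ext k l
    change j ((gens t i).1 k l) = (gens (j t) i).1 k l
    cases i <;> fin_cases k <;> fin_cases l <;> simp [gens, genA, genB]
  have hΦof : ∀ i x, Φ (FreeGroup.of i) x = (linA hn (gens (j t) i).1).mulVec (x - Q) + Q := by
    intro i x
    simp only [Φ, MonoidHom.comp_apply, FreeGroup.lift_apply_of, hmap, affHom_apply]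
  have hiso : ∀ i y, N ((linA hn (gens (j t) i).1).mulVec y) = N y := by
    intro i y
    by_cases hy : y = 0
    · rw [hy, Matrix.mulVec_zero]
    apply norm_eq_of_sub_lt hv hN
    have hNy : 0 < N y := lt_of_le_of_ne (hN.1 _) (Ne.symm (by rw [Ne, hN.2.1]; exact hy))
    have hm0 : 0 ≤ maxNorm v y := (hv.1 _).trans (le_maxNorm v y (Fin.castLE hn 0))
    have h1 := linA_sub_bound hv hn (gens (j t) i).1 (v (j t)) (gens_bound hv (j t) htv1 i) y
      (maxNorm v y) hm0 (fun k => le_maxNorm v y _)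
    have hmp : 0 < maxNorm v y := by
      rcases hm0.lt_or_eq with h | h
      · exact h
      · have := (heq y).2; rw [← h] at this; linarith
    calc N ((linA hn (gens (j t) i).1).mulVec y - y)
        ≤ C₂ * maxNorm v ((linA hn (gens (j t) i).1).mulVec y - y) := (heq _).2
      _ ≤ C₂ * (v (j t) * maxNorm v y) := by gcongr
      _ < C₂ * (C₁ / C₂ * maxNorm v y) := by gcongr
      _ = C₁ * maxNorm v y := by field_simp
      _ ≤ N y := (heq y).1
  have hisoA : ∀ i x y, N (Φ (FreeGroup.of i) x - Φ (FreeGroup.of i) y) = N (x - y) := by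
    intro i x y
    rw [hΦof, hΦof, add_sub_add_right_eq_sub, ← Matrix.mulVec_sub, hiso]
    congr 1; abel
  have hdisp : ∀ i, N (Φ (FreeGroup.of i) x₀ - x₀) < r := by
    intro i
    have e : Φ (FreeGroup.of i) x₀ - x₀ =
        (linA hn (gens (j t) i).1).mulVec (x₀ - Q) - (x₀ - Q) := by
      rw [hΦof]; abel
    rw [e]
    have h1 := linA_sub_bound hv hn (gens (j t) i).1 (v (j t)) (gens_bound hv (j t) htv1 i)
      (x₀ - Q) (v c) hc0.le (fun k => by
        rw [Pi.sub_apply, hQp, sub_add_cancel_left, nav_neg hv]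
        fin_cases k
        · simp
        · simp [(hv.2.1 0).2 rfl, hv.1])
    calc _ ≤ C₂ * maxNorm v ((linA hn (gens (j t) i).1).mulVec (x₀ - Q) - (x₀ - Q)) := (heq _).2
      _ ≤ C₂ * (v (j t) * v c) := by gcongr
      _ < C₂ * (r / (C₂ * v c) * v c) := by gcongr
      _ = r := by field_simp
  have hEof : ∀ i x, N (Φ (FreeGroup.of i) x - x₀) = r ↔ N (x - x₀) = r := by
    intro i x
    have h1 := hisoA i x x₀
    have h2 := hdisp i
    set y := Φ (FreeGroup.of i) x
    set z := Φ (FreeGroup.of i) x₀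
    constructor
    · intro h
      rw [← h1, ← h]
      apply norm_eq_of_sub_lt hv hN
      rw [h]
      have : y - z - (y - x₀) = -(z - x₀) := by abel
      rwa [this, norm_neg' hv hN]
    · intro h
      rw [← h, ← h1]
      apply norm_eq_of_sub_lt hv hN
      rw [h1, h]
      have : y - x₀ - (y - z) = (z - x₀) := by abel
      rwa [this]
  have hEall : ∀ g x, N (Φ g x - x₀) = r ↔ N (x - x₀) = r := by
    intro g
    induction g using FreeGroup.induction_on with
    | C1 => intro x; simp
    | of i => exact hEof i
    | inv_of i ih =>
      intro x
      have := ih (Φ (FreeGroup.of i)⁻¹ x)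
      rw [← Equiv.Perm.mul_apply, ← map_mul, mul_inv_cancel, map_one, Equiv.Perm.one_apply] at this
      exact this.symm
    | mul g h hg hh =>
      intro x
      rw [map_mul, Equiv.Perm.mul_apply, hg, hh]
  refine paradox_of_free _ _ Φ (fun g x hx => (hEall g x).2 hx) ?_ ?_ ?_
  · intro g hg x hx hfix
    have hdet := det_ne w t htw g hg
    set A := FreeGroup.lift (gens t) g with hA
    have h1 : Φ g x = (linA hn (Matrix.SpecialLinearGroup.map j A).1).mulVec (x - Q) + Q := rfl
    rw [h1] at hfix
    have h2 : (linA hn (Matrix.SpecialLinearGroup.map j A).1).mulVec (x - Q) - (x - Q) = 0 := by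
      rw [sub_eq_zero]; exact eq_sub_of_add_eq hfix
    rw [linA_sub] at h2
    have h3 := congrArg ((embJ K hn).transpose.mulVec) h2
    rw [Matrix.mulVec_mulVec, embJ_mul, Matrix.one_mulVec, Matrix.mulVec_zero] at h3
    have h4 : ((Matrix.SpecialLinearGroup.map j A).1 - 1).det = 0 := by
      apply Matrix.exists_mulVec_eq_zero_iff.1
      refine ⟨_, ?_, h3⟩
      intro h0
      have h5 := congrFun h0 0
      rw [embJ_proj, Pi.sub_apply, hQp] at h5
      simp only [Matrix.cons_val_zero, Pi.zero_apply] at h5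
      have h6 : c = (x - x₀) (Fin.castLE hn 0) := by
        rw [Pi.sub_apply]; linear_combination -h5
      have h7 := le_maxNorm v (x - x₀) (Fin.castLE hn 0)
      rw [← h6] at h7
      have h8 := (heq (x - x₀)).1
      rw [show N (x - x₀) = r from hx] at h8
      rw [div_lt_iff₀ hC₁] at hc
      nlinarith
    apply hdet
    apply hj
    rw [map_zero, RingHom.map_det, ← h4]
    congr 1
    simp [Matrix.map_sub]
  · refine ⟨⟨1, 0, fun x => by simp⟩, Function.surjective_id, fun x y => rfl⟩
  · intro i
    refine ⟨⟨linA hn (gens (j t) i).1, Q - (linA hn (gens (j t) i).1).mulVec Q, fun x => ?_⟩,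
      (Φ (FreeGroup.of i)).surjective, hisoA i⟩
    rw [hΦof, Matrix.mulVec_sub]
    abel

/-! Part 6: existence of the auxiliary absolute value -/
noncomputable def intAbs : AbsoluteValue ℤ ℝ where
  toFun z := |(z : ℝ)|
  map_mul' x y := by push_cast; exact abs_mul _ _
  nonneg' x := abs_nonneg _
  eq_zero' x := by simp
  add_le' x y := by push_cast; exact abs_add_le _ _

open Polynomial in
noncomputable def degAbs (k : Type*) [CommRing k] [IsDomain k] : AbsoluteValue k[X] ℝ := by
  classical
  exact
  { toFun := fun p => if p = 0 then 0 else 2 ^ p.natDegree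
    map_mul' := fun p q => by
      by_cases hp : p = 0
      · simp [hp]
      by_cases hq : q = 0
      · simp [hq]
      simp [hp, hq, natDegree_mul hp hq, pow_add]
    nonneg' := fun p => by
      by_cases hp : p = 0
      · simp [hp]
      · simp [hp]
    eq_zero' := fun p => by
      by_cases hp : p = 0
      · simp [hp]
      · simp [hp]
    add_le' := fun p q => by
      by_cases hp : p = 0
      · simp [hp]
      by_cases hq : q = 0
      · simp [hq]
      by_cases hpq : p + q = 0
      · simp [hpq, hp, hq]; positivity
      simp only [hp, hq, hpq, if_false]
      have h := natDegree_add_le p q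
      have h2 : (2 : ℝ) ^ (p + q).natDegree ≤ 2 ^ (max p.natDegree q.natDegree) :=
        pow_le_pow_right₀ (by norm_num) h
      have h3 : (0 : ℝ) < 2 ^ p.natDegree := by positivity
      have h4 : (0 : ℝ) < 2 ^ q.natDegree := by positivity
      rcases max_choice p.natDegree q.natDegree with h' | h' <;> rw [h'] at h2 <;> linarith }

theorem degAbs_X (k : Type*) [CommRing k] [IsDomain k] :
    1 < degAbs k (Polynomial.X : Polynomial k) := by
  unfold degAbs
  simp

theorem nav_int {K : Type*} [Field K] {v : K → ℝ} (hv : IsNAVal v) (m : ℤ) : v (m : K) ≤ 1 := by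
  have hnat : ∀ k : ℕ, v (k : K) ≤ 1 := by
    intro k
    induction k with
    | zero => simp [(hv.2.1 0).2 rfl]
    | succ k ih => push_cast; exact nav_add_le hv ih (nav_one hv).le
  cases m with
  | ofNat k => simpa using hnat k
  | negSucc k =>
    rw [Int.cast_negSucc, nav_neg hv]; exact hnat _

open Polynomial in
theorem nav_transc {K : Type*} [Field K] {v : K → ℝ} (hv : IsNAVal v)
    (k : Subring K) (hk1 : ∀ x ∈ k, x ≠ 0 → v x = 1) (t : K) (ht0 : t ≠ 0) (ht : v t < 1) :
    Function.Injective (eval₂RingHom k.subtype t) := by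
  have hle : ∀ x ∈ k, v x ≤ 1 := by
    intro x hx
    by_cases h : x = 0
    · rw [h, (hv.2.1 0).2 rfl]; exact zero_le_one
    · exact (hk1 x hx h).le
  have hint : ∀ p : k[X], v (eval₂RingHom k.subtype t p) ≤ 1 := by
    intro p
    induction p using Polynomial.induction_on' with
    | add p q hp hq => rw [map_add]; exact nav_add_le hv hp hq
    | monomial m a =>
      simp only [coe_eval₂RingHom, eval₂_monomial]
      rw [hv.2.2.1, nav_pow hv]
      exact mul_le_one₀ (hle _ a.2) (pow_nonneg (hv.1 _) _) (pow_le_one₀ (hv.1 _) ht.le)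
  rw [injective_iff_map_eq_zero]
  have key : ∀ (d : ℕ) (p : k[X]), p.natDegree ≤ d → eval₂RingHom k.subtype t p = 0 → p = 0 := by
    intro d
    induction d with
    | zero =>
      intro p hp h0
      rw [eq_C_of_natDegree_le_zero hp] at h0 ⊢
      simp at h0
      simp [h0]
    | succ d ih =>
      intro p hp h0
      have hdec := divX_mul_X_add p
      have h1 : eval₂RingHom k.subtype t p.divX * t + (p.coeff 0 : K) = 0 := by
        rw [← h0]
        conv_rhs => rw [← hdec]
        simp
      have hc : p.coeff 0 = 0 := by
        by_contra hne
        have h2 := hk1 (p.coeff 0 : K) (p.coeff 0).2 (by simpa using hne)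
        have h3 : (p.coeff 0 : K) = -(eval₂RingHom k.subtype t p.divX * t) := by
          linear_combination h1
        rw [h3, nav_neg hv, hv.2.2.1] at h2
        have := hint p.divX
        have := hv.1 t
        nlinarith
      rw [hc] at h1
      simp only [ZeroMemClass.coe_zero, add_zero, mul_eq_zero, ht0, or_false] at h1
      have h4 := ih p.divX (by rw [natDegree_divX_eq_natDegree_tsub_one]; omega) h1
      rw [← hdec, h4, hc]; simp
  exact fun p h => key _ p le_rfl h


theorem statement12 {K : Type*} [Field K] (v : K → ℝ) (hv : IsNAVal v)
    (hnt : ∃ c : K, c ≠ 0 ∧ v c ≠ 1)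
    (n : ℕ) (hn : 2 ≤ n) (N : (Fin n → K) → ℝ) (hN : IsNANorm v N)
    -- N is equivalent to the maximum norm
    (heq : ∃ C₁ C₂ : ℝ, 0 < C₁ ∧ 0 < C₂ ∧
      ∀ x : Fin n → K, C₁ * maxNorm v x ≤ N x ∧ N x ≤ C₂ * maxNorm v x)
    (x₀ : Fin n → K) (r : ℝ) (hr : 0 < r)
    (hne : {x : Fin n → K | N (x - x₀) = r}.Nonempty) :
    ParadoxicalUsing {f | MemIA N f} {x : Fin n → K | N (x - x₀) = r} 4 := by
  obtain ⟨C₁, C₂, hC₁, hC₂, heq⟩ := heq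
  by_cases hcase : ∃ m : ℤ, (m : K) ≠ 0 ∧ v (m : K) < 1
  · obtain ⟨m, hm0, hm1⟩ := hcase
    have hchar : Function.Injective (Int.castRingHom K) := by
      rw [injective_iff_map_eq_zero]
      intro a ha
      by_contra hne
      simp only [eq_intCast] at ha
      -- positive characteristic
      obtain ⟨p, hp⟩ := CharP.exists K
      rcases CharP.char_is_prime_or_zero K p with hpp | hp0
      · haveI := Fact.mk hpp
        have h1 : (m : ZMod p) ≠ 0 := by
          intro h
          apply hm0
          rw [ZMod.intCast_zmod_eq_zero_iff_dvd] at h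
          exact (CharP.intCast_eq_zero_iff K p m).2 h
        have h2 := ZMod.pow_card_sub_one_eq_one h1
        have h3 : (m : K) ^ (p - 1) = 1 := by
          have := congrArg (ZMod.castHom (dvd_refl p) K) h2
          simpa using this
        have h4 := congrArg v h3
        rw [nav_pow hv, nav_one hv] at h4
        have := pow_lt_one₀ (hv.1 (m : K)) hm1 (n := p - 1) (by have := hpp.two_le; omega)
        linarith
      · subst hp0
        haveI := CharP.charP_to_charZero K
        exact hne (by exact_mod_cast ha)
    refine main_geo v hv n hn N hN C₁ C₂ hC₁ hC₂ heq x₀ r hr (Int.castRingHom K) hchar intAbs m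
      ?_ (by simpa using hm1)
    change (1 : ℝ) < |(m : ℝ)|
    have hm00 : m ≠ 0 := by rintro rfl; simp at hm0
    have hm11 : |m| ≠ 1 := by
      intro h
      rcases (abs_eq (by norm_num)).1 h with h | h
      · rw [h] at hm1; simp [nav_one hv] at hm1
      · rw [h] at hm1; simp [nav_neg hv, nav_one hv] at hm1
    have : 1 < |m| := by have := abs_pos.2 hm00; omega
    exact_mod_cast this
  · push Not at hcase
    obtain ⟨t, ht0, ht⟩ : ∃ t : K, t ≠ 0 ∧ v t < 1 := by
      obtain ⟨c, hc0, hc1⟩ := hnt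
      rcases lt_or_gt_of_ne hc1 with h | h
      · exact ⟨c, hc0, h⟩
      · exact ⟨c⁻¹, inv_ne_zero hc0, by rw [nav_inv hv c hc0]; exact inv_lt_one_of_one_lt₀ h⟩
    have hinj := nav_transc hv (Int.castRingHom K).range (by
      rintro x ⟨m, rfl⟩ hx
      exact le_antisymm (nav_int hv m) (hcase m hx)) t ht0 ht
    refine main_geo v hv n hn N hN C₁ C₂ hC₁ hC₂ heq x₀ r hr _ hinj (degAbs _) Polynomial.X ?_
      (by simpa using ht)
    exact degAbs_X _
end

section
/- Let (X,‖·‖) be a finite-dimensional non-Archimedean normed space over a complete non-Archimedean nontrivially valued field (K,|·|), with dim X ≥ 2. Then X, every closed ball {x : ‖x−x₀‖ ≤ r}, every open ball {x : ‖x−x₀‖ < r}, and every nonempty sphere {x : ‖x−x₀‖ = r} (x₀ ∈ X, r > 0) are paradoxical using four pieces with respect to the group of surjective affine isometries of (X,‖·‖). -/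
/-- `(K, v)` is complete: every Cauchy sequence with respect to the metric
`d (x, y) = v (x - y)` converges. -/
def IsCompleteVF {K : Type*} [Field K] (v : K → ℝ) : Prop :=
  ∀ s : ℕ → K,
    (∀ δ : ℝ, 0 < δ → ∃ M : ℕ, ∀ p q : ℕ, M ≤ p → M ≤ q → v (s p - s q) < δ) →
    ∃ l : K, ∀ δ : ℝ, 0 < δ → ∃ M : ℕ, ∀ p : ℕ, M ≤ p → v (s p - l) < δ

/-- The group of surjective affine isometries of a normed space `(X, N)` over `K`,
as a set of transformations of `X`. -/
def AffineIsometries (K : Type*) [Field K] {X : Type*} [AddCommGroup X] [Module K X]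
    (N : X → ℝ) : Set (X → X) :=
  {f | (∃ (L : X →ₗ[K] X) (τ : X), ∀ x, f x = L x + τ) ∧
    Function.Surjective f ∧ ∀ x y, N (f x - f y) = N (x - y)}


namespace S13

/-- inverse letter -/
def linv (l : Bool × Bool) : Bool × Bool := (l.1, !l.2)

/-- letter as group element -/
def el (l : Bool × Bool) : FreeGroup Bool := FreeGroup.mk [l]

lemma linv_linv (l : Bool × Bool) : linv (linv l) = l := by simp [linv]

lemma linv_ne (l : Bool × Bool) : linv l ≠ l := by
  rcases l with ⟨a, b⟩; cases b <;> simp [linv]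

lemma el_linv (l : Bool × Bool) : el (linv l) = (el l)⁻¹ := by
  simp [el, linv, FreeGroup.inv_mk, FreeGroup.invRev]

lemma chain_iff (a b : Bool × Bool) : (a.1 = b.1 → a.2 = b.2) ↔ b ≠ linv a := by
  revert a b; decide

lemma red_cons (l : Bool × Bool) (L : List (Bool × Bool)) :
    FreeGroup.IsReduced (l :: L) ↔ (L.head? ≠ some (linv l) ∧ FreeGroup.IsReduced L) := by
  cases L with
  | nil => simp [FreeGroup.IsReduced]
  | cons m L =>
    rw [FreeGroup.IsReduced, List.isChain_cons_cons, chain_iff]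
    simp [FreeGroup.IsReduced]

lemma toWord_mk_of_red {L : List (Bool × Bool)} (h : FreeGroup.IsReduced L) :
    (FreeGroup.mk L).toWord = L := by
  rw [FreeGroup.toWord_mk, h.reduce_eq]

lemma mk_cons (l : Bool × Bool) (L : List (Bool × Bool)) :
    FreeGroup.mk (l :: L) = el l * FreeGroup.mk L := by
  rw [el, FreeGroup.mul_mk]; rfl

lemma toWord_el_mul (l : Bool × Bool) (k : FreeGroup Bool)
    (h : k.toWord.head? ≠ some (linv l)) : (el l * k).toWord = l :: k.toWord := by
  conv_lhs => rw [← FreeGroup.mk_toWord (x := k), ← mk_cons]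
  exact toWord_mk_of_red ((red_cons _ _).2 ⟨h, FreeGroup.isReduced_toWord⟩)

lemma head_el_mul' (l : Bool × Bool) (k : FreeGroup Bool)
    (h : k.toWord.head? = some (linv l)) : (el l * k).toWord.head? ≠ some l := by
  obtain ⟨L, hL⟩ : ∃ L, k.toWord = linv l :: L := by
    cases hk : k.toWord with
    | nil => simp [hk] at h
    | cons m L => simp [hk] at h; exact ⟨L, by rw [h]⟩
  have hr : FreeGroup.IsReduced (linv l :: L) := hL ▸ FreeGroup.isReduced_toWord
  rw [red_cons, linv_linv] at hr
  have : el l * k = FreeGroup.mk L := by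
    rw [← FreeGroup.mk_toWord (x := k), hL, mk_cons, el_linv]; group
  rw [this, toWord_mk_of_red hr.2]
  exact hr.1

lemma head_mul_el (k : FreeGroup Bool) (l : Bool × Bool) (h : 1 < k.toWord.length) :
    (k * el l).toWord.head? = k.toWord.head? ∧
      k.toWord.length ≤ (k * el l).toWord.length + 1 := by
  obtain h0 | ⟨w, m, hw⟩ := List.eq_nil_or_concat k.toWord
  · simp [h0] at h
  have hr : FreeGroup.IsReduced k.toWord := FreeGroup.isReduced_toWord
  rw [List.concat_eq_append] at hw
  by_cases hm : l = linv m
  · have hr' : FreeGroup.IsReduced w := by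
      rw [hw] at hr; exact hr.infix ⟨[], [m], by simp⟩
    have : k * el l = FreeGroup.mk w := by
      rw [← FreeGroup.mk_toWord (x := k), hw, ← FreeGroup.mul_mk, hm, el_linv]
      exact mul_inv_cancel_right _ _
    rw [this, toWord_mk_of_red hr', hw]
    rw [hw] at h
    cases w with
    | nil => simp at h
    | cons a b => simp
  · have hr' : FreeGroup.IsReduced (w ++ [m] ++ [l]) := by
      apply FreeGroup.IsReduced.append_overlap
      · rwa [← hw]
      · rw [List.singleton_append, red_cons]
        exact ⟨by simpa using hm, by simp [FreeGroup.IsReduced]⟩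
      · simp
    have : k * el l = FreeGroup.mk (w ++ [m] ++ [l]) := by
      rw [← FreeGroup.mul_mk, ← hw, FreeGroup.mk_toWord]; rfl
    rw [this, toWord_mk_of_red hr', hw]
    cases w <;> simp

lemma head_mul_mk (L : List (Bool × Bool)) : ∀ (k : FreeGroup Bool),
    L.length + 1 < k.toWord.length → (k * FreeGroup.mk L).toWord.head? = k.toWord.head? := by
  induction L with
  | nil => intro k _; rw [← FreeGroup.one_eq_mk, mul_one]
  | cons l L ih =>
    intro k hk
    have hk' : L.length + 1 + 1 < k.toWord.length := by simpa using hk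
    obtain ⟨h1, h2⟩ := head_mul_el k l (by omega)
    rw [mk_cons, ← mul_assoc, ih _ (by omega), h1]

lemma length_large (g u : FreeGroup Bool) (hu : u ≠ 1) (m : ℕ) :
    ∀ᶠ n in (Filter.hyperfilter ℕ : Filter ℕ), m < (g * u ^ n).toWord.length := by
  apply Filter.Eventually.filter_mono Filter.hyperfilter_le_cofinite
  rw [Filter.eventually_cofinite]
  have hinj : Function.Injective (fun n : ℕ => (g * u ^ n).toWord) := by
    intro a b hab
    have h1 := FreeGroup.toWord_injective hab
    have h2 : u ^ a = u ^ b := mul_left_cancel h1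
    exact (injective_pow_iff_not_isOfFinOrder.2 (not_isOfFinOrder_of_isMulTorsionFree hu)) h2
  refine Set.Finite.subset ((List.finite_length_le (Bool × Bool) m).preimage hinj.injOn) ?_
  intro n hn
  simpa using hn

lemma exists_mu (g u : FreeGroup Bool) (hu : u ≠ 1) :
    ∃ l : Bool × Bool, ∀ᶠ n in (Filter.hyperfilter ℕ : Filter ℕ),
      (g * u ^ n).toWord.head? = some l := by
  obtain ⟨o, ho⟩ := Ultrafilter.eq_pure_of_finite
    ((Filter.hyperfilter ℕ).map (fun n : ℕ => (g * u ^ n).toWord.head?))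
  have h1 : ∀ᶠ n in (Filter.hyperfilter ℕ : Filter ℕ), (g * u ^ n).toWord.head? = o := by
    have : {o} ∈ (Filter.hyperfilter ℕ).map (fun n : ℕ => (g * u ^ n).toWord.head?) := by
      rw [ho]; exact Set.mem_singleton o
    exact this
  cases o with
  | some l => exact ⟨l, h1⟩
  | none =>
    obtain ⟨n, hn1, hn2⟩ := (h1.and (length_large g u hu 0)).exists
    simp only [List.head?_eq_none_iff] at hn1
    simp [hn1] at hn2

open Classical in
/-- the limiting first letter -/
noncomputable def mu (g u : FreeGroup Bool) : Bool × Bool :=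
  if hu : u ≠ 1 then (exists_mu g u hu).choose else (true, true)

lemma mu_spec (g u : FreeGroup Bool) (hu : u ≠ 1) :
    ∀ᶠ n in (Filter.hyperfilter ℕ : Filter ℕ), (g * u ^ n).toWord.head? = some (mu g u) := by
  rw [mu, dif_pos hu]; exact (exists_mu g u hu).choose_spec

lemma mu_flip (g u : FreeGroup Bool) (hu : u ≠ 1) (l : Bool × Bool) :
    mu g u = linv l ↔ ¬ mu (el l * g) u = l := by
  obtain ⟨n, hn1, hn2⟩ := ((mu_spec g u hu).and (mu_spec (el l * g) u hu)).exists
  constructor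
  · intro h h'
    rw [h] at hn1
    rw [h', mul_assoc] at hn2
    exact head_el_mul' l _ hn1 hn2
  · intro h
    by_contra h'
    rw [mul_assoc, toWord_el_mul] at hn2
    · simp at hn2; exact h hn2.symm
    · rw [hn1]; simpa using h'

lemma mu_mul (g u v : FreeGroup Bool) (hu : u ≠ 1) (hc : u * v = v * u) :
    mu (g * v) u = mu g u := by
  obtain ⟨n, ⟨hn1, hn2⟩, hn3⟩ := (((mu_spec g u hu).and (mu_spec (g * v) u hu)).and
    (length_large g u hu (v.toWord.length + 1))).exists
  have : g * v * u ^ n = g * u ^ n * FreeGroup.mk v.toWord := by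
    have h : Commute v (u ^ n) := (show Commute v u from hc.symm).pow_right n
    rw [FreeGroup.mk_toWord, mul_assoc, h.eq, mul_assoc]
  rw [this, head_mul_mk _ _ hn3, hn1] at hn2
  simpa using hn2.symm

lemma exists_select {X : Type*} (ρ : FreeGroup Bool →* Equiv.Perm X)
    (hc : ∀ (p : X) (u v : FreeGroup Bool), ρ u p = p → ρ v p = p → u * v = v * u) :
    ∃ lam : X → Bool × Bool, ∀ x l, lam x = l ↔ ¬ lam (ρ (el l) x) = linv l := by
  classical
  let st : Setoid X :=
    { r := fun x y => ∃ g, ρ g x = y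
      iseqv := ⟨fun x => ⟨1, by simp⟩, fun {x y} ⟨g, h⟩ => ⟨g⁻¹, by rw [← h, map_inv]; simp⟩,
        fun {x y z} ⟨g, h⟩ ⟨g', h'⟩ => ⟨g' * g, by rw [map_mul, Equiv.Perm.mul_apply, h, h']⟩⟩ }
  let rep : X → X := fun x => (Quotient.mk st x).out
  have hrep : ∀ x, ∃ g, ρ g (rep x) = x := fun x => Quotient.exact (Quotient.out_eq (Quotient.mk st x))
  have hrep' : ∀ x g, rep (ρ g x) = rep x := by
    intro x g
    have : Quotient.mk st (ρ g x) = Quotient.mk st x :=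
      (Quotient.sound (s := st) (⟨g, rfl⟩ : ∃ g', ρ g' x = ρ g x)).symm
    simp only [rep, this]
  choose γ hγ using hrep
  have hu : ∀ p : X, ∃ u : FreeGroup Bool, u ≠ 1 ∧ ∀ v, ρ v p = p → u * v = v * u := by
    intro p
    by_cases h : ∃ u, u ≠ 1 ∧ ρ u p = p
    · obtain ⟨u, h1, h2⟩ := h
      exact ⟨u, h1, fun v hv => hc p u v h2 hv⟩
    · push Not at h
      refine ⟨FreeGroup.of true, FreeGroup.of_ne_one _, fun v hv => ?_⟩
      by_cases hv1 : v = 1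
      · simp [hv1]
      · exact absurd hv (h v hv1)
  choose U hU1 hU2 using hu
  have key : ∀ p g g', ρ g p = ρ g' p → mu g (U p) = mu g' (U p) := by
    intro p g g' h
    have : g' = g * (g⁻¹ * g') := by group
    rw [this, mu_mul _ _ _ (hU1 p)]
    apply hU2
    rw [map_mul, Equiv.Perm.mul_apply, ← h, map_inv]; simp
  refine ⟨fun x => linv (mu (γ x) (U (rep x))), fun x l => ?_⟩
  have h1 : mu (γ (ρ (el l) x)) (U (rep x)) = mu (el l * γ x) (U (rep x)) := by
    apply key
    have := hγ (ρ (el l) x)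
    rw [hrep'] at this
    rw [this, map_mul, Equiv.Perm.mul_apply, hγ]
  simp only [hrep', h1]
  have h2 : ∀ a b : Bool × Bool, linv a = b ↔ a = linv b := by decide
  have h3 : ∀ a b : Bool × Bool, linv a = linv b ↔ a = b := by decide
  rw [h2, h3]
  exact mu_flip _ _ (hU1 _) l

end S13
namespace S13

lemma half {X : Type*} (ρ : FreeGroup Bool →* Equiv.Perm X) (lam : X → Bool × Bool)
    (hl : ∀ x l, lam x = l ↔ ¬ lam (ρ (el l) x) = linv l)
    (E : Set X) (hE : ∀ i x, ρ (FreeGroup.of i) x ∈ E ↔ x ∈ E) (i : Bool) :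
    Disjoint {x | x ∈ E ∧ lam x = (i, false)}
      (ρ (FreeGroup.of i) '' {x | x ∈ E ∧ lam x = (i, true)}) ∧
    {x | x ∈ E ∧ lam x = (i, false)} ∪
      (ρ (FreeGroup.of i) '' {x | x ∈ E ∧ lam x = (i, true)}) = E := by
  have hel : el (i, true) = FreeGroup.of i := rfl
  have hl' : ∀ x, lam x = (i, true) ↔ ¬ lam (ρ (FreeGroup.of i) x) = (i, false) := fun x => hl x _
  constructor
  · rw [Set.disjoint_left]
    rintro x ⟨_, h1⟩ ⟨y, ⟨_, h2⟩, rfl⟩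
    exact (hl' y).1 h2 h1
  · ext x
    constructor
    · rintro (⟨h, _⟩ | ⟨y, ⟨h, _⟩, rfl⟩)
      · exact h
      · exact (hE i y).2 h
    · intro hx
      by_cases h : lam x = (i, false)
      · exact Or.inl ⟨hx, h⟩
      · right
        obtain ⟨y, rfl⟩ := (ρ (FreeGroup.of i)).surjective x
        exact ⟨y, ⟨(hE i y).1 hx, (hl' y).2 h⟩, rfl⟩

lemma paradox {X : Type*} (S : Set (X → X)) (ρ : FreeGroup Bool →* Equiv.Perm X)
    (hc : ∀ (p : X) (u v : FreeGroup Bool), ρ u p = p → ρ v p = p → u * v = v * u)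
    (hS : ∀ i, (ρ (FreeGroup.of i) : X → X) ∈ S) (hid : id ∈ S)
    (E : Set X) (hE : ∀ i x, ρ (FreeGroup.of i) x ∈ E ↔ x ∈ E) :
    ParadoxicalUsing S E 4 := by
  obtain ⟨lam, hl⟩ := exists_select ρ hc
  have hh := half ρ lam hl E hE
  have hd : ∀ a b : Bool × Bool, a ≠ b →
      Disjoint {x | x ∈ E ∧ lam x = a} {x | x ∈ E ∧ lam x = b} := by
    intro a b hab
    rw [Set.disjoint_left]
    rintro x ⟨_, h1⟩ ⟨_, h2⟩
    exact hab (h1.symm.trans h2)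
  have hs : ∀ a : Bool × Bool, {x | x ∈ E ∧ lam x = a} ⊆ E := fun a x h => h.1
  refine ⟨2, 2, by norm_num, by norm_num, by norm_num,
    ![{x | x ∈ E ∧ lam x = (true, false)}, {x | x ∈ E ∧ lam x = (true, true)}],
    ![{x | x ∈ E ∧ lam x = (false, false)}, {x | x ∈ E ∧ lam x = (false, true)}],
    ![id, ρ (FreeGroup.of true)], ![id, ρ (FreeGroup.of false)], ?_⟩
  have hU : ∀ f : Fin 2 → Set X, (⋃ i, f i) = f 0 ∪ f 1 := by
    intro f; ext x; simp [Fin.exists_fin_two]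
  simp only [Fin.forall_fin_two, hU, Matrix.cons_val_zero, Matrix.cons_val_one, Set.image_id,
    ne_eq, not_true_eq_false, false_imp_iff, true_and, and_true]
  refine ⟨⟨hid, hS _⟩, ⟨hid, hS _⟩, ⟨hs _, hs _⟩, ⟨hs _, hs _⟩,
    ⟨fun _ => hd _ _ (by decide), fun _ => hd _ _ (by decide)⟩,
    ⟨fun _ => hd _ _ (by decide), fun _ => hd _ _ (by decide)⟩,
    ⟨⟨hd _ _ (by decide), hd _ _ (by decide)⟩, ⟨hd _ _ (by decide), hd _ _ (by decide)⟩⟩, ?_,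
    ⟨fun _ => (hh true).1, fun _ => (hh true).1.symm⟩, (hh true).2,
    ⟨fun _ => (hh false).1, fun _ => (hh false).1.symm⟩, (hh false).2⟩
  ext x
  rcases h : lam x with ⟨a, b⟩
  cases a <;> cases b <;> simp [h]

end S13
namespace S13

section Ping
variable {V : Type*} (ρ : FreeGroup Bool →* Equiv.Perm V)

/-- walk step along a letter -/
def T (l : Bool × Bool) (P : V) : V := ρ (el l)⁻¹ P

lemma T_linv (l : Bool × Bool) (P : V) : T ρ (linv l) (T ρ l P) = P := by
  simp [T, el_linv]

lemma run_cons (l : Bool × Bool) (L : List (Bool × Bool)) (P : V) :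
    ρ (FreeGroup.mk (l :: L))⁻¹ P = ρ (FreeGroup.mk L)⁻¹ (T ρ l P) := by
  rw [mk_cons, mul_inv_rev, map_mul, Equiv.Perm.mul_apply]; rfl

variable {O : Type*} [LinearOrder O] (f : V → O) (m : O)

lemma up (H1 : ∀ P, m < f P → ∀ l l', l ≠ l' → f P < f (T ρ l P) ∨ f P < f (T ρ l' P))
    (L : List (Bool × Bool)) : ∀ (l : Bool × Bool) (P : V), FreeGroup.IsReduced (l :: L) →
    m < f (T ρ l P) → f P ≤ f (T ρ l P) →
    f (T ρ l P) ≤ f (ρ (FreeGroup.mk (l :: L))⁻¹ P) ∧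
      (L ≠ [] → f (T ρ l P) < f (ρ (FreeGroup.mk (l :: L))⁻¹ P)) := by
  induction L with
  | nil =>
    intro l P _ _ _
    rw [run_cons, ← FreeGroup.one_eq_mk]; simp
  | cons k L ih =>
    intro l P hr h1 h2
    rw [red_cons] at hr
    have hk : k ≠ linv l := by simpa using hr.1
    have h3 : f (T ρ l P) < f (T ρ k (T ρ l P)) := by
      rcases H1 _ h1 k (linv l) hk with h | h
      · exact h
      · rw [T_linv] at h; exact absurd h2 (not_le.2 h)
    have := (ih k (T ρ l P) hr.2 (h1.trans h3) h3.le).1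
    rw [run_cons]
    exact ⟨(h3.trans_le this).le, fun _ => h3.trans_le this⟩

lemma det (H1 : ∀ P, m < f P → ∀ l l', l ≠ l' → f P < f (T ρ l P) ∨ f P < f (T ρ l' P))
    (H2 : ∀ P, f P ≤ m → ∀ l₁ l₂ l₃, l₁ ≠ l₂ → l₁ ≠ l₃ → l₂ ≠ l₃ →
      m < f (T ρ l₁ P) ∨ m < f (T ρ l₂ P) ∨ m < f (T ρ l₃ P))
    (L₁ : List (Bool × Bool)) : ∀ (L₂ : List (Bool × Bool)) (l : Bool × Bool) (P : V),
    f P ≤ m → f (T ρ l P) ≤ m →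
    FreeGroup.IsReduced (l :: L₁) → FreeGroup.IsReduced (l :: L₂) → L₁.length = L₂.length →
    f (ρ (FreeGroup.mk (l :: L₁))⁻¹ P) ≤ m → f (ρ (FreeGroup.mk (l :: L₂))⁻¹ P) ≤ m →
    L₁ = L₂ := by
  induction L₁ with
  | nil => intro L₂ l P _ _ _ _ h _ _; simpa [eq_comm] using h
  | cons x L₁ ih =>
    intro L₂ l P hP hQ hr1 hr2 hlen he1 he2
    cases L₂ with
    | nil => simp at hlen
    | cons y L₂ =>
      rw [red_cons] at hr1 hr2
      have hx : x ≠ linv l := by simpa using hr1.1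
      have hy : y ≠ linv l := by simpa using hr2.1
      rw [run_cons] at he1 he2
      have in1 : ∀ (x : Bool × Bool) (L : List (Bool × Bool)), FreeGroup.IsReduced (x :: L) →
          f (ρ (FreeGroup.mk (x :: L))⁻¹ (T ρ l P)) ≤ m → f (T ρ x (T ρ l P)) ≤ m := by
        intro x L hr he
        by_contra h
        push Not at h
        have := (up ρ f m H1 L x (T ρ l P) hr h (hQ.trans h.le)).1
        exact absurd (h.trans_le this) (not_lt.2 he)
      have hfx := in1 x L₁ hr1.2 he1
      have hfy := in1 y L₂ hr2.2 he2
      have hxy : x = y := by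
        by_contra hne
        rcases H2 _ hQ x y (linv l) hne hx hy with h | h | h
        · exact absurd h (not_lt.2 hfx)
        · exact absurd h (not_lt.2 hfy)
        · rw [T_linv] at h; exact absurd h (not_lt.2 hP)
      subst hxy
      rw [ih L₂ x (T ρ l P) hQ hfx hr1.2 hr2.2 (by simpa using hlen) he1 he2]

/-- first-letter data of a nontrivial element fixing a point of the core -/
lemma inD (H1 : ∀ P, m < f P → ∀ l l', l ≠ l' → f P < f (T ρ l P) ∨ f P < f (T ρ l' P))
    (P : V) (hP : f P ≤ m) (l : Bool × Bool) (L : List (Bool × Bool))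
    (hr : FreeGroup.IsReduced (l :: L)) (h : ρ (FreeGroup.mk (l :: L))⁻¹ P = P) :
    f (T ρ l P) ≤ m := by
  by_contra h'
  push Not at h'
  have := (up ρ f m H1 L l P hr h' (hP.trans h'.le)).1
  rw [h] at this
  exact absurd (h'.trans_le this) (not_lt.2 hP)

lemma fix_inv {u : FreeGroup Bool} {P : V} (h : ρ u P = P) : ρ u⁻¹ P = P := by
  rw [map_inv, Equiv.Perm.inv_eq_iff_eq, h]

lemma same_first (H1 : ∀ P, m < f P → ∀ l l', l ≠ l' → f P < f (T ρ l P) ∨ f P < f (T ρ l' P))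
    (H2 : ∀ P, f P ≤ m → ∀ l₁ l₂ l₃, l₁ ≠ l₂ → l₁ ≠ l₃ → l₂ ≠ l₃ →
      m < f (T ρ l₁ P) ∨ m < f (T ρ l₂ P) ∨ m < f (T ρ l₃ P))
    (P : V) (hP : f P ≤ m) (u v : FreeGroup Bool) (hu : ρ u P = P) (hv : ρ v P = P)
    (hlen : u.toWord.length = v.toWord.length) (hh : u.toWord.head? = v.toWord.head?) : u = v := by
  apply FreeGroup.toWord_injective
  have hru : FreeGroup.IsReduced u.toWord := FreeGroup.isReduced_toWord
  have hrv : FreeGroup.IsReduced v.toWord := FreeGroup.isReduced_toWord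
  have hu' := fix_inv ρ hu
  have hv' := fix_inv ρ hv
  rw [← FreeGroup.mk_toWord (x := u)] at hu'
  rw [← FreeGroup.mk_toWord (x := v)] at hv'
  cases hU : u.toWord with
  | nil => rw [hU] at hlen; symm; simpa [eq_comm] using hlen
  | cons l L =>
    cases hV : v.toWord with
    | nil => simp [hU, hV] at hlen
    | cons k L' =>
      rw [hU, hV] at hh hlen
      rw [hU] at hru hu'
      rw [hV] at hrv hv'
      have hk : l = k := by simpa using hh
      subst hk
      rw [det ρ f m H1 H2 L L' l P hP (inD ρ f m H1 P hP l L hru hu') hru hrv (by simpa using hlen)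
        (by rw [hu']; exact hP) (by rw [hv']; exact hP)]

lemma head_fix (H1 : ∀ P, m < f P → ∀ l l', l ≠ l' → f P < f (T ρ l P) ∨ f P < f (T ρ l' P))
    (P : V) (hP : f P ≤ m) (u : FreeGroup Bool) (hu : ρ u P = P) (hu1 : u ≠ 1) :
    ∃ l, u.toWord.head? = some l ∧ f (T ρ l P) ≤ m := by
  have hru : FreeGroup.IsReduced u.toWord := FreeGroup.isReduced_toWord
  have hu' := fix_inv ρ hu
  rw [← FreeGroup.mk_toWord (x := u)] at hu'
  cases hU : u.toWord with
  | nil => exact absurd (FreeGroup.toWord_eq_nil_iff.1 hU) hu1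
  | cons l L =>
    rw [hU] at hru hu'
    exact ⟨l, rfl, inD ρ f m H1 P hP l L hru hu'⟩

lemma head_inv (u : FreeGroup Bool) (l : Bool × Bool) (h : u⁻¹.toWord.head? = some l) :
    u.toWord.getLast? = some (linv l) := by
  rw [FreeGroup.toWord_inv, FreeGroup.invRev, List.head?_reverse, List.getLast?_map] at h
  cases hL : u.toWord.getLast? with
  | none => simp [hL] at h
  | some k => simp [hL] at h; simp [← h, linv]

lemma toWord_mul_red (u v : FreeGroup Bool) (l k : Bool × Bool)
    (h1 : u⁻¹.toWord.head? = some l) (h2 : v.toWord.head? = some k) (hlk : l ≠ k) :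
    (u * v).toWord = u.toWord ++ v.toWord := by
  rw [FreeGroup.toWord_mul]
  apply FreeGroup.IsReduced.reduce_eq
  rw [FreeGroup.IsReduced, List.isChain_append]
  refine ⟨FreeGroup.isReduced_toWord, FreeGroup.isReduced_toWord, ?_⟩
  intro x hx y hy
  rw [head_inv u l h1] at hx
  rw [h2] at hy
  simp at hx hy
  rw [chain_iff, ← hx, ← hy, linv_linv]
  exact hlk.symm

lemma core_comm (H1 : ∀ P, m < f P → ∀ l l', l ≠ l' → f P < f (T ρ l P) ∨ f P < f (T ρ l' P))
    (H2 : ∀ P, f P ≤ m → ∀ l₁ l₂ l₃, l₁ ≠ l₂ → l₁ ≠ l₃ → l₂ ≠ l₃ →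
      m < f (T ρ l₁ P) ∨ m < f (T ρ l₂ P) ∨ m < f (T ρ l₃ P))
    (P : V) (hP : f P ≤ m) (u v : FreeGroup Bool) (hu : ρ u P = P) (hv : ρ v P = P) :
    u * v = v * u := by
  by_cases hu1 : u = 1
  · simp [hu1]
  by_cases hv1 : v = 1
  · simp [hv1]
  have hne : ∀ w : FreeGroup Bool, w ≠ 1 → ρ w P = P → w.toWord.head? ≠ w⁻¹.toWord.head? := by
    intro w hw hwP h
    have h1 := same_first ρ f m H1 H2 P hP w w⁻¹ hwP (fix_inv ρ hwP)
      (by rw [FreeGroup.toWord_inv, FreeGroup.invRev_length]) h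
    have h2 : w ^ 2 = 1 := by
      rw [pow_two]; nth_rewrite 2 [h1]; simp
    exact hw ((pow_eq_one_iff_left (two_ne_zero)).1 h2)
  obtain ⟨a, ha, ha'⟩ := head_fix ρ f m H1 P hP u hu hu1
  obtain ⟨b, hb, hb'⟩ := head_fix ρ f m H1 P hP u⁻¹ (fix_inv ρ hu) (by simpa using hu1)
  have hab : a ≠ b := by
    intro h; apply hne u hu1 hu; rw [ha, hb, h]
  have main : ∀ w : FreeGroup Bool, ρ w P = P → w⁻¹.toWord.head? = some b →
      w.toWord.head? = some a → u * w = w * u := by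
    intro w hw hwb hwa
    have e1 := toWord_mul_red u w b a hb hwa hab.symm
    have e2 := toWord_mul_red w u b a hwb ha hab.symm
    apply same_first ρ f m H1 H2 P hP
    · rw [map_mul, Equiv.Perm.mul_apply, hw, hu]
    · rw [map_mul, Equiv.Perm.mul_apply, hu, hw]
    · rw [e1, e2]; simp [add_comm]
    · rw [e1, e2, List.head?_append, List.head?_append, ha, hwa]
  obtain ⟨c, hc, hc'⟩ := head_fix ρ f m H1 P hP v hv hv1
  obtain ⟨d, hd, hd'⟩ := head_fix ρ f m H1 P hP v⁻¹ (fix_inv ρ hv) (by simpa using hv1)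
  have hcd : c ≠ d := by
    intro h; apply hne v hv1 hv; rw [hc, hd, h]
  have two : ∀ e, f (T ρ e P) ≤ m → e = a ∨ e = b := by
    intro e he
    by_contra h
    push Not at h
    rcases H2 P hP e a b h.1 h.2 hab with h | h | h
    · exact absurd h (not_lt.2 he)
    · exact absurd h (not_lt.2 ha')
    · exact absurd h (not_lt.2 hb')
  rcases two c hc' with rfl | rfl
  · rcases two d hd' with rfl | rfl
    · exact absurd rfl hcd
    · exact main v hv hd hc
  · rcases two d hd' with rfl | rfl
    · have := main v⁻¹ (fix_inv ρ hv) (by simpa using hc) hd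
      have h2 : Commute u v⁻¹ := this
      exact (Commute.inv_right_iff.1 h2).eq
    · exact absurd rfl hcd

lemma outer_free [WellFoundedLT O]
    (H1 : ∀ P, m < f P → ∀ l l', l ≠ l' → f P < f (T ρ l P) ∨ f P < f (T ρ l' P))
    (P : V) (u : FreeGroup Bool) (hu : ρ u P = P) (hu1 : u ≠ 1) :
    ∃ g, f (ρ g P) ≤ m := by
  obtain ⟨Q, ⟨g, hg⟩, hmin⟩ := WellFounded.has_min
    (InvImage.wf f (wellFounded_lt (α := O))) {Q | ∃ g, ρ g P = Q} ⟨P, 1, by simp⟩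
  refine ⟨g, ?_⟩
  rw [hg]
  by_contra hQ
  push Not at hQ
  have hmin' : ∀ l, f Q ≤ f (T ρ l Q) := by
    intro l
    have := hmin (T ρ l Q) ⟨(el l)⁻¹ * g, by rw [map_mul, Equiv.Perm.mul_apply, hg]; rfl⟩
    exact not_lt.1 this
  set w := g * u * g⁻¹ with hw
  have hw1 : w ≠ 1 := by
    intro h; apply hu1
    have : u = g⁻¹ * w * g := by rw [hw]; group
    rw [this, h]; simp
  have hwQ : ρ w Q = Q := by
    rw [hw, ← hg]; simp [hu]
  have hru : FreeGroup.IsReduced w.toWord := FreeGroup.isReduced_toWord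
  have hw' := fix_inv ρ hwQ
  rw [← FreeGroup.mk_toWord (x := w)] at hw'
  cases hW : w.toWord with
  | nil => exact hw1 (FreeGroup.toWord_eq_nil_iff.1 hW)
  | cons l L =>
    rw [hW] at hru hw'
    have h1 := (up ρ f m H1 L l Q hru (hQ.trans_le (hmin' l)) (hmin' l)).2
    rw [hw'] at h1
    by_cases hL : L = []
    · subst hL
      rw [run_cons, ← FreeGroup.one_eq_mk] at hw'
      have h2 : T ρ l Q = Q := by simpa using hw'
      have h3 : T ρ (linv l) Q = Q := by
        conv_lhs => rw [← h2]
        rw [T_linv]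
      rcases H1 Q hQ l (linv l) (linv_ne l).symm with h | h
      · rw [h2] at h; exact lt_irrefl _ h
      · rw [h3] at h; exact lt_irrefl _ h
    · exact absurd (h1 hL) (not_lt.2 (hmin' l))

end Ping
end S13
namespace S13

section Model
variable {R : Type*} [CommRing R]

/-- first generator -/
def genA (s : R) : Equiv.Perm (R × R) where
  toFun P := (P.1 + s ^ 2 * P.1 + s * P.2, P.2 + s * P.1)
  invFun P := (P.1 - s * P.2, P.2 - s * P.1 + s ^ 2 * P.2)
  left_inv P := by ext <;> simp <;> ring
  right_inv P := by ext <;> simp <;> ring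

/-- second generator -/
def genB (s c k : R) (hk : k * (1 - c) = 1) (z : R) : Equiv.Perm (R × R) where
  toFun P :=
    (P.1 + (s ^ 2 * (P.1 + P.2 - z) + s * (P.1 + c * P.2 - c ^ 2 * z)) -
      k * (s ^ 2 * (P.1 + P.2 - z) + s * (P.1 + c * P.2 - c ^ 2 * z) - s * (P.1 + P.2 - z)),
     P.2 + k * (s ^ 2 * (P.1 + P.2 - z) + s * (P.1 + c * P.2 - c ^ 2 * z) - s * (P.1 + P.2 - z)))
  invFun P :=
    (P.1 + (- s * (P.1 + c * P.2 - c ^ 2 * z)) -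
      k * (- s * (P.1 + c * P.2 - c ^ 2 * z) -
        (- s * (P.1 + P.2 - z) + s ^ 2 * (P.1 + c * P.2 - c ^ 2 * z))),
     P.2 + k * (- s * (P.1 + c * P.2 - c ^ 2 * z) -
        (- s * (P.1 + P.2 - z) + s ^ 2 * (P.1 + c * P.2 - c ^ 2 * z))))
  left_inv P := by
    rcases P with ⟨x, y⟩
    ext
    · simp only
      linear_combination (-(k * (s + s ^ 2) - s) * (s ^ 2 * (x + y - z) + s * (x + c * y - c ^ 2 * z) - s * (x + y - z))) * hk
    · simp only
      linear_combination (k * (s + s ^ 2) * (s ^ 2 * (x + y - z) + s * (x + c * y - c ^ 2 * z) - s * (x + y - z))) * hk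
  right_inv P := by
    rcases P with ⟨x, y⟩
    ext
    · simp only
      linear_combination (-(s - k * s) * (- s * (x + c * y - c ^ 2 * z) - (- s * (x + y - z) + s ^ 2 * (x + c * y - c ^ 2 * z)))) * hk
    · simp only
      linear_combination (-(k * s) * (- s * (x + c * y - c ^ 2 * z) - (- s * (x + y - z) + s ^ 2 * (x + c * y - c ^ 2 * z)))) * hk

end Model
end S13
namespace S13
section Rho
variable {R : Type*} [CommRing R]

/-- the two generators -/
def gen (s c k : R) (hk : k * (1 - c) = 1) (z : R) : Bool → Equiv.Perm (R × R)
  | true => genA s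
  | false => genB s c k hk z

/-- the affine action -/
def rho (s c k : R) (hk : k * (1 - c) = 1) (z : R) : FreeGroup Bool →* Equiv.Perm (R × R) :=
  FreeGroup.lift (gen s c k hk z)

lemma rho_of (s c k : R) (hk : k * (1 - c) = 1) (z : R) (i : Bool) :
    rho s c k hk z (FreeGroup.of i) = gen s c k hk z i := by simp [rho]

lemma rho_lin (s c k : R) (hk : k * (1 - c) = 1) (w : FreeGroup Bool) :
    ∃ a b e a' b' e' : R, ∀ z x y : R,
      rho s c k hk z w (x, y) = (a * x + b * y + e * z, a' * x + b' * y + e' * z) := by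
  induction w using FreeGroup.induction_on with
  | C1 => exact ⟨1, 0, 0, 0, 1, 0, fun z x y => by simp⟩
  | of i =>
    cases i with
    | true =>
      refine ⟨1 + s ^ 2, s, 0, s, 1, 0, fun z x y => ?_⟩
      rw [rho_of]
      ext <;> simp [gen, genA] <;> ring
    | false =>
      refine ⟨1 + (s ^ 2 + s) - k * (s ^ 2), s ^ 2 + s * c - k * (s ^ 2 + s * c - s),
        -(s ^ 2 + s * c ^ 2) + k * (s ^ 2 + s * c ^ 2 - s), k * s ^ 2,
        1 + k * (s ^ 2 + s * c - s), -(k * (s ^ 2 + s * c ^ 2 - s)), fun z x y => ?_⟩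
      rw [rho_of]
      ext <;> simp [gen, genB] <;> ring
  | inv_of i _ =>
    cases i with
    | true =>
      refine ⟨1, -s, 0, -s, 1 + s ^ 2, 0, fun z x y => ?_⟩
      rw [map_inv, rho_of]
      ext <;> simp [gen, genA, Equiv.Perm.inv_def, Equiv.symm] <;> ring
    | false =>
      refine ⟨1 - s - k * (- s ^ 2), -(s * c) - k * (- (s * c) + s - s ^ 2 * c),
        s * c ^ 2 - k * (s * c ^ 2 - s + s ^ 2 * c ^ 2), k * (- s ^ 2),
        1 + k * (- (s * c) + s - s ^ 2 * c), k * (s * c ^ 2 - s + s ^ 2 * c ^ 2),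
        fun z x y => ?_⟩
      rw [map_inv, rho_of]
      ext <;> simp [gen, genB, Equiv.Perm.inv_def, Equiv.symm] <;> ring
  | mul u v hu hv =>
    obtain ⟨a, b, e, a', b', e', h⟩ := hu
    obtain ⟨m, n, q, m', n', q', h'⟩ := hv
    refine ⟨a * m + b * m', a * n + b * n', a * q + b * q' + e,
      a' * m + b' * m', a' * n + b' * n', a' * q + b' * q' + e', fun z x y => ?_⟩
    rw [map_mul, Equiv.Perm.mul_apply, h', h]
    ext <;> simp <;> ring

lemma rho_map {R' : Type*} [CommRing R'] (φ : R →+* R') (s c k : R) (hk : k * (1 - c) = 1)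
    (s' c' k' : R') (hk' : k' * (1 - c') = 1) (hs : φ s = s') (hc : φ c = c') (hkk : φ k = k')
    (z : R) (w : FreeGroup Bool) : ∀ P : R × R,
    rho s' c' k' hk' (φ z) w (φ P.1, φ P.2) =
      (φ (rho s c k hk z w P).1, φ (rho s c k hk z w P).2) := by
  subst hs hc hkk
  have hof : ∀ (i : Bool) (P : R × R), rho (φ s) (φ c) (φ k) hk' (φ z) (FreeGroup.of i)
      (φ P.1, φ P.2) = (φ (rho s c k hk z (FreeGroup.of i) P).1,
        φ (rho s c k hk z (FreeGroup.of i) P).2) := by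
    intro i P
    rw [rho_of, rho_of]
    cases i <;> ext <;> simp [gen, genA, genB]
  induction w using FreeGroup.induction_on with
  | C1 => intro P; simp
  | of i => exact hof i
  | inv_of i _ =>
    intro P
    rw [map_inv, map_inv, Equiv.Perm.inv_eq_iff_eq]
    have := hof i ((rho s c k hk z (FreeGroup.of i))⁻¹ P)
    rw [this]; simp
  | mul u v hu hv =>
    intro P
    rw [map_mul, map_mul, Equiv.Perm.mul_apply, Equiv.Perm.mul_apply, hv, hu]

end Rho

section Poly
open Polynomial
variable {K : Type*} [Field K] 

/-- residual linear forms attached to letters -/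
def LL (c : K) (l : Bool × Bool) (x y z : K) : K :=
  match l with
  | (true, false) => x
  | (true, true) => y
  | (false, false) => x + y - z
  | (false, true) => x + c * y - c ^ 2 * z

lemma LL_H1 (c : K) (h0 : c ≠ 0) (h1 : c ≠ 1) (x y : K) (hxy : ¬ (x = 0 ∧ y = 0))
    (l l' : Bool × Bool) (hl : l ≠ l') : LL c l x y 0 ≠ 0 ∨ LL c l' x y 0 ≠ 0 := by
  by_contra h
  push Not at h
  obtain ⟨e1, e2⟩ := h
  apply hxy
  have h1' : c - 1 ≠ 0 := sub_ne_zero.2 h1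
  have red : x + y = 0 → x + c * y = 0 → x = 0 ∧ y = 0 := by
    intro e1 e2
    have hy : (c - 1) * y = 0 := by linear_combination e2 - e1
    have hy0 : y = 0 := by simpa [h1'] using hy
    exact ⟨by simpa [hy0] using e1, hy0⟩
  rcases l with ⟨_ | _, _ | _⟩ <;> rcases l' with ⟨_ | _, _ | _⟩ <;>
    simp [LL] at e1 e2 hl <;>
    first
    | exact red e1 e2
    | exact red e2 e1
    | simp_all

lemma LL_H2 (c : K) (h0 : c ≠ 0) (h1 : c ≠ 1) (h2 : c ^ 2 ≠ 1) (x y z : K) (hz : z ≠ 0)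
    (l₁ l₂ l₃ : Bool × Bool) (h12 : l₁ ≠ l₂) (h13 : l₁ ≠ l₃) (h23 : l₂ ≠ l₃) :
    LL c l₁ x y z ≠ 0 ∨ LL c l₂ x y z ≠ 0 ∨ LL c l₃ x y z ≠ 0 := by
  by_contra h
  push Not at h
  obtain ⟨e1, e2, e3⟩ := h
  have h1' : c - 1 ≠ 0 := sub_ne_zero.2 h1
  have h2' : c ^ 2 - 1 ≠ 0 := sub_ne_zero.2 h2
  have A : x = 0 → y = 0 → x + y - z = 0 → False := by
    intro a b e; apply hz; linear_combination a + b - e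
  have B : x = 0 → y = 0 → x + c * y - c ^ 2 * z = 0 → False := by
    intro a b e
    have : c ^ 2 * z = 0 := by linear_combination a + c * b - e
    simp [h0, hz] at this
  have C1 : x = 0 → x + y - z = 0 → x + c * y - c ^ 2 * z = 0 → False := by
    intro a b e
    have : c * ((c - 1) * z) = 0 := by linear_combination c * b - e + (1 - c) * a
    simp [h0, hz, h1'] at this
  have D : y = 0 → x + y - z = 0 → x + c * y - c ^ 2 * z = 0 → False := by
    intro a b e
    have : (c ^ 2 - 1) * z = 0 := by linear_combination b - e + (c - 1) * a
    simp [hz, h2'] at this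
  rcases l₁ with ⟨_ | _, _ | _⟩ <;> rcases l₂ with ⟨_ | _, _ | _⟩ <;>
    first
    | exact absurd rfl h12
    | (rcases l₃ with ⟨_ | _, _ | _⟩ <;>
        first
        | exact absurd rfl h13
        | exact absurd rfl h23
        | (simp only [LL] at e1 e2 e3
           first
           | exact A (by assumption) (by assumption) (by assumption)
           | exact B (by assumption) (by assumption) (by assumption)
           | exact C1 (by assumption) (by assumption) (by assumption)
           | exact D (by assumption) (by assumption) (by assumption)))

lemma hkC (c k : K) (hk : k * (1 - c) = 1) : (C k : K[X]) * (1 - C c) = 1 := by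
  rw [← C_1, ← C_sub, ← C_mul, hk]

/-- height -/
noncomputable def ht (P : K[X] × K[X]) : WithBot ℕ := max P.1.degree P.2.degree

lemma lt_ht_of_coeff (P : K[X] × K[X]) (M n : ℕ) (hn : M < n)
    (h : P.1.coeff n ≠ 0 ∨ P.2.coeff n ≠ 0) : (M : WithBot ℕ) < ht P := by
  have hMn : (M : WithBot ℕ) < n := by exact_mod_cast hn
  rcases h with h | h
  · exact hMn.trans_le ((le_degree_of_ne_zero h).trans (le_max_left _ _))
  · exact hMn.trans_le ((le_degree_of_ne_zero h).trans (le_max_right _ _))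

lemma coeff_up (f g : K[X]) (M : ℕ) (hf : f.degree ≤ M) (hg : g.degree ≤ M) :
    (f + X ^ 2 * f + X * g).coeff (M + 2) = f.coeff M := by
  have h1 : f.coeff (M + 2) = 0 := coeff_eq_zero_of_degree_lt
    (hf.trans_lt (by exact_mod_cast (by omega : M < M + 2)))
  have h2 : g.coeff (M + 1) = 0 := coeff_eq_zero_of_degree_lt
    (hg.trans_lt (by exact_mod_cast (by omega : M < M + 1)))
  rw [coeff_add, coeff_add, h1, coeff_X_pow_mul, show M + 2 = (M + 1) + 1 from rfl, coeff_X_mul, h2]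
  simp

lemma ht_up (c k : K) (hk : k * (1 - c) = 1) (P : K[X] × K[X]) (z : K[X]) (M : ℕ)
    (h1 : P.1.degree ≤ M) (h2 : P.2.degree ≤ M) (hz : z.degree ≤ M) (l : Bool × Bool)
    (hl : LL c l (P.1.coeff M) (P.2.coeff M) (z.coeff M) ≠ 0) :
    (M : WithBot ℕ) < ht (T (rho X (C c) (C k) (hkC c k hk) z) l P) := by
  have hzc : z.coeff (M + 2) = 0 := coeff_eq_zero_of_degree_lt
    (hz.trans_lt (by exact_mod_cast (by omega : M < M + 2)))
  obtain ⟨x, y⟩ := P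
  simp only at h1 h2 hl
  have d3 : (x + y - z).degree ≤ M :=
    (degree_sub_le _ _).trans (max_le ((degree_add_le _ _).trans (max_le h1 h2)) hz)
  have d4 : (x + C c * y - C c ^ 2 * z).degree ≤ M := by
    have e1 : (C c * y).degree ≤ M := by
      rw [← smul_eq_C_mul]; exact (degree_smul_le _ _).trans h2
    have e2 : (C c ^ 2 * z).degree ≤ M := by
      rw [← C_pow, ← smul_eq_C_mul]; exact (degree_smul_le _ _).trans hz
    exact (degree_sub_le _ _).trans (max_le ((degree_add_le _ _).trans (max_le h1 e1)) e2)
  apply lt_ht_of_coeff _ M (M + 2) (by omega)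
  rcases l with ⟨_ | _, _ | _⟩
  · -- generator b
    have hT : T (rho X (C c) (C k) (hkC c k hk) z) (false, false) (x, y) =
        genB X (C c) (C k) (hkC c k hk) z (x, y) := by
      have : (el (false, false))⁻¹ = FreeGroup.of false := by rw [← el_linv]; rfl
      rw [T, this, rho_of]; rfl
    rw [hT]
    set Q := genB X (C c) (C k) (hkC c k hk) z (x, y) with hQ
    have hs : Q.1 + Q.2 - z = (x + y - z) + X ^ 2 * (x + y - z) +
        X * (x + C c * y - C c ^ 2 * z) := by
      simp only [hQ, genB, Equiv.coe_fn_mk]; ring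
    have := coeff_up _ _ M d3 d4
    rw [← hs] at this
    by_contra hcon
    push Not at hcon
    rw [coeff_sub, coeff_add, hcon.1, hcon.2, hzc] at this
    apply hl
    simp only [LL]
    rw [← coeff_add, ← coeff_sub, ← this]; simp
  · have hT : T (rho X (C c) (C k) (hkC c k hk) z) (false, true) (x, y) =
        (genB X (C c) (C k) (hkC c k hk) z).symm (x, y) := by
      rw [T, map_inv, show el (false, true) = FreeGroup.of false from rfl, rho_of]; rfl
    rw [hT]
    set Q := (genB X (C c) (C k) (hkC c k hk) z).symm (x, y) with hQ
    have hs : Q.1 + C c * Q.2 - C c ^ 2 * z = (x + C c * y - C c ^ 2 * z) +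
        X ^ 2 * (x + C c * y - C c ^ 2 * z) + X * (-(x + y - z)) := by
      simp only [hQ, genB, Equiv.coe_fn_symm_mk]
      linear_combination (-(- X * (x + C c * y - C c ^ 2 * z) -
        (- X * (x + y - z) + X ^ 2 * (x + C c * y - C c ^ 2 * z)))) * (hkC c k hk)
    have := coeff_up _ _ M d4 (by rw [degree_neg]; exact d3 : (-(x + y - z)).degree ≤ M)
    rw [← hs] at this
    by_contra hcon
    push Not at hcon
    rw [← C_pow, coeff_sub, coeff_add, coeff_C_mul, coeff_C_mul, hcon.1, hcon.2, hzc] at this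
    apply hl
    simp only [LL]
    rw [coeff_sub, coeff_add, coeff_C_mul, coeff_C_mul] at this
    rw [← this]; simp
  · have hT : T (rho X (C c) (C k) (hkC c k hk) z) (true, false) (x, y) = genA X (x, y) := by
      have : (el (true, false))⁻¹ = FreeGroup.of true := by rw [← el_linv]; rfl
      rw [T, this, rho_of]; rfl
    rw [hT]
    left
    have := coeff_up x y M h1 h2
    simp only [genA, Equiv.coe_fn_mk]
    rw [this]; exact hl
  · have hT : T (rho X (C c) (C k) (hkC c k hk) z) (true, true) (x, y) =
        (genA X).symm (x, y) := by
      rw [T, map_inv, show el (true, true) = FreeGroup.of true from rfl, rho_of]; rfl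
    rw [hT]
    right
    have := coeff_up y (-x) M h2 (by rw [degree_neg]; exact h1)
    have e : ((genA X).symm (x, y)).2 = y + X ^ 2 * y + X * (-x) := by
      simp only [genA, Equiv.coe_fn_symm_mk]; ring
    rw [e, this]; exact hl

lemma poly_H1 (c k : K) (hk : k * (1 - c) = 1) (h0 : c ≠ 0) (h1 : c ≠ 1) (z : K[X]) 
    (P : K[X] × K[X]) (hP : z.degree < ht P) (l l' : Bool × Bool) (hl : l ≠ l') :
    ht P < ht (T (rho X (C c) (C k) (hkC c k hk) z) l P) ∨
    ht P < ht (T (rho X (C c) (C k) (hkC c k hk) z) l' P) := by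
  obtain ⟨M, hM⟩ : ∃ M : ℕ, ht P = M := by
    cases h : ht P with
    | bot => rw [h] at hP; exact absurd hP not_lt_bot
    | coe M => exact ⟨M, rfl⟩
  have e1 : P.1.degree ≤ M := hM ▸ le_max_left _ _
  have e2 : P.2.degree ≤ M := hM ▸ le_max_right _ _
  rw [hM] at hP ⊢
  have hz : z.coeff M = 0 := coeff_eq_zero_of_degree_lt hP
  have hne : ¬ (P.1.coeff M = 0 ∧ P.2.coeff M = 0) := by
    rintro ⟨a, b⟩
    have a' := lt_of_le_of_ne e1 (fun h => coeff_ne_zero_of_eq_degree h a)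
    have b' := lt_of_le_of_ne e2 (fun h => coeff_ne_zero_of_eq_degree h b)
    have : ht P < M := max_lt a' b'
    rw [hM] at this; exact lt_irrefl _ this
  have := LL_H1 c h0 h1 _ _ hne l l' hl
  exact this.imp (fun h => ht_up c k hk P z M e1 e2 hP.le l (by rw [hz]; exact h))
    (fun h => ht_up c k hk P z M e1 e2 hP.le l' (by rw [hz]; exact h))

lemma poly_H2 (c k : K) (hk : k * (1 - c) = 1) (h0 : c ≠ 0) (h1 : c ≠ 1) (h2 : c ^ 2 ≠ 1)
    (z : K[X]) (hz : z ≠ 0)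
    (P : K[X] × K[X]) (hP : ht P ≤ z.degree) (l₁ l₂ l₃ : Bool × Bool)
    (h12 : l₁ ≠ l₂) (h13 : l₁ ≠ l₃) (h23 : l₂ ≠ l₃) :
    z.degree < ht (T (rho X (C c) (C k) (hkC c k hk) z) l₁ P) ∨
    z.degree < ht (T (rho X (C c) (C k) (hkC c k hk) z) l₂ P) ∨
    z.degree < ht (T (rho X (C c) (C k) (hkC c k hk) z) l₃ P) := by
  have e1 : P.1.degree ≤ z.degree := (le_max_left _ _).trans hP
  have e2 : P.2.degree ≤ z.degree := (le_max_right _ _).trans hP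
  have hzl : z.coeff z.natDegree ≠ 0 := by simpa using hz
  have hd := degree_eq_natDegree hz
  rw [hd] at e1 e2 ⊢
  have := LL_H2 c h0 h1 h2 (P.1.coeff z.natDegree) (P.2.coeff z.natDegree) _ hzl l₁ l₂ l₃ h12 h13 h23
  exact this.imp (ht_up c k hk P z _ e1 e2 hd.le l₁)
    (Or.imp (ht_up c k hk P z _ e1 e2 hd.le l₂) (ht_up c k hk P z _ e1 e2 hd.le l₃))

lemma poly_comm (c k : K) (hk : k * (1 - c) = 1) (h0 : c ≠ 0) (h1 : c ≠ 1) (h2 : c ^ 2 ≠ 1)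
    (z : K[X]) (hz : z ≠ 0) (P : K[X] × K[X]) (u v : FreeGroup Bool)
    (hu : rho X (C c) (C k) (hkC c k hk) z u P = P)
    (hv : rho X (C c) (C k) (hkC c k hk) z v P = P) : u * v = v * u := by
  by_cases hu1 : u = 1
  · simp [hu1]
  have H1 := poly_H1 c k hk h0 h1 z
  have H2 := poly_H2 c k hk h0 h1 h2 z hz
  obtain ⟨g, hg⟩ := outer_free _ ht z.degree H1 P u hu hu1
  have := core_comm _ ht z.degree H1 H2 _ hg (g * u * g⁻¹) (g * v * g⁻¹)
    (by simp [hu]) (by simp [hv])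
  have h3 : g * (u * v) * g⁻¹ = g * (v * u) * g⁻¹ := by
    calc g * (u * v) * g⁻¹ = g * u * g⁻¹ * (g * v * g⁻¹) := by group
      _ = g * v * g⁻¹ * (g * u * g⁻¹) := this
      _ = _ := by group
  exact mul_left_cancel (mul_right_cancel h3)

lemma poly_free (c k : K) (hk : k * (1 - c) = 1) (h0 : c ≠ 0) (h1 : c ≠ 1)
    (P : K[X] × K[X]) (hP : P ≠ 0) (u : FreeGroup Bool)
    (hu : rho X (C c) (C k) (hkC c k hk) 0 u P = P) : u = 1 := by
  by_contra hu1
  obtain ⟨g, hg⟩ := outer_free _ ht (degree (0 : K[X])) (poly_H1 c k hk h0 h1 0) P u hu hu1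
  rw [degree_zero, le_bot_iff, ht, max_eq_bot, degree_eq_bot, degree_eq_bot] at hg
  have h3 : rho X (C c) (C k) (hkC c k hk) 0 g P = rho X (C c) (C k) (hkC c k hk) 0 g 0 := by
    obtain ⟨a, b, e, a', b', e', h⟩ := rho_lin (X : K[X]) (C c) (C k) (hkC c k hk) g
    have : rho X (C c) (C k) (hkC c k hk) 0 g (0, 0) = 0 := by rw [h]; ext <;> simp
    rw [show (0 : K[X] × K[X]) = (0, 0) from rfl, this]
    exact Prod.ext hg.1 hg.2
  exact hP ((rho X (C c) (C k) (hkC c k hk) 0 g).injective h3)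

lemma pair_poly (c k : K) (hk : k * (1 - c) = 1) (h0 : c ≠ 0) (h1 : c ≠ 1) (h2 : c ^ 2 ≠ 1)
    (u v : FreeGroup Bool) (huv : u * v ≠ v * u) :
    ∃ q : K[X], q ≠ 0 ∧ ∀ s : K, q.eval s ≠ 0 → ∀ p : K × K,
      rho s c k hk 1 u p = p → rho s c k hk 1 v p = p → False := by
  have hu1 : u ≠ 1 := by rintro rfl; simp at huv
  obtain ⟨a, b, e, a', b', e', h⟩ := rho_lin (X : K[X]) (C c) (C k) (hkC c k hk) u
  set d : K[X] := (a - 1) * (b' - 1) - b * a' with hd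
  set x : K[X] := -e * (b' - 1) + b * e' with hx
  set y : K[X] := -e' * (a - 1) + a' * e with hy
  have hd0 : d ≠ 0 := by
    intro hd0
    have fr := fun P hP => mt (poly_free c k hk h0 h1 P hP u) hu1
    have f1 : (b, 1 - a) = (0 : K[X] × K[X]) := by
      by_contra hne
      refine fr _ hne ?_
      rw [h]; ext1 <;> simp only
      · ring
      · rw [hd] at hd0; linear_combination -hd0
    have f2 : (1 - b', a') = (0 : K[X] × K[X]) := by
      by_contra hne
      refine fr _ hne ?_
      rw [h]; ext1 <;> simp only
      · rw [hd] at hd0; linear_combination -hd0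
      · ring
    have g1 := congrArg Prod.fst f1
    have g2 := congrArg Prod.snd f1
    have g3 := congrArg Prod.fst f2
    have g4 := congrArg Prod.snd f2
    simp only [Prod.fst_zero, Prod.snd_zero] at g1 g2 g3 g4
    refine fr (1, 0) (by simp) ?_
    rw [h]; ext1 <;> simp only
    · linear_combination -g2
    · linear_combination g4
  have hfix : rho X (C c) (C k) (hkC c k hk) d u (x, y) = (x, y) := by
    rw [h]; ext1 <;> simp only
    · rw [hx, hy, hd]; ring
    · rw [hx, hy, hd]; ring
  have hv : rho X (C c) (C k) (hkC c k hk) d v (x, y) ≠ (x, y) :=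
    fun hv => huv (poly_comm c k hk h0 h1 h2 d hd0 _ u v hfix hv)
  have spec : ∀ (s : K) (p : K × K), rho s c k hk 1 u p = p → rho s c k hk 1 v p = p →
      d.eval s * p.1 = x.eval s ∧ d.eval s * p.2 = y.eval s ∧
      (rho X (C c) (C k) (hkC c k hk) d v (x, y)).1.eval s = d.eval s * p.1 ∧
      (rho X (C c) (C k) (hkC c k hk) d v (x, y)).2.eval s = d.eval s * p.2 := by
    intro s p hp hpv
    have m1 := rho_map (evalRingHom s) X (C c) (C k) (hkC c k hk) s c k hk (by simp) (by simp)
      (by simp) 1 u (C p.1, C p.2)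
    rw [h] at m1
    simp only [coe_evalRingHom, eval_C, eval_one, eval_add, eval_mul, mul_one] at m1
    rw [hp] at m1
    have m11 := congrArg Prod.fst m1
    have m12 := congrArg Prod.snd m1
    simp only at m11 m12
    have t1 : d.eval s * p.1 = x.eval s := by
      simp only [hd, hx, eval_add, eval_mul, eval_sub, eval_neg, eval_one]
      linear_combination (1 - b'.eval s) * m11 + b.eval s * m12
    have t2 : d.eval s * p.2 = y.eval s := by
      simp only [hd, hy, eval_add, eval_mul, eval_sub, eval_neg, eval_one]
      linear_combination (1 - a.eval s) * m12 + a'.eval s * m11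
    have m2 := rho_map (evalRingHom s) X (C c) (C k) (hkC c k hk) s c k hk (by simp) (by simp)
      (by simp) d v (x, y)
    simp only [coe_evalRingHom] at m2
    rw [← t1, ← t2] at m2
    obtain ⟨A, B, E, A', B', E', hA⟩ := rho_lin s c k hk v
    have hpv' := hpv
    rw [show p = (p.1, p.2) from rfl, hA] at hpv'
    rw [hA] at m2
    have n1 := congrArg Prod.fst hpv'
    have n2 := congrArg Prod.snd hpv'
    have n3 := congrArg Prod.fst m2
    have n4 := congrArg Prod.snd m2
    simp only at n1 n2 n3 n4
    refine ⟨t1, t2, ?_, ?_⟩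
    · rw [← n3]; linear_combination (d.eval s) * n1
    · rw [← n4]; linear_combination (d.eval s) * n2
  by_cases hc1 : (rho X (C c) (C k) (hkC c k hk) d v (x, y)).1 = x
  · have hc2 : (rho X (C c) (C k) (hkC c k hk) d v (x, y)).2 - y ≠ 0 := by
      intro h'
      exact hv (Prod.ext hc1 (sub_eq_zero.1 h'))
    refine ⟨_, hc2, fun s hs p h3 h4 => hs ?_⟩
    obtain ⟨t1, t2, t3, t4⟩ := spec s p h3 h4
    rw [eval_sub, t4, t2, sub_self]
  · refine ⟨_, sub_ne_zero.2 hc1, fun s hs p h3 h4 => hs ?_⟩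
    obtain ⟨t1, t2, t3, t4⟩ := spec s p h3 h4
    rw [eval_sub, t3, t1, sub_self]

lemma bad_countable (c k : K) (hk : k * (1 - c) = 1) (h0 : c ≠ 0) (h1 : c ≠ 1) (h2 : c ^ 2 ≠ 1) :
    ∃ B : Set K, B.Countable ∧ ∀ s ∉ B, ∀ (p : K × K) (u v : FreeGroup Bool),
      rho s c k hk 1 u p = p → rho s c k hk 1 v p = p → u * v = v * u := by
  choose q hq hs using pair_poly c k hk h0 h1 h2
  refine ⟨⋃ u, ⋃ v, ⋃ h, {s | (q u v h).IsRoot s}, ?_, ?_⟩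
  · refine Set.countable_iUnion fun u => Set.countable_iUnion fun v => Set.countable_iUnion fun h => ?_
    exact (finite_setOfPred_isRoot (hq u v h)).countable
  · intro s hsB p u v hu hv
    by_contra h
    refine hs u v h s ?_ p hu hv
    intro h'
    apply hsB
    simp only [Set.mem_iUnion]
    exact ⟨u, v, h, h'⟩

end Poly
end S13
namespace S13
section Field
variable {K : Type*} [Field K] (v : K → ℝ) (hv : IsNAVal v)

lemma v_zero {v : K → ℝ} (hv : IsNAVal v) : v 0 = 0 := (hv.2.1 0).2 rfl

lemma v_one {v : K → ℝ} (hv : IsNAVal v) : v 1 = 1 := by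
  have h := hv.2.2.1 1 1
  have h' : v 1 ≠ 0 := fun h => one_ne_zero ((hv.2.1 1).1 h)
  rw [one_mul] at h
  exact (mul_left_cancel₀ h' (by rw [mul_one]; exact h)).symm

lemma v_neg {v : K → ℝ} (hv : IsNAVal v) (x : K) : v (-x) = v x := by
  have h : v (-1) * v (-1) = 1 := by rw [← hv.2.2.1]; simp [v_one hv]
  have h1 : v (-1) = 1 := by
    have := hv.1 (-1)
    nlinarith
  rw [← neg_one_mul, hv.2.2.1, h1, one_mul]

lemma v_big {v : K → ℝ} (hv : IsNAVal v) (hnt : ∃ c : K, c ≠ 0 ∧ v c ≠ 1) : ∃ x, 1 < v x := by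
  obtain ⟨c, h0, h1⟩ := hnt
  rcases lt_or_gt_of_ne h1 with h | h
  · refine ⟨c⁻¹, ?_⟩
    have h2 : v c * v c⁻¹ = 1 := by rw [← hv.2.2.1, mul_inv_cancel₀ h0, v_one hv]
    have h3 := hv.1 c
    have h4 := hv.1 c⁻¹
    by_contra h5
    push Not at h5
    nlinarith
  · exact ⟨c, h⟩

/-- the normed field attached to the valuation -/
@[reducible] def nf (hnt : ∃ c : K, c ≠ 0 ∧ v c ≠ 1) : NontriviallyNormedField K :=
  { ‹Field K› with
    norm := v
    dist := fun x y => v (x - y)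
    dist_self := fun x => by simp [v_zero hv]
    dist_comm := fun x y => by rw [← v_neg hv, neg_sub]
    dist_triangle := fun x y z => by
      have h := hv.2.2.2 (x - y) (y - z)
      rw [sub_add_sub_cancel] at h
      exact h.trans (max_le_add_of_nonneg (hv.1 _) (hv.1 _))
    eq_of_dist_eq_zero := fun {x y} h => sub_eq_zero.1 ((hv.2.1 _).1 h)
    dist_eq := fun x y => by
      change v (x - y) = v (-x + y)
      rw [← v_neg hv, neg_sub, neg_add_eq_sub]
    norm_mul := hv.2.2.1
    non_trivial := v_big hv hnt }

include hv in
lemma uncountable (hcomplete : IsCompleteVF v) (hnt : ∃ c : K, c ≠ 0 ∧ v c ≠ 1) :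
    ¬ (Set.univ : Set K).Countable := by
  letI := nf v hv hnt
  haveI : CompleteSpace K := by
    apply Metric.complete_of_cauchySeq_tendsto
    intro u hu
    rw [Metric.cauchySeq_iff] at hu
    obtain ⟨l, hl⟩ := hcomplete u (fun δ hδ => by
      obtain ⟨M, hM⟩ := hu δ hδ
      exact ⟨M, fun p q hp hq => hM p hp q hq⟩)
    refine ⟨l, ?_⟩
    rw [Metric.tendsto_atTop]
    intro ε hε
    exact hl ε hε
  have := continuum_le_cardinal_of_nontriviallyNormedField K
  intro h
  rw [← Cardinal.le_aleph0_iff_set_countable, Cardinal.mk_univ] at h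
  exact absurd (this.trans h) (not_le.2 Cardinal.aleph0_lt_continuum)

include hv in
lemma exists_small (hcomplete : IsCompleteVF v) (hnt : ∃ c : K, c ≠ 0 ∧ v c ≠ 1)
    (B : Set K) (hB : B.Countable) (δ : ℝ) (hδ : 0 < δ) : ∃ s ∉ B, v s < δ := by
  by_contra! hcon
  obtain ⟨b, hb⟩ := v_big hv hnt
  have hb0 : b ≠ 0 := by
    rintro rfl
    rw [v_zero hv] at hb
    linarith
  have hvp : ∀ n : ℕ, v (b ^ n) = v b ^ n := by
    intro n
    induction n with
    | zero => simp [v_one hv]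
    | succ n ih => rw [pow_succ, hv.2.2.1, ih, pow_succ]
  apply uncountable v hv hcomplete hnt
  have : (Set.univ : Set K) ⊆ ⋃ n : ℕ, (fun x => b ^ n * x) '' B := by
    intro x _
    obtain ⟨n, hn⟩ := pow_unbounded_of_one_lt (v x / δ) hb
    rw [Set.mem_iUnion]
    refine ⟨n, (b ^ n)⁻¹ * x, ?_, ?_⟩
    · by_contra hx
      have h1 := hcon _ hx
      have h2 : v x = v b ^ n * v ((b ^ n)⁻¹ * x) := by
        rw [← hvp, ← hv.2.2.1, mul_inv_cancel_left₀ (pow_ne_zero _ hb0)]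
      rw [div_lt_iff₀ hδ, h2] at hn
      have h3 : 0 < v b ^ n := by positivity
      nlinarith
    · exact mul_inv_cancel_left₀ (pow_ne_zero _ hb0) x
  exact (Set.countable_iUnion fun n => hB.image _).mono this

variable {X : Type*} [AddCommGroup X] [Module K X]

lemma N_zero {v : K → ℝ} {N : X → ℝ} (hN : IsNANorm v N) : N 0 = 0 := (hN.2.1 0).2 rfl

lemma N_neg {v : K → ℝ} (hv : IsNAVal v) {N : X → ℝ} (hN : IsNANorm v N) (x : X) :
    N (-x) = N x := by
  rw [← neg_one_smul K x, hN.2.2.1, v_neg hv, v_one hv, one_mul]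

lemma N_add_of_lt {v : K → ℝ} (hv : IsNAVal v) {N : X → ℝ} (hN : IsNANorm v N) (x y : X)
    (h : N y < N x) : N (x + y) = N x := by
  apply le_antisymm
  · exact (hN.2.2.2 x y).trans (max_le le_rfl h.le)
  · have h1 := hN.2.2.2 (x + y) (-y)
    rw [add_neg_cancel_right, N_neg hv hN] at h1
    rcases le_max_iff.1 h1 with h2 | h2
    · exact h2
    · exact absurd h (not_lt.2 h2)

lemma bdd [FiniteDimensional K X] {v : K → ℝ} (hv : IsNAVal v) (hcomplete : IsCompleteVF v)
    (hnt : ∃ c : K, c ≠ 0 ∧ v c ≠ 1)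
    {N : X → ℝ} (hN : IsNANorm v N) (T : X →ₗ[K] X) : ∃ C > 0, ∀ p, N (T p) ≤ C * N p := by
  letI := nf v hv hnt
  haveI : CompleteSpace K := by
    apply Metric.complete_of_cauchySeq_tendsto
    intro u hu
    rw [Metric.cauchySeq_iff] at hu
    obtain ⟨l, hl⟩ := hcomplete u (fun δ hδ => by
      obtain ⟨M, hM⟩ := hu δ hδ
      exact ⟨M, fun p q hp hq => hM p hp q hq⟩)
    refine ⟨l, ?_⟩
    rw [Metric.tendsto_atTop]
    intro ε hε
    exact hl ε hε
  letI : NormedAddCommGroup X :=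
    { ‹AddCommGroup X› with
      norm := N
      dist := fun x y => N (x - y)
      dist_self := fun x => by simp [N_zero hN]
      dist_comm := fun x y => by rw [← N_neg hv hN, neg_sub]
      dist_triangle := fun x y z => by
        have h := hN.2.2.2 (x - y) (y - z)
        rw [sub_add_sub_cancel] at h
        exact h.trans (max_le_add_of_nonneg (hN.1 _) (hN.1 _))
      eq_of_dist_eq_zero := fun {x y} h => sub_eq_zero.1 ((hN.2.1 _).1 h)
      dist_eq := fun x y => by
        change N (x - y) = N (-x + y)
        rw [← N_neg hv hN, neg_sub, neg_add_eq_sub] }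
  letI : NormedSpace K X := { ‹Module K X› with norm_smul_le := fun a b => (hN.2.2.1 a b).le }
  let T' : X →L[K] X := LinearMap.toContinuousLinearMap T
  refine ⟨‖T'‖ + 1, by positivity, fun p => ?_⟩
  have h := T'.le_opNorm p
  have h2 : N (T p) ≤ ‖T'‖ * N p := h
  have h3 := hN.1 p
  linarith

lemma quad {v : K → ℝ} (hv : IsNAVal v) {N : X → ℝ} (hN : IsNANorm v N) (s : K) (hs : v s < 1)
    (a b : X) (C M : ℝ) (hC : N a ≤ C) (hM : N b ≤ M) :
    N (s • (s • a + b)) ≤ v s * (C + M) := by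
  rw [hN.2.2.1]
  apply mul_le_mul_of_nonneg_left _ (hv.1 s)
  refine (hN.2.2.2 _ _).trans ?_
  rw [hN.2.2.1]
  have h1 := hN.1 a
  have h2 := hN.1 b
  have h3 := hv.1 s
  apply max_le <;> nlinarith

lemma affine_small [FiniteDimensional K X] {v : K → ℝ} (hv : IsNAVal v)
    (hcomplete : IsCompleteVF v) (hnt : ∃ c : K, c ≠ 0 ∧ v c ≠ 1)
    {N : X → ℝ} (hN : IsNANorm v N) (T₁ T₂ : X →ₗ[K] X) (τ₁ τ₂ x₀ : X) (r : ℝ) (hr : 0 < r) :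
    ∃ δ > 0, ∀ s, v s < δ → ∀ f : Equiv.Perm X,
      (∀ p, f p = p + s • (s • (T₂ (p - x₀) + τ₂) + (T₁ (p - x₀) + τ₁))) →
      (f : X → X) ∈ AffineIsometries K N ∧ N (f x₀ - x₀) < r := by
  obtain ⟨C₁, h1, hC₁⟩ := bdd hv hcomplete hnt hN T₁
  obtain ⟨C₂, h2, hC₂⟩ := bdd hv hcomplete hnt hN T₂
  have hn1 := hN.1 τ₁
  have hn2 := hN.1 τ₂
  refine ⟨min 1 (min (1 / (C₂ + C₁)) (r / (N τ₂ + N τ₁ + 1))), by positivity, ?_⟩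
  intro s hs f hf
  rw [lt_min_iff, lt_min_iff, lt_div_iff₀ (by positivity), lt_div_iff₀ (by positivity)] at hs
  obtain ⟨hs1, hs2, hs3⟩ := hs
  have hs0 := hv.1 s
  refine ⟨⟨⟨LinearMap.id + s • (s • T₂ + T₁),
    s • (s • (τ₂ - T₂ x₀) + (τ₁ - T₁ x₀)), fun x => ?_⟩, f.surjective, fun x y => ?_⟩, ?_⟩
  · rw [hf]
    simp only [map_sub, LinearMap.add_apply, LinearMap.smul_apply, LinearMap.id_apply]
    module
  · have e : f x - f y = (x - y) + s • (s • T₂ (x - y) + T₁ (x - y)) := by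
      rw [hf, hf]
      simp only [map_sub]
      module
    rw [e]
    by_cases hxy : x - y = 0
    · simp [hxy]
    · have hpos : 0 < N (x - y) := lt_of_le_of_ne (hN.1 _) (fun h => hxy ((hN.2.1 _).1 h.symm))
      apply N_add_of_lt hv hN
      have := quad hv hN s hs1 _ _ _ _ (hC₂ (x - y)) (hC₁ (x - y))
      refine this.trans_lt ?_
      nlinarith
  · have e : f x₀ - x₀ = s • (s • τ₂ + τ₁) := by
      rw [hf]
      simp
    rw [e]
    have := quad hv hN s hs1 τ₂ τ₁ _ _ le_rfl le_rfl
    refine this.trans_lt ?_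
    nlinarith

/-- lifting a permutation of the plane -/
def liftP (π : X →ₗ[K] K × K) (ι : K × K →ₗ[K] X) (h : ∀ q, π (ι q) = q) (x₀ : X)
    (g : Equiv.Perm (K × K)) : Equiv.Perm X where
  toFun p := p + ι (g (π (p - x₀)) - π (p - x₀))
  invFun p := p + ι (g.symm (π (p - x₀)) - π (p - x₀))
  left_inv p := by
    have e : π (p + ι (g (π (p - x₀)) - π (p - x₀)) - x₀) = g (π (p - x₀)) := by
      rw [add_sub_right_comm, map_add, h]; abel
    simp only [e, Equiv.symm_apply_apply]
    rw [add_assoc, ← map_add]; simp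
  right_inv p := by
    have e : π (p + ι (g.symm (π (p - x₀)) - π (p - x₀)) - x₀) = g.symm (π (p - x₀)) := by
      rw [add_sub_right_comm, map_add, h]; abel
    simp only [e, Equiv.apply_symm_apply]
    rw [add_assoc, ← map_add]; simp

lemma pi_liftP (π : X →ₗ[K] K × K) (ι : K × K →ₗ[K] X) (h : ∀ q, π (ι q) = q) (x₀ : X)
    (g : Equiv.Perm (K × K)) (p : X) : π (liftP π ι h x₀ g p - x₀) = g (π (p - x₀)) := by
  change π (p + ι (g (π (p - x₀)) - π (p - x₀)) - x₀) = g (π (p - x₀))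
  rw [add_sub_right_comm, map_add, h]; abel

lemma equivar (π : X →ₗ[K] K × K) (ι : K × K →ₗ[K] X) (h : ∀ q, π (ι q) = q) (x₀ : X)
    (g : Bool → Equiv.Perm (K × K)) (w : FreeGroup Bool) : ∀ p : X,
    π (FreeGroup.lift (fun i => liftP π ι h x₀ (g i)) w p - x₀) =
      FreeGroup.lift g w (π (p - x₀)) := by
  induction w using FreeGroup.induction_on with
  | C1 => intro p; simp
  | of i => intro p; simpa using pi_liftP π ι h x₀ (g i) p
  | inv_of i _ =>
    intro p
    rw [map_inv, map_inv, FreeGroup.lift_apply_of, FreeGroup.lift_apply_of, eq_comm,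
      Equiv.Perm.inv_eq_iff_eq, ← pi_liftP π ι h x₀ (g i)]
    simp
  | mul u w hu hw =>
    intro p
    rw [map_mul, map_mul, Equiv.Perm.mul_apply, Equiv.Perm.mul_apply, hu, hw]

lemma gen_form (c k : K) (hk : k * (1 - c) = 1) (i : Bool) :
    ∃ (M₁ M₂ : K × K →ₗ[K] K × K) (t₁ t₂ : K × K), ∀ s P,
      gen s c k hk 1 i P = P + s • (s • (M₂ P + t₂) + (M₁ P + t₁)) := by
  let x : K × K →ₗ[K] K := LinearMap.fst K K K
  let y : K × K →ₗ[K] K := LinearMap.snd K K K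
  cases i with
  | true =>
    refine ⟨y.prod x, x.prod 0, 0, 0, fun s P => ?_⟩
    ext <;> simp [gen, genA, x, y] <;> ring
  | false =>
    refine ⟨((x + c • y) - k • ((x + c • y) - (x + y))).prod (k • ((x + c • y) - (x + y))),
      ((x + y) - k • (x + y)).prod (k • (x + y)),
      (- c ^ 2 - k * (- c ^ 2 + 1), k * (- c ^ 2 + 1)), (-1 + k, -k), fun s P => ?_⟩
    ext <;> simp [gen, genB, x, y] <;> ring

lemma plane [FiniteDimensional K X] (hdim : 2 ≤ Module.finrank K X) :
    ∃ (π : X →ₗ[K] K × K) (ι : K × K →ₗ[K] X), ∀ q, π (ι q) = q := by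
  have h : ((2 : ℕ) : Cardinal) ≤ Module.rank K X := by
    rw [← Module.finrank_eq_rank]; exact_mod_cast hdim
  obtain ⟨f, hf⟩ := Module.le_rank_iff_exists_linearMap.1 h
  let ι : K × K →ₗ[K] X := f ∘ₗ (LinearEquiv.finTwoArrow K K).symm.toLinearMap
  have hι : LinearMap.ker ι = ⊥ := by
    rw [LinearMap.ker_eq_bot]
    exact hf.comp (LinearEquiv.finTwoArrow K K).symm.injective
  obtain ⟨π, hπ⟩ := ι.exists_leftInverse_of_injective hι
  exact ⟨π, ι, fun q => LinearMap.congr_fun hπ q⟩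

lemma master [FiniteDimensional K X] {v : K → ℝ} (hv : IsNAVal v)
    (hcomplete : IsCompleteVF v) (hnt : ∃ c : K, c ≠ 0 ∧ v c ≠ 1)
    (hdim : 2 ≤ Module.finrank K X)
    {N : X → ℝ} (hN : IsNANorm v N) (x₀ : X) (r : ℝ) (hr : 0 < r) (E : Set X)
    (hE : ∀ f : X → X, f ∈ AffineIsometries K N → N (f x₀ - x₀) < r → ∀ x, f x ∈ E ↔ x ∈ E) :
    ParadoxicalUsing (AffineIsometries K N) E 4 := by
  obtain ⟨c, h0, hc1⟩ := id hnt
  have h1 : c ≠ 1 := by rintro rfl; exact hc1 (v_one hv)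
  have h2 : c ^ 2 ≠ 1 := by
    intro h
    have e : v c * v c = 1 := by rw [← hv.2.2.1, ← pow_two, h, v_one hv]
    apply hc1
    have := hv.1 c
    nlinarith
  obtain ⟨k, hk⟩ : ∃ k : K, k * (1 - c) = 1 :=
    ⟨(1 - c)⁻¹, inv_mul_cancel₀ (sub_ne_zero.2 h1.symm)⟩
  obtain ⟨B, hB, hBc⟩ := bad_countable c k hk h0 h1 h2
  obtain ⟨π, ι, h⟩ := plane (K := K) (X := X) hdim
  have key : ∀ i, ∃ δ > 0, ∀ s, v s < δ →
      (liftP π ι h x₀ (gen s c k hk 1 i) : X → X) ∈ AffineIsometries K N ∧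
      N (liftP π ι h x₀ (gen s c k hk 1 i) x₀ - x₀) < r := by
    intro i
    obtain ⟨M₁, M₂, t₁, t₂, hg⟩ := gen_form c k hk i
    obtain ⟨δ, hδ, hh⟩ := affine_small hv hcomplete hnt hN (ι ∘ₗ M₁ ∘ₗ π) (ι ∘ₗ M₂ ∘ₗ π)
      (ι t₁) (ι t₂) x₀ r hr
    refine ⟨δ, hδ, fun s hs => hh s hs _ fun p => ?_⟩
    change p + ι (gen s c k hk 1 i (π (p - x₀)) - π (p - x₀)) = _
    rw [hg, add_sub_cancel_left]
    simp only [map_add, map_smul, LinearMap.comp_apply]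
  choose δ hδ hkey using key
  obtain ⟨s, hsB, hs⟩ := exists_small v hv hcomplete hnt B hB (min (δ true) (δ false))
    (lt_min (hδ _) (hδ _))
  rw [lt_min_iff] at hs
  have hs' : ∀ i, v s < δ i := by
    intro i; cases i
    · exact hs.2
    · exact hs.1
  refine paradox _ (FreeGroup.lift (fun i => liftP π ι h x₀ (gen s c k hk 1 i))) ?_ ?_ ?_ E ?_
  · intro p u w hu hw
    apply hBc s hsB (π (p - x₀)) u w
    · rw [rho, ← equivar π ι h x₀, hu]
    · rw [rho, ← equivar π ι h x₀, hw]
  · intro i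
    rw [FreeGroup.lift_apply_of]
    exact (hkey i s (hs' i)).1
  · exact ⟨⟨LinearMap.id, 0, fun x => by simp⟩, Function.surjective_id, fun _ _ => rfl⟩
  · intro i x
    rw [FreeGroup.lift_apply_of]
    exact hE _ (hkey i s (hs' i)).1 (hkey i s (hs' i)).2 x

lemma N_cmp {v : K → ℝ} (hv : IsNAVal v) {N : X → ℝ} (hN : IsNANorm v N) (x₀ : X) (r : ℝ)
    (f : X → X) (hf : f ∈ AffineIsometries K N) (hr : N (f x₀ - x₀) < r) (x : X) :
    (N (f x - x₀) < r ∧ N (x - x₀) < r) ∨ N (f x - x₀) = N (x - x₀) := by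
  have h1 := hf.2.2 x x₀
  have e : f x - x₀ = (f x - f x₀) + (f x₀ - x₀) := by abel
  rcases lt_or_ge (N (f x₀ - x₀)) (N (x - x₀)) with h | h
  · right
    rw [e, N_add_of_lt hv hN _ _ (by rw [h1]; exact h), h1]
  · left
    refine ⟨?_, h.trans_lt hr⟩
    rw [e]
    refine (hN.2.2.2 _ _).trans_lt (max_lt ?_ hr)
    rw [h1]; exact h.trans_lt hr

end Field
end S13

theorem statement13 {K : Type*} [Field K] (v : K → ℝ) (hv : IsNAVal v)
    (hcomplete : IsCompleteVF v) (hnt : ∃ c : K, c ≠ 0 ∧ v c ≠ 1)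
    {X : Type*} [AddCommGroup X] [Module K X] [FiniteDimensional K X]
    (hdim : 2 ≤ Module.finrank K X)
    (N : X → ℝ) (hN : IsNANorm v N) :
    -- the whole space is paradoxical using four pieces …
    ParadoxicalUsing (AffineIsometries K N) (Set.univ : Set X) 4 ∧
    -- … and so are all balls and all nonempty spheres
    ∀ (x₀ : X) (r : ℝ), 0 < r →
      ParadoxicalUsing (AffineIsometries K N) {x : X | N (x - x₀) ≤ r} 4 ∧
      ParadoxicalUsing (AffineIsometries K N) {x : X | N (x - x₀) < r} 4 ∧
      ({x : X | N (x - x₀) = r}.Nonempty →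
        ParadoxicalUsing (AffineIsometries K N) {x : X | N (x - x₀) = r} 4) := by
  refine ⟨S13.master hv hcomplete hnt hdim hN 0 1 one_pos _ (fun f _ _ x => by simp), ?_⟩
  intro x₀ r hr
  refine ⟨S13.master hv hcomplete hnt hdim hN x₀ r hr _ fun f hf hfr x => ?_,
    S13.master hv hcomplete hnt hdim hN x₀ r hr _ fun f hf hfr x => ?_,
    fun _ => S13.master hv hcomplete hnt hdim hN x₀ r hr _ fun f hf hfr x => ?_⟩
  · rcases S13.N_cmp hv hN x₀ r f hf hfr x with ⟨a, b⟩ | a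
    · exact ⟨fun _ => b.le, fun _ => a.le⟩
    · simp only [Set.mem_setOf_eq, a]
  · rcases S13.N_cmp hv hN x₀ r f hf hfr x with ⟨a, b⟩ | a
    · exact ⟨fun _ => b, fun _ => a⟩
    · simp only [Set.mem_setOf_eq, a]
  · rcases S13.N_cmp hv hN x₀ r f hf hfr x with ⟨a, b⟩ | a
    · exact ⟨fun h => absurd h a.ne, fun h => absurd h b.ne⟩
    · simp only [Set.mem_setOf_eq, a]
end

section
/- Let K be a field equipped with the trivial valuation (|0| = 0 and |x| = 1 for all x ≠ 0), and assume K is not locally finite (i.e., some finitely generated subfield of K is infinite). Let n ≥ 2 and let ‖·‖ be a non-Archimedean norm on K^n. If the norm ‖·‖ takes fewer than n nonzero values, then K^n is paradoxical using four pieces with respect to the group IA(K^n,‖·‖) of affine isometries of (K^n,‖·‖). -/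
open Finset in
theorem hall_aux {X Γ : Type*} [LinearOrder Γ] (c : Bool → Equiv.Perm X) (s : X → Γ) (r : Γ)
    (d : Bool × Bool → X → X)
    (hd0 : ∀ i x, d (i, false) x = c i x) (hd1 : ∀ i x, d (i, true) x = (c i).symm x)
    (hin : ∀ x, s x ≤ r → ∀ i j k, i ≠ j → i ≠ k → j ≠ k →
      s (d i x) ≤ r → s (d j x) ≤ r → s (d k x) ≤ r → False)
    (hout : ∀ x, r < s x → ∀ i j, i ≠ j → s (d i x) ≤ s x → s (d j x) ≤ s x → False) :
    ∃ m : X × Bool → X, Function.Bijective m ∧ ∀ e, m e = e.1 ∨ m e = c e.2 e.1 := by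
  classical
  -- inner edges
  let ED := {e : X × Bool // s e.1 ≤ r ∧ s (c e.2 e.1) ≤ r}
  let t : ED → Finset X := fun e => {e.1.1, c e.1.2 e.1.1}
  have hall : ∀ S : Finset ED, #S ≤ #(S.biUnion t) := by
    intro S
    let F : ED × Bool → X := fun p => if p.2 then c p.1.1.2 p.1.1.1 else p.1.1.1
    have h1 : #(S ×ˢ (univ : Finset Bool)) ≤ 2 * #(S.biUnion t) := by
      apply card_le_mul_card_image_of_maps_to (f := F)
      · rintro ⟨e, ε⟩ he
        simp only [mem_product] at he
        refine mem_biUnion.2 ⟨e, he.1, ?_⟩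
        cases ε <;> simp [F, t]
      · intro w hw
        by_contra hcon
        push Not at hcon
        obtain ⟨⟨e1, i1⟩, h1, ⟨e2, i2⟩, h2, ⟨e3, i3⟩, h3, h12, h13, h23⟩ := two_lt_card.1 hcon
        have key : ∀ (e : ED) (i : Bool), F (e, i) = w → s w ≤ r ∧ s (d (e.1.2, i) w) ≤ r := by
          rintro ⟨⟨x, j⟩, hx⟩ i rfl
          cases i
          · simpa [F, hd0] using hx
          · simpa [F, hd1, and_comm] using hx
        have inj : ∀ (e e' : ED) (i i' : Bool), F (e, i) = w → F (e', i') = w → (e, i) ≠ (e', i') →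
            (e.1.2, i) ≠ (e'.1.2, i') := by
          rintro ⟨⟨x, j⟩, hx⟩ ⟨⟨x', j'⟩, hx'⟩ i i' h h' hne heq
          apply hne
          simp only [Prod.mk.injEq] at heq
          obtain ⟨rfl, rfl⟩ := heq
          have : x = x' := by
            cases i
            · simp [F] at h h'; rw [h, h']
            · simp [F] at h h'; exact (c j).injective (h.trans h'.symm)
          subst this
          rfl
        have h1 := (mem_filter.1 h1).2
        have h2 := (mem_filter.1 h2).2
        have h3 := (mem_filter.1 h3).2
        exact hin w (key _ _ h1).1 _ _ _ (inj _ _ _ _ h1 h2 h12) (inj _ _ _ _ h1 h3 h13)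
          (inj _ _ _ _ h2 h3 h23) (key _ _ h1).2 (key _ _ h2).2 (key _ _ h3).2
    rw [card_product] at h1
    simp at h1
    omega
  obtain ⟨f, hf, hft⟩ := (Finset.all_card_le_biUnion_card_iff_exists_injective t).1 hall
  let G : X × Bool → X := fun e => if s e.1 ≤ s (c e.2 e.1) then c e.2 e.1 else e.1
  have hG : ∀ e : X × Bool, ¬ (s e.1 ≤ r ∧ s (c e.2 e.1) ≤ r) → r < s (G e) ∧
      ∃ i, s (d (e.2, i) (G e)) ≤ s (G e) ∧ e.1 = (if i then (c e.2).symm (G e) else G e) := by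
    rintro ⟨x, j⟩ he
    simp only [not_and_or, not_le] at he
    by_cases h : s x ≤ s (c j x)
    · have hGe : G (x, j) = c j x := by simp [G, h]
      rw [hGe]
      refine ⟨?_, true, ?_, ?_⟩
      · rcases he with he | he
        · exact he.trans_le h
        · exact he
      · simpa [hd1] using h
      · simp
    · have hGe : G (x, j) = x := by simp [G, h]
      rw [hGe]
      refine ⟨?_, false, ?_, ?_⟩
      · rcases he with he | he
        · exact he
        · exact he.trans (not_le.1 h)
      · simpa [hd0] using (not_le.1 h).le
      · simp
  let M : X × Bool → X := fun e => if h : s e.1 ≤ r ∧ s (c e.2 e.1) ≤ r then f ⟨e, h⟩ else G e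
  have hfr : ∀ e : ED, s (f e) ≤ r := by
    intro e
    have := hft e
    simp only [t, Finset.mem_insert, Finset.mem_singleton] at this
    rcases this with h | h <;> rw [h]
    · exact e.2.1
    · exact e.2.2
  have hM : Function.Injective M := by
    intro e e' hee
    by_cases h : s e.1 ≤ r ∧ s (c e.2 e.1) ≤ r <;>
    by_cases h' : s e'.1 ≤ r ∧ s (c e'.2 e'.1) ≤ r
    · simp only [M, dif_pos h, dif_pos h'] at hee
      exact congrArg Subtype.val (hf hee)
    · simp only [M, dif_pos h, dif_neg h'] at hee
      have h1 := hfr ⟨e, h⟩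
      rw [hee] at h1
      exact absurd h1 (not_le.2 (hG e' h').1)
    · simp only [M, dif_neg h, dif_pos h'] at hee
      have h1 := hfr ⟨e', h'⟩
      rw [← hee] at h1
      exact absurd h1 (not_le.2 (hG e h).1)
    · simp only [M, dif_neg h, dif_neg h'] at hee
      obtain ⟨hr, i, hi, hx⟩ := hG e h
      obtain ⟨hr', i', hi', hx'⟩ := hG e' h'
      rw [← hee] at hr' hi' hx'
      by_cases hd : (e.2, i) = (e'.2, i')
      · simp only [Prod.mk.injEq] at hd
        obtain ⟨h1, rfl⟩ := hd
        rw [← h1] at hx'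
        exact Prod.ext (hx.trans hx'.symm) h1
      · exact (hout _ hr _ _ hd hi hi').elim
  obtain ⟨m, hm, hR⟩ := Function.Embedding.schroeder_bernstein_of_rel (f := M)
    (g := fun x => (x, false)) hM (fun x y h => congrArg Prod.fst h)
    (fun e x => x = e.1 ∨ x = c e.2 e.1) (by
      intro e
      by_cases h : s e.1 ≤ r ∧ s (c e.2 e.1) ≤ r
      · simp only [M, dif_pos h]
        simpa [t] using hft ⟨e, h⟩
      · simp only [M, dif_neg h, G]
        split_ifs <;> simp) (by intro b; simp)
  exact ⟨m, hm, hR⟩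

theorem exists_val {K : Type*} [Field K] 
    (hnlf : ∃ s : Finset K, ¬ (Subfield.closure (s : Set K) : Set K).Finite) :
    ∃ (A : ValuationSubring K) (t : K), t ≠ 0 ∧ A.valuation t < 1 := by
  by_contra hcon
  push Not at hcon
  have hall : ∀ (A : ValuationSubring K) (x : K), x ∈ A := by
    intro A x
    by_cases hx : x = 0
    · rw [hx]; exact A.zero_mem
    rw [← A.valuation_le_one_iff]
    have := hcon A x⁻¹ (inv_ne_zero hx)
    rw [map_inv₀] at this
    exact (one_le_inv₀ (by simpa [zero_lt_iff] using hx)).1 this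
  have hint : ∀ x : K, IsIntegral ℤ x := by
    intro x
    have h := iInf_valuationSubring_superset (K := K) (s := ∅)
    have hx : x ∈ (⨅ V : {V : ValuationSubring K // (∅ : Set K) ⊆ V.toSubring}, V.1.toSubring) := by
      rw [Subring.mem_iInf]
      intro V
      exact hall V.1 x
    rw [h] at hx
    have hx : IsIntegral (Subring.closure (∅ : Set K)) x := hx
    have : Algebra.IsIntegral ℤ (Subring.closure (∅ : Set K)) := by
      constructor
      rintro ⟨y, hy⟩
      rw [Subring.closure_empty, Subring.mem_bot] at hy
      obtain ⟨n, rfl⟩ := hy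
      have : (⟨(n : K), by simp⟩ : Subring.closure (∅ : Set K)) = algebraMap ℤ _ n := by
        ext; simp
      rw [this]
      exact isIntegral_algebraMap
    exact isIntegral_trans _ hx
  obtain ⟨p, hp⟩ := CharP.exists K
  rcases CharP.char_is_prime_or_zero K p with hpp | rfl
  · haveI : Fact p.Prime := ⟨hpp⟩
    letI := ZMod.algebra K p
    obtain ⟨s, hs⟩ := hnlf
    apply hs
    have hfd : FiniteDimensional (ZMod p) (IntermediateField.adjoin (ZMod p) (s : Set K)) :=
      IntermediateField.finiteDimensional_adjoin (fun x _ => (hint x).tower_top)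
    have hfin : Finite (IntermediateField.adjoin (ZMod p) (s : Set K)) :=
      Module.finite_of_finite (ZMod p)
    have hle : Subfield.closure (s : Set K) ≤ (IntermediateField.adjoin (ZMod p) (s : Set K)).toSubfield :=
      Subfield.closure_le.2 (IntermediateField.subset_adjoin _ _)
    exact Set.Finite.subset (Set.toFinite (IntermediateField.adjoin (ZMod p) (s : Set K) : Set K)) hle
  · haveI := CharP.charP_to_charZero K
    have h := hint (algebraMap ℚ K (1/2))
    rw [isIntegral_algebraMap_iff (algebraMap ℚ K).injective] at h
    obtain ⟨n, hn⟩ := IsIntegrallyClosed.isIntegral_iff.1 h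
    have h2 : (2 * n : ℚ) = 1 := by
      simp at hn; rw [hn]; norm_num
    have h3 : 2 * n = 1 := by exact_mod_cast h2
    omega

def FaL {K : Type*} [Field K] (u : K) : (K × K) ≃ₗ[K] (K × K) where
  toFun z := (u * z.1 - z.2, z.1)
  invFun z := (z.2, u * z.2 - z.1)
  map_add' z w := by ext <;> simp; ring
  map_smul' a z := by ext <;> simp; ring
  left_inv z := by ext <;> simp
  right_inv z := by ext <;> simp

def chgL {K : Type*} [Field K] (t : K) (ht : 1 - t ^ 2 ≠ 0) : (K × K) ≃ₗ[K] (K × K) where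
  toFun z := (z.1 + t * z.2, t * z.1 + z.2)
  invFun z := ((z.1 - t * z.2) / (1 - t ^ 2), (z.2 - t * z.1) / (1 - t ^ 2))
  map_add' z w := by ext <;> simp <;> ring
  map_smul' a z := by ext <;> simp <;> ring
  left_inv z := by ext <;> simp <;> field_simp <;> ring
  right_inv z := by ext <;> simp <;> field_simp <;> ring

noncomputable def chgA {K : Type*} [Field K] (t : K) (ht : 1 - t ^ 2 ≠ 0) :
    (K × K) ≃ᵃ[K] (K × K) :=
  (chgL t ht).toAffineEquiv.trans (AffineEquiv.constVAdd K (K × K) (t, t))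

theorem chgA_apply {K : Type*} [Field K] (t : K) (ht : 1 - t ^ 2 ≠ 0) (z : K × K) :
    chgA t ht z = (t + (z.1 + t * z.2), t + (t * z.1 + z.2)) := rfl

theorem lemA {K Γ : Type*} [Field K] [LinearOrderedCommGroupWithZero Γ] (v : Valuation K Γ)
    (t : K) (ht0 : t ≠ 0) (x y : K) (R : Γ) (h1 : v y ≤ R)
    (h2 : v ((t ^ 2)⁻¹ * x - y) ≤ R) : v x ≤ v t ^ 2 * R := by
  have h3 : v ((t ^ 2)⁻¹ * x) ≤ R := by
    have := v.map_add_le h2 h1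
    simpa using this
  have h4 : x = t ^ 2 * ((t ^ 2)⁻¹ * x) := by field_simp
  rw [h4, map_mul, map_pow]
  gcongr

section
variable {K Γ : Type*} [Field K] [LinearOrderedCommGroupWithZero Γ] (v : Valuation K Γ)
    (t : K) (ht0 : t ≠ 0) (ht1 : v t < 1) (x y p q : K) (R : Γ)
    (hx : x = t + (p + t * q)) (hy : y = t + (t * p + q)) 

include ht0 ht1 hx hy in
theorem in_xyp (h1 : v x ≤ v t ^ 2) (h2 : v y ≤ v t ^ 2) (h3 : v p ≤ v t ^ 2) : False := by
  have ht : t = x - p - t * y + t ^ 2 + t ^ 2 * p := by rw [hx, hy]; ring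
  have h0 : 0 < v t := by simpa [zero_lt_iff] using ht0
  have hp1 : v t ^ 2 ≤ 1 := pow_le_one₀ h0.le ht1.le
  have key : v t ≤ v t ^ 2 := by
    conv_lhs => rw [ht]
    refine v.map_add_le (v.map_add_le (v.map_sub_le (v.map_sub_le h1 h3) ?_) ?_) ?_
    · rw [map_mul]; exact (mul_le_of_le_one_left zero_le ht1.le).trans h2
    · rw [map_pow]
    · rw [map_mul, map_pow]; exact (mul_le_of_le_one_left zero_le hp1).trans h3
  have : v t ^ 2 < v t := by
    rw [pow_two]; exact mul_lt_of_lt_one_left h0 ht1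
  exact absurd key (not_le.2 this)

include ht0 ht1 hx in
theorem in_xpq (h1 : v x ≤ v t ^ 2) (h2 : v p ≤ v t ^ 2) (h3 : v q ≤ v t ^ 2) : False := by
  have ht : t = x - p - t * q := by rw [hx]; ring
  have h0 : 0 < v t := by simpa [zero_lt_iff] using ht0
  have key : v t ≤ v t ^ 2 := by
    conv_lhs => rw [ht]
    refine v.map_sub_le (v.map_sub_le h1 h2) ?_
    rw [map_mul]; exact (mul_le_of_le_one_left zero_le ht1.le).trans h3
  have : v t ^ 2 < v t := by
    rw [pow_two]; exact mul_lt_of_lt_one_left h0 ht1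
  exact absurd key (not_le.2 this)

include ht0 ht1 in
theorem sq_lt (hR : 1 < R) : v t ^ 2 * R < v t * R ∧ v t * R < R ∧ v t < v t * R := by
  have h0 : 0 < v t := by simpa [zero_lt_iff] using ht0
  have hR0 : 0 < R := zero_lt_one.trans hR
  refine ⟨?_, ?_, ?_⟩
  · rw [pow_two, mul_assoc]
    exact mul_lt_of_lt_one_left (mul_pos h0 hR0) ht1
  · exact mul_lt_of_lt_one_left hR0 ht1
  · exact lt_mul_of_one_lt_right h0 hR

include ht0 ht1 hx hy in
theorem out_pq (hR : 1 < R) (hmax : max (v x) (v y) = R)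
    (h1 : v p ≤ v t ^ 2 * R) (h2 : v q ≤ v t ^ 2 * R) : False := by
  obtain ⟨e1, e2, e3⟩ := sq_lt v t ht0 ht1 R hR
  have hp : v p < R := h1.trans_lt (e1.trans e2)
  have hq : v q < R := h2.trans_lt (e1.trans e2)
  have ht : v t < R := e3.trans e2
  have htp : v (t * p) < R := by
    rw [map_mul]; exact (mul_le_of_le_one_left zero_le ht1.le).trans_lt hp
  have htq : v (t * q) < R := by
    rw [map_mul]; exact (mul_le_of_le_one_left zero_le ht1.le).trans_lt hq
  have hx' : v x < R := by rw [hx]; exact v.map_add_lt ht (v.map_add_lt hp htq)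
  have hy' : v y < R := by rw [hy]; exact v.map_add_lt ht (v.map_add_lt htp hq)
  exact absurd hmax (max_lt hx' hy').ne

include ht0 ht1 hx hy in
theorem out_xq (hR : 1 < R) (hmax : max (v x) (v y) = R)
    (h1 : v x ≤ v t ^ 2 * R) (h2 : v q ≤ v t ^ 2 * R) : False := by
  obtain ⟨e1, e2, e3⟩ := sq_lt v t ht0 ht1 R hR
  have hx' : v x < R := h1.trans_lt (e1.trans e2)
  have hq : v q < R := h2.trans_lt (e1.trans e2)
  have ht : v t < R := e3.trans e2
  have htq : v (t * q) < R := by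
    rw [map_mul]; exact (mul_le_of_le_one_left zero_le ht1.le).trans_lt hq
  have hp : v p < R := by
    have : p = x - t - t * q := by rw [hx]; ring
    rw [this]
    exact v.map_sub_lt (v.map_sub_lt hx' ht) htq
  have htp : v (t * p) < R := by
    rw [map_mul]; exact (mul_le_of_le_one_left zero_le ht1.le).trans_lt hp
  have hy' : v y < R := by rw [hy]; exact v.map_add_lt ht (v.map_add_lt htp hq)
  exact absurd hmax (max_lt hx' hy').ne

include ht0 ht1 hx hy in
theorem out_xp (hR : 1 < R) (hmax : max (v x) (v y) = R)
    (h1 : v x ≤ v t ^ 2 * R) (h2 : v p ≤ v t ^ 2 * R) : False := by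
  obtain ⟨e1, e2, e3⟩ := sq_lt v t ht0 ht1 R hR
  have h0 : 0 < v t := by simpa [zero_lt_iff] using ht0
  have hx' : v x < R := h1.trans_lt (e1.trans e2)
  have hp : v p < R := h2.trans_lt (e1.trans e2)
  have ht : v t < R := e3.trans e2
  have htq : v (t * q) < v t * R := by
    have : t * q = x - p - t := by rw [hx]; ring
    rw [this]
    exact v.map_sub_lt (v.map_sub_lt (h1.trans_lt e1) (h2.trans_lt e1)) e3
  have hq : v q < R := by
    rw [map_mul] at htq
    exact lt_of_mul_lt_mul_left htq zero_le
  have htp : v (t * p) < R := by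
    rw [map_mul]; exact (mul_le_of_le_one_left zero_le ht1.le).trans_lt hp
  have hy' : v y < R := by rw [hy]; exact v.map_add_lt ht (v.map_add_lt htp hq)
  exact absurd hmax (max_lt hx' hy').ne

include ht0 ht1 in
theorem out_xy (hR : 1 < R) (hmax : max (v x) (v y) = R)
    (h1 : v x ≤ v t ^ 2 * R) (h2 : v y ≤ v t ^ 2 * R) : False := by
  obtain ⟨e1, e2, e3⟩ := sq_lt v t ht0 ht1 R hR
  exact absurd hmax (max_lt (h1.trans_lt (e1.trans e2)) (h2.trans_lt (e1.trans e2))).ne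
end

theorem three_of (P : Bool × Bool → Prop)
    (h1 : P (false, false) → P (false, true) → P (true, false) → False)
    (h2 : P (false, false) → P (false, true) → P (true, true) → False)
    (h3 : P (false, false) → P (true, false) → P (true, true) → False)
    (h4 : P (false, true) → P (true, false) → P (true, true) → False)
    (i j k : Bool × Bool) (hij : i ≠ j) (hik : i ≠ k) (hjk : j ≠ k)
    (hi : P i) (hj : P j) (hk : P k) : False := by
  obtain ⟨i1, i2⟩ := i
  obtain ⟨j1, j2⟩ := j
  obtain ⟨l1, l2⟩ := k
  cases i1 <;> cases i2 <;> cases j1 <;> cases j2 <;> cases l1 <;> cases l2 <;> simp_all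

theorem two_of (P : Bool × Bool → Prop)
    (h1 : P (false, false) → P (false, true) → False)
    (h2 : P (false, false) → P (true, false) → False)
    (h3 : P (false, false) → P (true, true) → False)
    (h4 : P (false, true) → P (true, false) → False)
    (h5 : P (false, true) → P (true, true) → False)
    (h6 : P (true, false) → P (true, true) → False)
    (i j : Bool × Bool) (hij : i ≠ j)
    (hi : P i) (hj : P j) : False := by
  obtain ⟨i1, i2⟩ := i
  obtain ⟨j1, j2⟩ := j
  cases i1 <;> cases i2 <;> cases j1 <;> cases j2 <;> simp_all

theorem plane {K Γ : Type*} [Field K] [LinearOrderedCommGroupWithZero Γ] (v : Valuation K Γ)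
    (t : K) (ht0 : t ≠ 0) (ht1 : v t < 1) :
    ∃ (c : Bool → (K × K) ≃ᵃ[K] (K × K)) (s : K × K → Γ) (d : Bool × Bool → K × K → K × K),
      (∀ i z, d (i, false) z = c i z) ∧ (∀ i z, d (i, true) z = (c i).symm z) ∧
      (∀ x, s x ≤ 1 → ∀ i j k, i ≠ j → i ≠ k → j ≠ k →
        s (d i x) ≤ 1 → s (d j x) ≤ 1 → s (d k x) ≤ 1 → False) ∧
      (∀ x, 1 < s x → ∀ i j, i ≠ j → s (d i x) ≤ s x → s (d j x) ≤ s x → False) := by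
  have hdet : 1 - t ^ 2 ≠ 0 := by
    intro h
    have h1 : t ^ 2 = 1 := (sub_eq_zero.1 h).symm
    have h2 : v t ^ 2 < 1 := pow_lt_one₀ zero_le ht1 two_ne_zero
    rw [← map_pow, h1, map_one] at h2
    exact lt_irrefl _ h2
  have hvdet : v (1 - t ^ 2) = 1 := by
    apply Valuation.map_one_sub_of_lt
    rw [map_pow]
    exact pow_lt_one₀ zero_le ht1 two_ne_zero
  let g := chgA t hdet
  let F : (K × K) ≃ᵃ[K] (K × K) := (FaL (t ^ 2)⁻¹).toAffineEquiv
  let c : Bool → (K × K) ≃ᵃ[K] (K × K) := fun i => if i then g.symm.trans (F.trans g) else F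
  let s : K × K → Γ := fun z => max (v z.1) (v z.2)
  let d : Bool × Bool → K × K → K × K := fun i z => if i.2 then (c i.1).symm z else c i.1 z
  let f : Bool × Bool → K × K → K := fun i z =>
    if i.1 then (if i.2 then (g.symm z).2 else (g.symm z).1) else (if i.2 then z.2 else z.1)
  have hgs : ∀ z R, v t ≤ R → s (g z) ≤ R → s z ≤ R := by
    rintro ⟨p, q⟩ R hR hz
    have hz : max (v (t + (p + t * q))) (v (t + (t * p + q))) ≤ R := hz
    rw [max_le_iff] at hz
    obtain ⟨hz1, hz2⟩ := hz
    have h1 := v.map_sub_le hz1 hR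
    have h2 := v.map_sub_le hz2 hR
    have ht : ∀ y, v y ≤ R → v (t * y) ≤ R := by
      intro y hy
      rw [map_mul]; exact (mul_le_of_le_one_left zero_le ht1.le).trans hy
    have hp : v ((1 - t ^ 2) * p) ≤ R := by
      have := v.map_sub_le h1 (ht _ h2)
      convert this using 2; ring
    have hq : v ((1 - t ^ 2) * q) ≤ R := by
      have := v.map_sub_le h2 (ht _ h1)
      convert this using 2; ring
    rw [map_mul, hvdet, one_mul] at hp hq
    exact max_le hp hq
  have hF : ∀ z R, s z ≤ R → s (F z) ≤ R → v z.1 ≤ v t ^ 2 * R := by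
    intro z R h1 h2
    exact lemA v t ht0 z.1 z.2 R ((le_max_right _ _).trans h1) ((le_max_left _ _).trans h2)
  have hF' : ∀ z R, s z ≤ R → s (F.symm z) ≤ R → v z.2 ≤ v t ^ 2 * R := by
    intro z R h1 h2
    exact lemA v t ht0 z.2 z.1 R ((le_max_left _ _).trans h1) ((le_max_right _ _).trans h2)
  have hsmall : ∀ i z R, 1 ≤ R → s z ≤ R → s (d i z) ≤ R → v (f i z) ≤ v t ^ 2 * R := by
    rintro ⟨i, j⟩ z R hR h1 h2
    have hR' := ht1.le.trans hR
    have h3 : s (g.symm z) ≤ R := hgs _ R hR' (by simpa using h1)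
    cases i <;> cases j
    · exact hF z R h1 h2
    · exact hF' z R h1 h2
    · exact hF _ R h3 (hgs _ R hR' h2)
    · exact hF' _ R h3 (hgs _ R hR' h2)
  have hxy : ∀ z, z.1 = t + ((g.symm z).1 + t * (g.symm z).2) ∧
      z.2 = t + (t * (g.symm z).1 + (g.symm z).2) := by
    intro z
    have h : g (g.symm z) = z := by simp
    rw [show g (g.symm z) = _ from chgA_apply t hdet _] at h
    exact ⟨(congrArg Prod.fst h).symm, (congrArg Prod.snd h).symm⟩
  refine ⟨c, s, d, fun _ _ => rfl, fun _ _ => rfl, ?_, ?_⟩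
  · intro z hz i j k hij hik hjk hi hj hk
    have hi := hsmall i z 1 le_rfl hz hi
    have hj := hsmall j z 1 le_rfl hz hj
    have hk := hsmall k z 1 le_rfl hz hk
    rw [mul_one] at hi hj hk
    obtain ⟨ex, ey⟩ := hxy z
    have ex' : z.1 = t + (t * (g.symm z).2 + (g.symm z).1) := by rw [ex]; ring
    have ey' : z.2 = t + ((g.symm z).2 + t * (g.symm z).1) := by rw [ey]; ring
    have k1 := in_xyp v t ht0 ht1 _ _ _ _ ex ey
    have k2 := in_xyp v t ht0 ht1 _ _ _ _ ey' ex'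
    have k3 := in_xpq v t ht0 ht1 _ _ _ ex
    have k4 := in_xpq v t ht0 ht1 _ _ _ ey'
    exact three_of (fun i => v (f i z) ≤ v t ^ 2) (fun a b c => k1 a b c) (fun a b c => k2 b a c)
      (fun a b c => k3 a b c) (fun a b c => k4 a c b) i j k hij hik hjk hi hj hk
  · intro z hz i j hij hi hj
    have hi := hsmall i z _ hz.le le_rfl hi
    have hj := hsmall j z _ hz.le le_rfl hj
    obtain ⟨ex, ey⟩ := hxy z
    have ex' : z.1 = t + (t * (g.symm z).2 + (g.symm z).1) := by rw [ex]; ring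
    have ey' : z.2 = t + ((g.symm z).2 + t * (g.symm z).1) := by rw [ey]; ring
    have k1 := out_xp v t ht0 ht1 _ _ _ _ (s z) ex ey hz rfl
    have k2 := out_xp v t ht0 ht1 _ _ _ _ (s z) ey' ex' hz (max_comm _ _)
    have k3 := out_xq v t ht0 ht1 _ _ _ _ (s z) ex ey hz rfl
    have k4 := out_xq v t ht0 ht1 _ _ _ _ (s z) ey' ex' hz (max_comm _ _)
    have k5 := out_pq v t ht0 ht1 _ _ _ _ (s z) ex ey hz rfl
    have k6 := out_xy v t ht0 ht1 z.1 z.2 (s z) hz rfl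
    exact two_of (fun i => v (f i z) ≤ v t ^ 2 * s z) (fun a b => k6 a b) (fun a b => k1 a b) (fun a b => k3 a b)
      (fun a b => k4 a b) (fun a b => k2 a b) (fun a b => k5 a b) i j hij hi hj

section
variable {K : Type*} [Field K] (v : K → ℝ) (hv0 : v 0 = 0) (hv1 : ∀ x : K, x ≠ 0 → v x = 1)
    {X : Type*} [AddCommGroup X] [Module K X] (N : X → ℝ) (hN : IsNANorm v N)

/-- open ball as a subspace -/
def ballLt (hv0 : v 0 = 0) (hv1 : ∀ x : K, x ≠ 0 → v x = 1) (hN : IsNANorm v N)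
    (r : ℝ) (hr : 0 < r) : Submodule K X where
  carrier := {x | N x < r}
  add_mem' {x y} hx hy := (hN.2.2.2 x y).trans_lt (max_lt hx hy)
  zero_mem' := by simpa [(hN.2.1 0).2 rfl] using hr
  smul_mem' c x hx := by
    rcases eq_or_ne c 0 with rfl | hc
    · simpa [(hN.2.1 0).2 rfl] using hr
    · simpa [hN.2.2.1, hv1 c hc] using hx

include hv0 hv1 hN in
theorem finrank_le_aux [FiniteDimensional K X]
    (hno : ∀ e f : X, e ≠ 0 → N e = N f → ∃ α β : K, (α ≠ 0 ∨ β ≠ 0) ∧ N (α • e + β • f) < N e)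
    (V : Finset ℝ) : ∀ P : Submodule K X, (∀ x ∈ P, x ≠ 0 → N x ∈ V) →
      Module.finrank K P ≤ V.card := by
  induction V using Finset.induction_on_max with
  | empty =>
    intro P hP
    have : P = ⊥ := by
      rw [Submodule.eq_bot_iff]
      intro x hx
      by_contra h
      simpa using hP x hx h
    simp [this]
  | insert m V hm ih =>
    intro P hP
    rw [Finset.card_insert_of_notMem (fun h => lt_irrefl _ (hm m h))]
    by_cases hex : ∃ e ∈ P, e ≠ 0 ∧ N e = m
    · obtain ⟨e, heP, he0, hem⟩ := hex
      have hm0 : 0 < m := by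
        rw [← hem]
        exact lt_of_le_of_ne (hN.1 e) (fun h => he0 ((hN.2.1 e).1 h.symm))
      let B := ballLt v N hv0 hv1 hN m hm0
      have h1 : Module.finrank K (P ⊓ B : Submodule K X) ≤ V.card := by
        apply ih
        rintro x ⟨hxP, hxB⟩ hx0
        have hxB : N x < m := hxB
        rcases Finset.mem_insert.1 (hP x hxP hx0) with h | h
        · exact absurd h hxB.ne
        · exact h
      have h2 : P ≤ (P ⊓ B) ⊔ Submodule.span K {e} := by
        intro f hf
        by_cases hfm : N f < m
        · exact Submodule.mem_sup_left ⟨hf, hfm⟩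
        have hf0 : f ≠ 0 := by
          rintro rfl
          exact hfm (by simpa [(hN.2.1 0).2 rfl] using hm0)
        have hfm' : N f = m := by
          rcases Finset.mem_insert.1 (hP f hf hf0) with h | h
          · exact h
          · exact absurd (hm _ h) hfm
        obtain ⟨α, β, hab, hlt⟩ := hno e f he0 (hem.trans hfm'.symm)
        have hβ : β ≠ 0 := by
          rintro rfl
          have hα : α ≠ 0 := by simpa using hab
          rw [zero_smul, add_zero, hN.2.2.1, hv1 α hα, one_mul] at hlt
          exact lt_irrefl _ hlt
        have hw : α • e + β • f ∈ P ⊓ B :=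
          ⟨P.add_mem (P.smul_mem _ heP) (P.smul_mem _ hf), by rw [hem] at hlt; exact hlt⟩
        have hf' : f = β⁻¹ • (α • e + β • f) + (-(β⁻¹ * α)) • e := by
          rw [smul_add, smul_smul, smul_smul, inv_mul_cancel₀ hβ, one_smul, neg_smul]
          abel
        rw [hf']
        exact Submodule.add_mem_sup (Submodule.smul_mem _ _ hw)
          (Submodule.smul_mem _ _ (Submodule.mem_span_singleton_self e))
      have h3 := Submodule.finrank_mono h2
      have h4 := Submodule.finrank_add_le_finrank_add_finrank (P ⊓ B) (Submodule.span K {e})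
      have h5 := finrank_span_singleton (K := K) he0
      omega
    · push Not at hex
      have := ih P (fun x hx hx0 => by
        rcases Finset.mem_insert.1 (hP x hx hx0) with h | h
        · exact absurd h (hex x hx hx0)
        · exact h)
      omega

include hv0 hv1 hN in
theorem exists_split [FiniteDimensional K X]
    (hval : ∃ V : Finset ℝ, V.card < Module.finrank K X ∧ ∀ x : X, x ≠ 0 → N x ∈ V) :
    ∃ (r : ℝ) (π : X →ₗ[K] K × K) (ι : K × K →ₗ[K] X), (∀ z, π (ι z) = z) ∧
      (∀ z, N (ι z) ≤ r) ∧ ∀ x, N x < r → π x = 0 := by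
  obtain ⟨V, hV, hNV⟩ := hval
  have hex : ∃ e f : X, e ≠ 0 ∧ N e = N f ∧
      ∀ α β : K, (α ≠ 0 ∨ β ≠ 0) → N e ≤ N (α • e + β • f) := by
    by_contra hcon
    push Not at hcon
    have := finrank_le_aux v hv0 hv1 N hN (by
      intro e f he hef
      obtain ⟨α, β, h1, h2⟩ := hcon e f he hef
      exact ⟨α, β, h1, h2⟩) V ⊤ (fun x _ h => hNV x h)
    rw [finrank_top] at this
    omega
  obtain ⟨e, f, he0, hef, hab⟩ := hex
  have hr : 0 < N e := lt_of_le_of_ne (hN.1 e) (fun h => he0 ((hN.2.1 e).1 h.symm))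
  let B := ballLt v N hv0 hv1 hN (N e) hr
  let ι : K × K →ₗ[K] X := (LinearMap.toSpanSingleton K X e).coprod (LinearMap.toSpanSingleton K X f)
  have hι : ∀ z, ι z = z.1 • e + z.2 • f := fun z => by simp [ι]
  have hker : LinearMap.ker (B.mkQ ∘ₗ ι) = ⊥ := by
    rw [Submodule.eq_bot_iff]
    rintro ⟨α, β⟩ hz
    rw [LinearMap.mem_ker, LinearMap.comp_apply, Submodule.mkQ_apply,
      Submodule.Quotient.mk_eq_zero, hι] at hz
    by_contra hne
    have h : α ≠ 0 ∨ β ≠ 0 := by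
      by_contra h
      push Not at h
      exact hne (by rw [h.1, h.2]; rfl)
    exact absurd (show N (α • e + β • f) < N e from hz) (not_lt.2 (hab α β h))
  obtain ⟨g, hg⟩ := LinearMap.exists_leftInverse_of_injective _ hker
  refine ⟨N e, g ∘ₗ B.mkQ, ι, fun z => ?_, fun z => ?_, fun x hx => ?_⟩
  · exact LinearMap.congr_fun hg z
  · rw [hι]
    have hle : ∀ (α : K) x, N (α • x) ≤ N x := by
      intro α x
      rw [hN.2.2.1]
      rcases eq_or_ne α 0 with rfl | h
      · rw [hv0, zero_mul]; exact hN.1 x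
      · rw [hv1 α h, one_mul]
    exact (hN.2.2.2 _ _).trans (max_le (hle _ _) ((hle _ _).trans hef.symm.le))
  · have : B.mkQ x = 0 := (Submodule.Quotient.mk_eq_zero B).2 hx
    rw [LinearMap.comp_apply, this, map_zero]
end

def liftP {K : Type*} [Field K] {X : Type*} [AddCommGroup X] [Module K X]
    (π : X →ₗ[K] K × K) (ι : K × K →ₗ[K] X) (hπ : ∀ z, π (ι z) = z)
    (F : (K × K) ≃ᵃ[K] (K × K)) : Equiv.Perm X where
  toFun x := x + ι (F (π x) - π x)
  invFun x := x + ι (F.symm (π x) - π x)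
  left_inv x := by
    simp only [map_add, hπ]
    rw [add_sub_cancel, F.symm_apply_apply, add_assoc, ← map_add]
    simp
  right_inv x := by
    simp only [map_add, hπ]
    rw [add_sub_cancel, F.apply_symm_apply, add_assoc, ← map_add]
    simp

theorem lift_memIA {K : Type*} [Field K] (v : K → ℝ) {n : ℕ} (N : (Fin n → K) → ℝ)
    (hN : IsNANorm v N) (r : ℝ)
    (π : (Fin n → K) →ₗ[K] K × K) (ι : K × K →ₗ[K] (Fin n → K)) (hπ : ∀ z, π (ι z) = z)
    (hι : ∀ z, N (ι z) ≤ r) (hr : ∀ x, N x < r → π x = 0)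
    (F : (K × K) ≃ᵃ[K] (K × K)) : MemIA N (liftP π ι hπ F) := by
  have hdiff : ∀ (G : (K × K) ≃ᵃ[K] (K × K)) x y, (liftP π ι hπ G) x - (liftP π ι hπ G) y =
      (x - y) + ι (G.linear (π (x - y)) - π (x - y)) := by
    intro G x y
    have h : G.linear (π (x - y)) = G (π x) - G (π y) := by
      have := G.toAffineMap.linearMap_vsub (π x) (π y)
      rw [map_sub]
      exact this
    rw [h]
    simp only [liftP, Equiv.coe_fn_mk, map_sub]
    abel
  have hle : ∀ (G : (K × K) ≃ᵃ[K] (K × K)) x y,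
      N ((liftP π ι hπ G) x - (liftP π ι hπ G) y) ≤ N (x - y) := by
    intro G x y
    rw [hdiff]
    by_cases h : N (x - y) < r
    · rw [hr _ h]; simp
    · exact (hN.2.2.2 _ _).trans (max_le le_rfl ((hι _).trans (not_lt.1 h)))
  refine ⟨?_, (liftP π ι hπ F).surjective, fun x y => le_antisymm (hle F x y) ?_⟩
  · let L : (Fin n → K) →ₗ[K] (Fin n → K) :=
      LinearMap.id + ι ∘ₗ (F.linear.toLinearMap ∘ₗ π - π)
    refine ⟨LinearMap.toMatrix' L, liftP π ι hπ F 0, fun x => ?_⟩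
    rw [LinearMap.toMatrix'_mulVec, ← sub_eq_iff_eq_add, hdiff]
    simp [L]
  · have h := hle F.symm (liftP π ι hπ F x) (liftP π ι hπ F y)
    have hs : ∀ x, liftP π ι hπ F.symm (liftP π ι hπ F x) = x :=
      fun x => (liftP π ι hπ F).left_inv x
    rwa [hs, hs] at h

theorem paradox_of_matching {X : Type*} (S : Set (X → X)) (hid : id ∈ S)
    (c : Bool → Equiv.Perm X) (hc : ∀ i, ⇑(c i).symm ∈ S)
    (m : X × Bool → X) (hm : Function.Bijective m) (hR : ∀ e, m e = e.1 ∨ m e = c e.2 e.1) :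
    ParadoxicalUsing S (Set.univ : Set X) 4 := by
  let P : Bool → Fin 2 → Set X := fun i j =>
    if j = 0 then {x | m (x, i) = x} else c i '' {x | m (x, i) ≠ x}
  let g : Bool → Fin 2 → X → X := fun i j => if j = 0 then id else (c i).symm
  have hP : ∀ i j x, x ∈ P i j → ∃ y, m (y, i) = x ∧ (j = 0 ↔ m (y, i) = y) := by
    intro i j x hx
    by_cases hj : j = 0
    · simp only [P, hj, if_true] at hx
      exact ⟨x, hx, by simpa [hj] using hx⟩
    · simp only [P, hj, if_false] at hx
      obtain ⟨y, hy, rfl⟩ := hx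
      exact ⟨y, (hR (y, i)).resolve_left hy, by simpa [hj] using hy⟩
  have hdis : ∀ i i' j j', (i, j) ≠ (i', j') → Disjoint (P i j) (P i' j') := by
    intro i i' j j' hne
    rw [Set.disjoint_left]
    intro x hx hx'
    obtain ⟨y, hy, hyj⟩ := hP _ _ _ hx
    obtain ⟨y', hy', hyj'⟩ := hP _ _ _ hx'
    have h := hm.1 (hy.trans hy'.symm)
    simp only [Prod.mk.injEq] at h
    obtain ⟨rfl, rfl⟩ := h
    apply hne
    have h2 : j = 0 ↔ j' = 0 := hyj.trans hyj'.symm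
    have : j = j' := by omega
    rw [this]
  have hcov : ∀ x, ∃ i j, x ∈ P i j := by
    intro x
    obtain ⟨⟨y, i⟩, rfl⟩ := hm.2 x
    by_cases h : m (y, i) = y
    · exact ⟨i, 0, by simp [P, h]⟩
    · refine ⟨i, 1, ?_⟩
      simp only [P, one_ne_zero, if_false]
      exact ⟨y, h, ((hR (y, i)).resolve_left h).symm⟩
  have him0 : ∀ i, g i 0 '' P i 0 = {x | m (x, i) = x} := by intro i; simp [g, P]
  have him1 : ∀ i, g i 1 '' P i 1 = {x | m (x, i) = x}ᶜ := by
    intro i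
    simp only [g, P, one_ne_zero, if_false, Set.image_image, Equiv.symm_apply_apply, Set.image_id']
    rfl
  have hgd : ∀ i j j', j ≠ j' → Disjoint (g i j '' P i j) (g i j' '' P i j') := by
    intro i j j' hne
    fin_cases j <;> fin_cases j'
    · exact (hne rfl).elim
    · exact (him0 i).symm ▸ (him1 i).symm ▸ disjoint_compl_right
    · exact (him0 i).symm ▸ (him1 i).symm ▸ disjoint_compl_left
    · exact (hne rfl).elim
  have hgc : ∀ i, (⋃ j, g i j '' P i j) = Set.univ := by
    intro i
    rw [Set.eq_univ_iff_forall]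
    intro x
    rw [Set.mem_iUnion]
    by_cases h : m (x, i) = x
    · exact ⟨0, by rw [him0]; exact h⟩
    · exact ⟨1, by rw [him1]; exact h⟩
  have hgS : ∀ i j, g i j ∈ S := by
    intro i j
    by_cases h : j = 0
    · simpa [g, h] using hid
    · simpa [g, h] using hc i
  refine ⟨2, 2, by norm_num, by norm_num, by norm_num, P false, P true, g false, g true,
    hgS _, hgS _, fun _ => Set.subset_univ _, fun _ => Set.subset_univ _,
    fun j j' h => hdis _ _ _ _ (by simpa using h), fun j j' h => hdis _ _ _ _ (by simpa using h),
    fun j j' => hdis _ _ _ _ (by simp), ?_, hgd _, hgc _, hgd _, hgc _⟩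
  rw [Set.eq_univ_iff_forall]
  intro x
  obtain ⟨i, j, h⟩ := hcov x
  cases i
  · exact Or.inl (Set.mem_iUnion.2 ⟨j, h⟩)
  · exact Or.inr (Set.mem_iUnion.2 ⟨j, h⟩)

theorem statement14 {K : Type*} [Field K] (v : K → ℝ)
    -- v is the trivial valuation
    (hv0 : v 0 = 0) (hv1 : ∀ x : K, x ≠ 0 → v x = 1)
    -- K is not locally finite
    (hnlf : ∃ s : Finset K, ¬ (Subfield.closure (s : Set K) : Set K).Finite)
    (n : ℕ) (hn : 2 ≤ n) (N : (Fin n → K) → ℝ) (hN : IsNANorm v N)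
    -- N takes fewer than n nonzero values
    (hval : ∃ V : Finset ℝ, V.card < n ∧ ∀ x : Fin n → K, x ≠ 0 → N x ∈ V) :
    ParadoxicalUsing {f | MemIA N f} (Set.univ : Set (Fin n → K)) 4 := by
  obtain ⟨A, t, ht0, ht1⟩ := exists_val hnlf
  obtain ⟨c, s, d, hd0, hd1, hin, hout⟩ := plane A.valuation t ht0 ht1
  obtain ⟨r, π, ι, hπ, hι, hr⟩ := exists_split v hv0 hv1 N hN (by simpa using hval)
  have hl : ∀ F x, π (liftP π ι hπ F x) = F (π x) := by
    intro F x
    simp [liftP, hπ]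
  have hls : ∀ F x, π ((liftP π ι hπ F).symm x) = F.symm (π x) := by
    intro F x
    exact hl F.symm x
  let C : Bool → Equiv.Perm (Fin n → K) := fun i => liftP π ι hπ (c i)
  let D : Bool × Bool → (Fin n → K) → (Fin n → K) := fun i x =>
    if i.2 then (C i.1).symm x else C i.1 x
  have hD : ∀ i x, π (D i x) = d i (π x) := by
    rintro ⟨i, j⟩ x
    cases j
    · rw [hd0]; exact hl _ _
    · rw [hd1]; exact hls _ _
  obtain ⟨m, hm, hR⟩ := hall_aux C (fun x => s (π x)) 1 D (fun _ _ => rfl) (fun _ _ => rfl)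
    (by
      intro x hx i j k hij hik hjk
      simp only [hD]
      exact hin (π x) hx i j k hij hik hjk)
    (by
      intro x hx i j hij
      simp only [hD]
      exact hout (π x) hx i j hij)
  refine paradox_of_matching _ ?_ C ?_ m hm hR
  · refine ⟨⟨1, 0, fun x => by simp⟩, Function.surjective_id, fun x y => rfl⟩
  · intro i
    exact lift_memIA v N hN r π ι hπ hι hr (c i).symm
end
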